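/- Assume f satisfies the basic assumptions and hypothesis (H). Then there exists a constant c₊* > 0 with the following property: for every h₀ ∈ ℝ, every u₀ ∈ H₊(h₀) with u₀(x) ≤ p(0,x) for all x ≤ h₀ and liminf as x → −∞ of (p(0,x) − u₀(x)) > 0, and every classical solution (u,h) of the half-line free boundary problem (1.10) with this initial data (u extended by 0 for x > h(t)) such that for every C ∈ ℝ, sup over x ≤ C of |u(nω,x) − p(0,x)| → 0 as n → ∞, one has: for every c < c₊*, sup over x ≤ ct of |u(t,x) − p(t,x)| → 0 as t → ∞, and h(t)/t → c₊* as t → ∞. -/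

import Mathlib

open Filter Topology Set

noncomputable section

/-- `u` solves `u_t = d u_xx + f(t,x,u)` classically at every point `(t,x)` of the set `s`:
the spatial function is twice differentiable there and the time derivative exists and
equals `d u_xx + f(t,x,u)`. -/
def SolvesPDE (d : ℝ) (f : ℝ → ℝ → ℝ → ℝ) (u : ℝ → ℝ → ℝ) (s : Set (ℝ × ℝ)) : Prop :=
  ∀ q ∈ s,
    DifferentiableAt ℝ (u q.1) q.2 ∧
    DifferentiableAt ℝ (deriv (u q.1)) q.2 ∧
    HasDerivAt (fun t => u t q.2)
      (d * deriv (deriv (u q.1)) q.2 + f q.1 q.2 (u q.1 q.2)) q.1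

/-- Basic assumptions on the reaction term `f(t,x,u)` (for `u ≥ 0`): continuity,
Hölder continuity of class `C^{α/2,α}` in `(t,x)` locally uniformly in `u`,
`C¹` in `u` uniformly in `(t,x)`, `f(t,x,0) = 0`, nonpositivity for large `u`,
and space-time periodicity. -/
structure BasicAssumptions (ω L : ℝ) (f : ℝ → ℝ → ℝ → ℝ) : Prop where
  cont : ContinuousOn (fun q : ℝ × ℝ × ℝ => f q.1 q.2.1 q.2.2) {q : ℝ × ℝ × ℝ | 0 ≤ q.2.2}
  holder : ∃ α ∈ Set.Ioo (0:ℝ) 1, ∀ R > 0, ∃ C > 0, ∀ t s x y u : ℝ,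
    0 ≤ u → u ≤ R → |f t x u - f s y u| ≤ C * (|t - s| ^ (α / 2) + |x - y| ^ α)
  c1 : ∃ fu : ℝ → ℝ → ℝ → ℝ,
    (∀ t x u : ℝ, 0 ≤ u → HasDerivWithinAt (fun w => f t x w) (fu t x u) (Set.Ici 0) u) ∧
    ∀ ε > 0, ∃ δ > 0, ∀ t x u v : ℝ, 0 ≤ u → 0 ≤ v → |u - v| ≤ δ →
      |fu t x u - fu t x v| ≤ ε
  zero : ∀ t x : ℝ, f t x 0 = 0
  neg_large : ∃ M > 0, ∀ t x u : ℝ, M ≤ u → f t x u ≤ 0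
  per_t : ∀ t x u : ℝ, 0 ≤ u → f (t + ω) x u = f t x u
  per_x : ∀ t x u : ℝ, 0 ≤ u → f t (x + L) u = f t x u

/-- A bounded classical solution of the Cauchy problem
`v_t = d v_xx + f(t,x,v)` on `(0,∞) × ℝ` with initial datum `v₀`. -/
structure IsCauchySolution (d : ℝ) (f : ℝ → ℝ → ℝ → ℝ) (v₀ : ℝ → ℝ) (v : ℝ → ℝ → ℝ) : Prop where
  init : ∀ x, v 0 x = v₀ x
  cont : ContinuousOn (fun q : ℝ × ℝ => v q.1 q.2) {q : ℝ × ℝ | 0 ≤ q.1}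
  pde : SolvesPDE d f v {q : ℝ × ℝ | 0 < q.1}
  bdd : ∃ C, ∀ t ≥ (0:ℝ), ∀ x, |v t x| ≤ C

/-- Hypothesis (H): `p` is the unique positive space-time periodic solution of
`p_t = d p_xx + f(t,x,p)`, and every bounded solution of the Cauchy problem with
initial datum bounded below by a positive constant converges to `p` uniformly. -/
structure HypH (d ω L : ℝ) (f : ℝ → ℝ → ℝ → ℝ) (p : ℝ → ℝ → ℝ) : Prop where
  pos : ∀ t x, 0 < p t x
  per_t : ∀ t x, p (t + ω) x = p t x
  per_x : ∀ t x, p t (x + L) = p t x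
  sol : SolvesPDE d f p Set.univ
  uniq : ∀ q : ℝ → ℝ → ℝ, (∀ t x, 0 < q t x) → (∀ t x, q (t + ω) x = q t x) →
    (∀ t x, q t (x + L) = q t x) → SolvesPDE d f q Set.univ → q = p
  conv : ∀ v₀ : ℝ → ℝ, Continuous v₀ → (∃ C, ∀ x, |v₀ x| ≤ C) →
    (∃ ε > 0, ∀ x, ε ≤ v₀ x) →
    ∀ v : ℝ → ℝ → ℝ, IsCauchySolution d f v₀ v →
    ∀ ε > 0, ∃ S, ∀ s ≥ S, ∀ t ≥ (0:ℝ), ∀ x : ℝ, |v (t + s) x - p (t + s) x| ≤ ε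

/-- The class `H₊(h₀)` of admissible initial data on `(-∞, h₀]`. -/
def memHplus (h₀ : ℝ) (φ : ℝ → ℝ) : Prop :=
  ContinuousOn φ (Set.Iic h₀) ∧ (∃ C, ∀ x ≤ h₀, |φ x| ≤ C) ∧ φ h₀ = 0 ∧ ∀ x < h₀, 0 < φ x

/-- A classical solution `(u, h)` of the half-line free boundary problem (1.10)
with Stefan constant `μ` and initial data `u₀ ∈ H₊(h₀)`, with `u` extended by `0`
for `x > h(t)`. -/
structure IsHalfFBPSolution (d μ : ℝ) (f : ℝ → ℝ → ℝ → ℝ) (h₀ : ℝ) (u₀ : ℝ → ℝ)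
    (u : ℝ → ℝ → ℝ) (h : ℝ → ℝ) : Prop where
  h_init : h 0 = h₀
  h_smooth : ContDiffOn ℝ 1 h (Set.Ici 0)
  bdd : ∃ C, ∀ t ≥ (0:ℝ), ∀ x, |u t x| ≤ C
  u_cont : ContinuousOn (fun q : ℝ × ℝ => u q.1 q.2) {q : ℝ × ℝ | 0 ≤ q.1 ∧ q.2 ≤ h q.1}
  pde : SolvesPDE d f u {q : ℝ × ℝ | 0 < q.1 ∧ q.2 < h q.1}
  bc : ∀ t > (0:ℝ), u t (h t) = 0
  stefan : ∀ t > (0:ℝ),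
    HasDerivAt h (-μ * derivWithin (u t) (Set.Iic (h t)) (h t)) t
  init : ∀ x ≤ h₀, u 0 x = u₀ x
  ext : ∀ t ≥ (0:ℝ), ∀ x : ℝ, h t < x → u t x = 0

section

/-- one-sided-in-time second order jet of `w` at `(t,x)` -/
def Jet (w : ℝ → ℝ → ℝ) (t x wt wxx : ℝ) : Prop :=
  HasDerivWithinAt (fun s => w s x) wt (Iic t) t ∧
  ∃ w1 : ℝ → ℝ, (∀ᶠ y in 𝓝 x, HasDerivAt (w t) (w1 y) y) ∧ HasDerivAt w1 wxx x

lemma Jet.add {v w : ℝ → ℝ → ℝ} {t x vt vxx wt wxx : ℝ} (hv : Jet v t x vt vxx)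
    (hw : Jet w t x wt wxx) : Jet (fun s y => v s y + w s y) t x (vt + wt) (vxx + wxx) := by
  obtain ⟨h1, v1, h2, h3⟩ := hv
  obtain ⟨k1, w1, k2, k3⟩ := hw
  refine ⟨h1.add k1, fun y => v1 y + w1 y, ?_, h3.add k3⟩
  filter_upwards [h2, k2] with y hy ky using hy.add ky

lemma Jet.sub {v w : ℝ → ℝ → ℝ} {t x vt vxx wt wxx : ℝ} (hv : Jet v t x vt vxx)
    (hw : Jet w t x wt wxx) : Jet (fun s y => v s y - w s y) t x (vt - wt) (vxx - wxx) := by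
  obtain ⟨h1, v1, h2, h3⟩ := hv
  obtain ⟨k1, w1, k2, k3⟩ := hw
  refine ⟨h1.sub k1, fun y => v1 y - w1 y, ?_, h3.sub k3⟩
  filter_upwards [h2, k2] with y hy ky using hy.sub ky

lemma Jet.prod {T X X1 : ℝ → ℝ} {t x Tt Xxx : ℝ} (hT : HasDerivAt T Tt t)
    (hX : ∀ y, HasDerivAt X (X1 y) y) (hX2 : HasDerivAt X1 Xxx x) :
    Jet (fun s y => T s * X y) t x (Tt * X x) (T t * Xxx) := by
  refine ⟨(hT.mul_const _).hasDerivWithinAt, fun y => T t * X1 y, ?_, hX2.const_mul _⟩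
  exact Eventually.of_forall fun y => (hX y).const_mul _

/-- time factor times a jet -/
lemma Jet.tmul {T : ℝ → ℝ} {v : ℝ → ℝ → ℝ} {t x Tt vt vxx : ℝ} (hT : HasDerivAt T Tt t)
    (hv : Jet v t x vt vxx) :
    Jet (fun s y => T s * v s y) t x (Tt * v t x + T t * vt) (T t * vxx) := by
  obtain ⟨h1, v1, h2, h3⟩ := hv
  refine ⟨(hT.hasDerivWithinAt.mul h1), fun y => T t * v1 y, ?_, h3.const_mul _⟩
  filter_upwards [h2] with y hy using hy.const_mul _

lemma Jet.cmul {v : ℝ → ℝ → ℝ} {t x vt vxx : ℝ} (c : ℝ)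
    (hv : Jet v t x vt vxx) : Jet (fun s y => c * v s y) t x (c * vt) (c * vxx) := by
  have := Jet.tmul (hasDerivAt_const t c) hv
  simpa using this

lemma Jet.const (c t x : ℝ) : Jet (fun _ _ => c) t x 0 0 :=
  ⟨hasDerivWithinAt_const _ _ _, fun _ => 0,
    Eventually.of_forall fun _ => hasDerivAt_const _ _, hasDerivAt_const _ _⟩

lemma Jet.exp (a b c t x : ℝ) : Jet (fun s y => Real.exp (a + b * s + c * y)) t x
    (b * Real.exp (a + b * t + c * x)) (c ^ 2 * Real.exp (a + b * t + c * x)) := by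
  refine ⟨HasDerivAt.hasDerivWithinAt ?_, fun y => c * Real.exp (a + b * t + c * y), ?_, ?_⟩
  · have : HasDerivAt (fun s => a + b * s + c * x) b t := by
      have := (((hasDerivAt_id t).const_mul b).const_add a).add_const (c * x)
      simpa using this
    have := this.exp
    simpa [mul_comm] using this
  · refine Eventually.of_forall fun y => ?_
    have : HasDerivAt (fun s => a + b * t + c * s) c y := by
      have := (((hasDerivAt_id y).const_mul c).const_add (a + b * t))
      simpa using this
    have := this.exp
    simpa [mul_comm] using this
  · have : HasDerivAt (fun s => a + b * t + c * s) c x := by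
      have := (((hasDerivAt_id x).const_mul c).const_add (a + b * t))
      simpa using this
    have := this.exp.const_mul c
    rw [show c ^ 2 * Real.exp (a + b * t + c * x) = c * (Real.exp (a + b * t + c * x) * c) by ring]
    exact this

lemma jet_of_solves {d : ℝ} {f : ℝ → ℝ → ℝ → ℝ} {u : ℝ → ℝ → ℝ} {s : Set (ℝ × ℝ)}
    (hu : SolvesPDE d f u s) {t x : ℝ} (hn : ∀ᶠ y in 𝓝 x, (t, y) ∈ s) :
    ∃ uxx, Jet u t x (d * uxx + f t x (u t x)) uxx := by
  refine ⟨deriv (deriv (u t)) x, ?_, deriv (u t), ?_, ?_⟩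
  · exact (hu (t, x) hn.self_of_nhds).2.2.hasDerivWithinAt
  · filter_upwards [hn] with y hy using (hu (t, y) hy).1.hasDerivAt
  · exact (hu (t, x) hn.self_of_nhds).2.1.hasDerivAt

/-- second derivative test -/
lemma second_deriv_test {g g1 : ℝ → ℝ} {x gxx : ℝ} (h1 : ∀ᶠ y in 𝓝 x, HasDerivAt g (g1 y) y)
    (h2 : HasDerivAt g1 gxx x) (hm : IsLocalMax g x) : gxx ≤ 0 := by
  by_contra hneg
  push Not at hneg
  have e1 : deriv g =ᶠ[𝓝 x] g1 := by
    filter_upwards [h1] with y hy using hy.deriv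
  have e2 : deriv (deriv g) x = gxx := by rw [e1.deriv_eq]; exact h2.deriv
  have hmin : IsLocalMin g x := by
    apply isLocalMin_of_deriv_deriv_pos
    · rw [e2]; exact hneg
    · exact hm.deriv_eq_zero
    · exact h1.self_of_nhds.continuousAt
  have hc : g =ᶠ[𝓝 x] fun _ => g x := by
    filter_upwards [hm, hmin] with y a b using le_antisymm a b
  have e3 : deriv g =ᶠ[𝓝 x] fun _ => 0 := by
    have := hc.deriv
    simpa using this
  have : deriv (deriv g) x = 0 := by rw [e3.deriv_eq]; simp
  linarith

/-- left derivative at a left-max is nonnegative -/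
lemma left_deriv_test {g : ℝ → ℝ} {t gt : ℝ} (h1 : HasDerivWithinAt g gt (Iic t) t)
    (hm : ∀ᶠ s in 𝓝[≤] t, g s ≤ g t) : 0 ≤ gt := by
  have h2 : HasDerivWithinAt g gt (Iio t) t := h1.mono Iio_subset_Iic_self
  rw [hasDerivWithinAt_iff_tendsto_slope' (by simp)] at h2
  refine ge_of_tendsto h2 ?_
  have hm2 : ∀ᶠ s in 𝓝[<] t, g s ≤ g t :=
    hm.filter_mono (nhdsWithin_mono _ Iio_subset_Iic_self)
  filter_upwards [hm2, self_mem_nhdsWithin] with s hs hst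
  rw [slope_def_field]
  have : s < t := hst
  apply div_nonneg_of_nonpos <;> linarith

/-- The basic maximum principle. -/
theorem maxPrinciple {d K T B : ℝ} (hd : 0 ≤ d) (Ω : Set (ℝ × ℝ)) (hΩ : IsClosed Ω)
    (hT : ∀ q ∈ Ω, 0 ≤ q.1 ∧ q.1 ≤ T) (w : ℝ → ℝ → ℝ)
    (hc : ContinuousOn (fun q : ℝ × ℝ => w q.1 q.2) Ω)
    (hB : ∀ q ∈ Ω, w q.1 q.2 ≤ B)
    (hsub : ∀ t x, (t, x) ∈ Ω → 0 < w t x →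
      (∀ᶠ y in 𝓝 x, (t, y) ∈ Ω) ∧ (∀ᶠ s in 𝓝[≤] t, (s, x) ∈ Ω) ∧
      ∃ wt wxx, Jet w t x wt wxx ∧ wt ≤ d * wxx + K * w t x) :
    ∀ t x, (t, x) ∈ Ω → w t x ≤ 0 := by
  intro t1 x1 hq1
  by_contra hpos
  push Not at hpos
  set D : ℝ := |K| + 1 with hD
  -- penalized function
  have hE : 0 < Real.exp (-D * t1) * w t1 x1 := by positivity
  obtain ⟨ε, hε, hε1⟩ : ∃ ε > 0, 0 < Real.exp (-D * t1) * w t1 x1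
      - ε * (x1 ^ 2 + (2 * d + 1) * t1) := by
    set a := Real.exp (-D * t1) * w t1 x1
    have hb : 0 ≤ x1 ^ 2 + (2 * d + 1) * t1 := by
      have := (hT _ hq1).1
      simp only at this
      positivity
    set b := x1 ^ 2 + (2 * d + 1) * t1
    refine ⟨a / (b + 1), by positivity, ?_⟩
    have : a / (b + 1) * b < a := by
      rw [div_mul_eq_mul_div, div_lt_iff₀ (by positivity)]
      nlinarith
    linarith
  set z : ℝ × ℝ → ℝ := fun q => Real.exp (-D * q.1) * w q.1 q.2
      - ε * (q.2 ^ 2 + (2 * d + 1) * q.1) with hz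
  set z1 := z (t1, x1) with hz1
  have hz1pos : 0 < z1 := hε1
  set ρ : ℝ := |B| / ε + 1 + |x1| with hρ
  have hρ1 : 1 ≤ ρ := by
    have : 0 ≤ |B| / ε := by positivity
    have := abs_nonneg x1
    linarith
  set C : Set (ℝ × ℝ) := Ω ∩ (Icc 0 T ×ˢ Icc (-ρ) ρ) with hC
  have hCc : IsCompact C := (isCompact_Icc.prod isCompact_Icc).inter_left hΩ
  have hq1C : (t1, x1) ∈ C := by
    refine ⟨hq1, ⟨(hT _ hq1).1, (hT _ hq1).2⟩, ?_⟩
    have : |x1| ≤ ρ := by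
      have : 0 ≤ |B| / ε := by positivity
      linarith
    exact abs_le.1 this
  have hzc : ContinuousOn z C := by
    apply ContinuousOn.sub
    · apply ContinuousOn.mul
      · fun_prop
      · exact hc.mono inter_subset_left
    · fun_prop
  obtain ⟨⟨t0, x0⟩, hq0, hmax⟩ := hCc.exists_isMaxOn ⟨_, hq1C⟩ hzc
  have hz0 : 0 < z (t0, x0) := lt_of_lt_of_le hz1pos (hmax hq1C)
  have ht0 : 0 ≤ t0 := (hT _ hq0.1).1
  have hw0 : 0 < w t0 x0 := by
    have h1 : 0 < Real.exp (-D * t0) * w t0 x0 := by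
      have : z (t0, x0) = Real.exp (-D * t0) * w t0 x0 - ε * (x0 ^ 2 + (2 * d + 1) * t0) := rfl
      have h2 : 0 ≤ ε * (x0 ^ 2 + (2 * d + 1) * t0) := by positivity
      linarith
    exact (pos_iff_pos_of_mul_pos h1).1 (Real.exp_pos _)
  -- global max on Ω
  have hglob : ∀ q ∈ Ω, z q ≤ z (t0, x0) := by
    rintro ⟨t, x⟩ hq
    by_cases hx : |x| ≤ ρ
    · exact hmax ⟨hq, ⟨(hT _ hq).1, (hT _ hq).2⟩, abs_le.1 hx⟩
    · push Not at hx
      have ht : 0 ≤ t := (hT _ hq).1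
      have h1 : Real.exp (-D * t) * w t x ≤ |B| := by
        have hwB : w t x ≤ |B| := (hB _ hq).trans (le_abs_self _)
        have he : Real.exp (-D * t) ≤ 1 := by
          rw [Real.exp_le_one_iff]
          have : 0 ≤ D := by positivity
          nlinarith
        have he0 := Real.exp_pos (-D * t)
        have := abs_nonneg B
        calc Real.exp (-D * t) * w t x ≤ Real.exp (-D * t) * |B| := by gcongr
          _ ≤ 1 * |B| := by gcongr
          _ = |B| := one_mul _
      have h2 : |B| ≤ ε * x ^ 2 := by
        have h3 : |B| / ε ≤ x ^ 2 := by
          have : |B| / ε ≤ ρ := by have := abs_nonneg x1; linarith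
          have : ρ ≤ x ^ 2 := by
            rw [← sq_abs x]; nlinarith
          linarith
        rw [div_le_iff₀ hε] at h3
        linarith
      have h3 : z (t, x) ≤ 0 := by
        have : z (t, x) = Real.exp (-D * t) * w t x - ε * (x ^ 2 + (2 * d + 1) * t) := rfl
        have h4 : 0 ≤ ε * ((2 * d + 1) * t) := by positivity
        rw [this]; linarith
      linarith
  obtain ⟨hy, hs, wt, wxx, hjet, hle⟩ := hsub t0 x0 hq0.1 hw0
  have hJ : Jet (fun s y => Real.exp (-D * s) * w s y
      - (ε * (y ^ 2 + (2 * d + 1) * s))) t0 x0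
      ((-D * Real.exp (-D * t0)) * w t0 x0 + Real.exp (-D * t0) * wt - ε * (2 * d + 1))
      (Real.exp (-D * t0) * wxx - ε * 2) := by
    apply Jet.sub
    · apply Jet.tmul _ hjet
      have : HasDerivAt (fun s => -D * s) (-D) t0 := by
        simpa using (hasDerivAt_id t0).const_mul (-D)
      have := this.exp
      simpa [mul_comm] using this
    · refine ⟨HasDerivAt.hasDerivWithinAt ?_, fun y => ε * (2 * y), ?_, ?_⟩
      · have := (((hasDerivAt_id t0).const_mul (2 * d + 1)).const_add (x0 ^ 2)).const_mul ε
        simpa using this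
      · refine Eventually.of_forall fun y => ?_
        have := ((hasDerivAt_pow 2 y).add_const ((2 * d + 1) * t0)).const_mul ε
        simpa using this
      · have := ((hasDerivAt_id x0).const_mul 2).const_mul ε
        simpa using this
  obtain ⟨j1, z1', j2, j3⟩ := hJ
  have k1 := left_deriv_test j1 (by
    filter_upwards [hs] with s hs
    exact hglob (s, x0) hs)
  have k2 := second_deriv_test j2 j3 (by
    filter_upwards [hy] with y hy
    exact hglob (t0, y) hy)
  have hexp := Real.exp_pos (-D * t0)
  set e := Real.exp (-D * t0)
  have : K ≤ |K| := le_abs_self K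
  have h5 : e * wt ≤ e * (d * wxx + K * w t0 x0) := by gcongr
  have h6 : d * (e * wxx) ≤ d * (ε * 2) := by
    apply mul_le_mul_of_nonneg_left _ hd
    linarith
  have h7 : 0 < e * w t0 x0 := by positivity
  have h8 : K * (e * w t0 x0) ≤ |K| * (e * w t0 x0) := by gcongr
  rw [hD] at k1
  nlinarith

end

section

lemma f_bdd {ω L : ℝ} {f : ℝ → ℝ → ℝ → ℝ} (hω : 0 < ω) (hL : 0 < L)
    (hf : BasicAssumptions ω L f) (R : ℝ) :
    ∃ B : ℝ, 0 ≤ B ∧ ∀ t x u : ℝ, 0 ≤ u → u ≤ R → |f t x u| ≤ B := by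
  have hc : IsCompact (Icc 0 ω ×ˢ Icc 0 L ×ˢ Icc 0 R : Set (ℝ × ℝ × ℝ)) :=
    isCompact_Icc.prod (isCompact_Icc.prod isCompact_Icc)
  obtain ⟨B, hB⟩ := hc.exists_bound_of_continuousOn
    (hf.cont.mono (by rintro ⟨t, x, u⟩ ⟨-, -, h⟩; exact h.1))
  refine ⟨|B|, abs_nonneg _, fun t x u hu0 hu1 => ?_⟩
  have p1 : Function.Periodic (fun t => f t x u) ω := fun t => hf.per_t t x u hu0
  obtain ⟨t', ht', e1⟩ := p1.exists_mem_Ico₀ hω t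
  have p2 : Function.Periodic (fun x => f t' x u) L := fun x => hf.per_x t' x u hu0
  obtain ⟨x', hx', e2⟩ := p2.exists_mem_Ico₀ hL x
  have e : f t x u = f t' x' u := Eq.trans e1 e2
  rw [e]
  have := hB (t', x', u) ⟨⟨ht'.1, ht'.2.le⟩, ⟨hx'.1, hx'.2.le⟩, hu0, hu1⟩
  exact this.trans (le_abs_self _)

lemma f_lip {ω L : ℝ} {f : ℝ → ℝ → ℝ → ℝ} (hω : 0 < ω) (hL : 0 < L)
    (hf : BasicAssumptions ω L f) (R : ℝ) :
    ∃ K : ℝ, 0 < K ∧ ∀ t x u v : ℝ, 0 ≤ u → u ≤ R → 0 ≤ v → v ≤ R →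
      |f t x u - f t x v| ≤ K * |u - v| := by
  obtain ⟨fu, h1, h2⟩ := hf.c1
  obtain ⟨δ0, hδ0, h3⟩ := h2 1 one_pos
  set δ := min δ0 1 with hδ
  have hδp : 0 < δ := lt_min hδ0 one_pos
  obtain ⟨B, hB0, hB⟩ := f_bdd hω hL hf (R + 1)
  refine ⟨2 * B / δ + 1, by positivity, ?_⟩
  have key : ∀ t x u, 0 ≤ u → u ≤ R → |fu t x u| ≤ 2 * B / δ + 1 := by
    intro t x u hu0 hu1
    obtain ⟨ξ, hξ, e⟩ := exists_hasDerivAt_eq_slope (fun w => f t x w) (fun w => fu t x w)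
      (show u < u + δ by linarith)
      (fun w hw => ((h1 t x w (hu0.trans hw.1)).continuousWithinAt).mono
        (fun z hz => hu0.trans hz.1))
      (fun w hw => (h1 t x w (hu0.trans hw.1.le)).hasDerivAt
        (Ici_mem_nhds (lt_of_le_of_lt hu0 hw.1)))
    have b1 := hB t x u hu0 (by linarith)
    have b2 := hB t x (u + δ) (by linarith) (by
      have : δ ≤ 1 := min_le_right _ _
      linarith)
    have e2 : |fu t x ξ| ≤ 2 * B / δ := by
      rw [e, add_sub_cancel_left, abs_div, abs_of_pos hδp]
      gcongr
      have := abs_sub (f t x (u + δ)) (f t x u)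
      linarith
    have e3 := h3 t x u ξ hu0 (hu0.trans hξ.1.le) (by
      rw [abs_sub_comm, abs_of_pos (by linarith [hξ.1])]
      have : δ ≤ δ0 := min_le_left _ _
      linarith [hξ.2])
    have := abs_sub_abs_le_abs_sub (fu t x u) (fu t x ξ)
    linarith
  intro t x u v hu0 hu1 hv0 hv1
  have := (convex_Icc (0:ℝ) R).norm_image_sub_le_of_norm_hasDerivWithin_le
    (f := fun w => f t x w) (f' := fun w => fu t x w) (C := 2 * B / δ + 1)
    (fun w hw => (h1 t x w hw.1).mono (fun z hz => hz.1))
    (fun w hw => key t x w hw.1 hw.2) (x := v) (y := u) ⟨hv0, hv1⟩ ⟨hu0, hu1⟩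
  exact this

end

section

open MeasureTheory

/-- Gaussian-dominated continuous kernels -/
structure Ker (k : ℝ → ℝ) : Prop where
  cont : Continuous k
  dom : ∃ C, 0 ≤ C ∧ ∀ z, |k z| ≤ C * Real.exp (-(1/4) * z ^ 2)

def GA (k : ℝ → ℝ) (σ : ℝ) (g : ℝ → ℝ) (x : ℝ) : ℝ := ∫ z, k z * g (x + σ * z)

lemma gauss_int {b : ℝ} (hb : 0 < b) : Integrable (fun z : ℝ => Real.exp (-b * z ^ 2)) :=
  integrable_exp_neg_mul_sq hb

lemma Ker.integrable {k : ℝ → ℝ} (hk : Ker k) : Integrable k := by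
  obtain ⟨C, -, h⟩ := hk.dom
  exact ((gauss_int (by norm_num : (0:ℝ) < 1/4)).const_mul C).mono'
    hk.cont.aestronglyMeasurable (Eventually.of_forall fun z => h z)

lemma Ker.integrable_mul {k : ℝ → ℝ} (hk : Ker k) {g : ℝ → ℝ} (hg : Continuous g) {B : ℝ}
    (hB : ∀ y, |g y| ≤ B) (σ x : ℝ) : Integrable (fun z => k z * g (x + σ * z)) := by
  refine (hk.integrable.norm.mul_const B).mono' ?_ ?_
  · exact (hk.cont.mul (hg.comp (by fun_prop))).aestronglyMeasurable
  · refine Eventually.of_forall fun z => ?_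
    rw [norm_mul]
    exact mul_le_mul_of_nonneg_left (hB _) (norm_nonneg _)

lemma GA_bound {k : ℝ → ℝ} (hk : Ker k) {g : ℝ → ℝ} {B : ℝ}
    (hB : ∀ y, |g y| ≤ B) (σ x : ℝ) : |GA k σ g x| ≤ (∫ z, |k z|) * B := by
  rw [GA, show (∫ z, |k z|) * B = ∫ z, |k z| * B from (integral_mul_const B _).symm,
    ← Real.norm_eq_abs]
  refine norm_integral_le_of_norm_le (hk.integrable.norm.mul_const B) ?_
  refine Eventually.of_forall fun z => ?_
  rw [norm_mul]
  exact mul_le_mul_of_nonneg_left (hB _) (norm_nonneg _)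

lemma GA_cont {X : Type*} [TopologicalSpace X] [FirstCountableTopology X]
    {k : ℝ → ℝ} (hk : Ker k) {G : X → ℝ → ℝ}
    (hG : Continuous (fun q : X × ℝ => G q.1 q.2)) {B : ℝ} (hB : ∀ q y, |G q y| ≤ B)
    {σ x : X → ℝ} (hσ : Continuous σ) (hx : Continuous x) :
    Continuous (fun q => GA k (σ q) (G q) (x q)) := by
  unfold GA
  refine continuous_of_dominated (bound := fun z => |k z| * B) ?_ ?_ ?_ ?_
  · intro q
    have : Continuous (fun z => G q (x q + σ q * z)) :=
      hG.comp (f := fun z => (q, x q + σ q * z)) (by fun_prop)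
    exact (hk.cont.mul this).aestronglyMeasurable
  · intro q
    refine Eventually.of_forall fun z => ?_
    rw [norm_mul]
    exact mul_le_mul_of_nonneg_left (hB _ _) (norm_nonneg _)
  · exact hk.integrable.norm.mul_const B
  · refine Eventually.of_forall fun z => ?_
    exact continuous_const.mul (hG.comp (f := fun q => (q, x q + σ q * z)) (by fun_prop))

lemma GA_kernel_form {k g : ℝ → ℝ} {σ : ℝ} (hσ : 0 < σ) (x : ℝ) :
    GA k σ g x = ∫ y, (σ⁻¹ * k ((y - x) / σ)) * g y := by
  have h1 : (∫ y, (σ⁻¹ * k ((y - x) / σ)) * g y)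
      = ∫ y, (σ⁻¹ * k (y / σ)) * g (x + y) := by
    rw [← integral_add_left_eq_self _ x]
    simp
  have h2 := Measure.integral_comp_mul_left (fun y => (σ⁻¹ * k (y / σ)) * g (x + y)) σ
  rw [h1, GA]
  have h3 : (∫ y, (σ⁻¹ * k (y / σ)) * g (x + y))
      = σ * ∫ z, (σ⁻¹ * k (σ * z / σ)) * g (x + σ * z) := by
    rw [h2, smul_eq_mul, abs_of_pos (by positivity)]
    field_simp
  rw [h3, ← integral_const_mul]
  congr 1
  ext z
  field_simp

lemma exp_dom (x0 y x σ σ0 : ℝ) (hσ0 : 0 < σ0) (hσ : 0 < σ) (hσ1 : σ ≤ 2 * σ0)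
    (hx : |x - x0| ≤ σ) :
    Real.exp (-(1/4) * ((y - x) / σ) ^ 2)
      ≤ Real.exp (1/4) * Real.exp (-(1 / (32 * σ0 ^ 2)) * (y - x0) ^ 2) := by
  rw [← Real.exp_add]
  apply Real.exp_le_exp.2
  have h1 : ((x - x0) / σ) ^ 2 ≤ 1 := by
    rw [div_pow, div_le_one (by positivity), ← sq_abs (x - x0)]
    gcongr
  have h2 : (y - x0) ^ 2 / (4 * σ0 ^ 2) ≤ ((y - x0) / σ) ^ 2 := by
    rw [div_pow]
    gcongr
    nlinarith
  have h3 : (y - x0) / σ = (y - x) / σ + (x - x0) / σ := by rw [← add_div]; congr 1; ring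
  have h4 : ((y - x0) / σ) ^ 2 ≤ 2 * ((y - x) / σ) ^ 2 + 2 * ((x - x0) / σ) ^ 2 := by
    rw [h3]
    nlinarith [sq_nonneg ((y - x) / σ - (x - x0) / σ)]
  have h5 : 1 / (32 * σ0 ^ 2) * (y - x0) ^ 2 = (1/8) * ((y - x0) ^ 2 / (4 * σ0 ^ 2)) := by
    field_simp; ring
  linarith

lemma gauss_int_shift {b : ℝ} (hb : 0 < b) (x0 C : ℝ) :
    Integrable (fun y : ℝ => C * Real.exp (-b * (y - x0) ^ 2)) :=
  ((gauss_int hb).comp_sub_right x0).const_mul C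

lemma GA_deriv_x {k k' : ℝ → ℝ} (hk : Ker k) (hk' : Ker k')
    (hd : ∀ z, HasDerivAt k (k' z) z) {g : ℝ → ℝ} (hg : Continuous g) {B : ℝ}
    (hB : ∀ y, |g y| ≤ B) {σ : ℝ} (hσ : 0 < σ) (x : ℝ) :
    HasDerivAt (GA k σ g) (-σ⁻¹ * GA k' σ g x) x := by
  obtain ⟨C, hC0, hC⟩ := hk'.dom
  have e : GA k σ g = fun x => ∫ y, (σ⁻¹ * k ((y - x) / σ)) * g y := by
    ext x; exact GA_kernel_form hσ x
  rw [e, GA_kernel_form hσ x, ← integral_const_mul]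
  have hB0 : 0 ≤ B := (abs_nonneg _).trans (hB 0)
  have hcont : ∀ x, Continuous (fun y => (σ⁻¹ * k ((y - x) / σ)) * g y) := fun x =>
    (continuous_const.mul (hk.cont.comp (by fun_prop))).mul hg
  have := hasDerivAt_integral_of_dominated_loc_of_deriv_le (μ := volume)
    (F := fun x y => (σ⁻¹ * k ((y - x) / σ)) * g y)
    (F' := fun x y => -σ⁻¹ * ((σ⁻¹ * k' ((y - x) / σ)) * g y)) (x₀ := x)
    (s := Metric.ball x σ)
    (bound := fun y => (σ⁻¹ * σ⁻¹ * C * Real.exp (1/4) * B)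
      * Real.exp (-(1 / (32 * σ ^ 2)) * (y - x) ^ 2))
    (Metric.ball_mem_nhds x hσ) ?_ ?_ ?_ ?_ ?_ ?_
  · exact this.2
  · exact Eventually.of_forall fun x => (hcont x).aestronglyMeasurable
  · obtain ⟨C', hC0', hC'⟩ := hk.dom
    refine (gauss_int_shift (b := 1 / (32 * σ ^ 2)) (by positivity) x
      (σ⁻¹ * C' * Real.exp (1/4) * B)).mono' (hcont x).aestronglyMeasurable ?_
    refine Eventually.of_forall fun y => ?_
    have := exp_dom x y x σ σ hσ hσ (by linarith) (by simpa using hσ.le)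
    have h2 := hC' ((y - x) / σ)
    rw [Real.norm_eq_abs, abs_mul, abs_mul, abs_of_pos (show 0 < σ⁻¹ by positivity)]
    calc σ⁻¹ * |k ((y - x) / σ)| * |g y|
        ≤ σ⁻¹ * (C' * (Real.exp (1/4) * Real.exp (-(1 / (32 * σ ^ 2)) * (y - x) ^ 2))) * B := by
          gcongr
          · exact h2.trans (by gcongr)
          · exact hB y
      _ = _ := by ring
  · exact (continuous_const.mul ((continuous_const.mul
      (hk'.cont.comp (by fun_prop))).mul hg)).aestronglyMeasurable
  · refine Eventually.of_forall fun y x' hx' => ?_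
    rw [Metric.mem_ball, Real.dist_eq] at hx'
    have := exp_dom x y x' σ σ hσ hσ (by linarith) hx'.le
    have h2 := hC ((y - x') / σ)
    rw [Real.norm_eq_abs, abs_mul, abs_mul, abs_mul, abs_neg,
      abs_of_pos (show 0 < σ⁻¹ by positivity)]
    calc σ⁻¹ * (σ⁻¹ * |k' ((y - x') / σ)| * |g y|)
        ≤ σ⁻¹ * (σ⁻¹ * (C * (Real.exp (1/4)
          * Real.exp (-(1 / (32 * σ ^ 2)) * (y - x) ^ 2))) * B) := by
          gcongr
          · exact h2.trans (by gcongr)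
          · exact hB y
      _ = _ := by ring
  · exact gauss_int_shift (by positivity) _ _
  · refine Eventually.of_forall fun y x' _ => ?_
    have h1 : HasDerivAt (fun x => (y - x) / σ) (-σ⁻¹) x' := by
      have := ((hasDerivAt_id x').const_sub y).div_const σ
      simpa [neg_div] using this
    have h2 := (((hd ((y - x') / σ)).comp x' h1).const_mul σ⁻¹).mul_const (g y)
    refine h2.congr_deriv ?_
    ring

lemma GA_deriv_σ {k k' : ℝ → ℝ} (hk : Ker k) (hk' : Ker (fun z => k z + z * k' z))
    (hd : ∀ z, HasDerivAt k (k' z) z) {g : ℝ → ℝ} (hg : Continuous g) {B : ℝ}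
    (hB : ∀ y, |g y| ≤ B) {σ : ℝ} (hσ : 0 < σ) (x : ℝ) :
    HasDerivAt (fun σ => GA k σ g x) (-σ⁻¹ * GA (fun z => k z + z * k' z) σ g x) σ := by
  obtain ⟨C, hC0, hC⟩ := hk'.dom
  have e : (fun σ => GA k σ g x) =ᶠ[𝓝 σ]
      fun σ => ∫ y, (σ⁻¹ * k ((y - x) / σ)) * g y := by
    filter_upwards [Ioi_mem_nhds hσ] with s hs
    exact GA_kernel_form hs x
  refine HasDerivAt.congr_of_eventuallyEq ?_ e
  rw [GA_kernel_form hσ x, ← integral_const_mul]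
  have hB0 : 0 ≤ B := (abs_nonneg _).trans (hB 0)
  have hcont : ∀ σ, Continuous (fun y => (σ⁻¹ * k ((y - x) / σ)) * g y) := fun x =>
    (continuous_const.mul (hk.cont.comp (by fun_prop))).mul hg
  have := hasDerivAt_integral_of_dominated_loc_of_deriv_le (μ := volume)
    (F := fun σ y => (σ⁻¹ * k ((y - x) / σ)) * g y)
    (F' := fun σ y => -σ⁻¹ * ((σ⁻¹ * (k ((y - x) / σ) + (y - x) / σ * k' ((y - x) / σ))) * g y))
    (x₀ := σ) (s := Ioo (σ / 2) (2 * σ))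
    (bound := fun y => ((σ/2)⁻¹ * (σ/2)⁻¹ * C * Real.exp (1/4) * B)
      * Real.exp (-(1 / (32 * σ ^ 2)) * (y - x) ^ 2))
    (Ioo_mem_nhds (by linarith) (by linarith)) ?_ ?_ ?_ ?_ ?_ ?_
  · exact this.2
  · exact Eventually.of_forall fun x => (hcont x).aestronglyMeasurable
  · obtain ⟨C', hC0', hC'⟩ := hk.dom
    refine (gauss_int_shift (b := 1 / (32 * σ ^ 2)) (by positivity) x
      (σ⁻¹ * C' * Real.exp (1/4) * B)).mono' (hcont σ).aestronglyMeasurable ?_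
    refine Eventually.of_forall fun y => ?_
    have := exp_dom x y x σ σ hσ hσ (by linarith) (by simpa using hσ.le)
    have h2 := hC' ((y - x) / σ)
    rw [Real.norm_eq_abs, abs_mul, abs_mul, abs_of_pos (show 0 < σ⁻¹ by positivity)]
    calc σ⁻¹ * |k ((y - x) / σ)| * |g y|
        ≤ σ⁻¹ * (C' * (Real.exp (1/4) * Real.exp (-(1 / (32 * σ ^ 2)) * (y - x) ^ 2))) * B := by
          gcongr
          · exact h2.trans (by gcongr)
          · exact hB y
      _ = _ := by ring
  · exact (continuous_const.mul ((continuous_const.mul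
      (hk'.cont.comp (f := fun y => (y - x) / σ) (by fun_prop))).mul hg)).aestronglyMeasurable
  · refine Eventually.of_forall fun y s hs => ?_
    have hs0 : 0 < s := by linarith [hs.1]
    have := exp_dom x y x s σ hσ hs0 (by linarith [hs.2]) (by simpa using hs0.le)
    have h2 := hC ((y - x) / s)
    rw [Real.norm_eq_abs, abs_mul, abs_mul, abs_mul, abs_neg,
      abs_of_pos (show 0 < s⁻¹ by positivity)]
    have h3 : s⁻¹ ≤ (σ/2)⁻¹ := inv_anti₀ (by positivity) hs.1.le
    calc s⁻¹ * (s⁻¹ * |k ((y - x) / s) + (y - x) / s * k' ((y - x) / s)| * |g y|)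
        ≤ (σ/2)⁻¹ * ((σ/2)⁻¹ * (C * (Real.exp (1/4)
          * Real.exp (-(1 / (32 * σ ^ 2)) * (y - x) ^ 2))) * B) := by
          gcongr
          · exact h2.trans (by gcongr)
          · exact hB y
      _ = _ := by ring
  · exact gauss_int_shift (by positivity) _ _
  · refine Eventually.of_forall fun y s hs => ?_
    have hs0 : 0 < s := by linarith [hs.1]
    have h1 : HasDerivAt (fun s => (y - x) / s) (-(y - x) / s ^ 2) s := by
      have := ((hasDerivAt_inv hs0.ne').const_mul (y - x))
      refine (this.congr_deriv (by field_simp)).congr_of_eventuallyEq ?_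
      exact Eventually.of_forall fun s => by simp [div_eq_mul_inv]
    have h2 := ((hasDerivAt_inv hs0.ne').mul
      ((hd ((y - x) / s)).comp s h1)).mul_const (g y)
    refine (h2.congr_deriv ?_)
    simp only [Function.comp]
    field_simp
    ring

end

section

open MeasureTheory

def ga (z : ℝ) : ℝ := (Real.sqrt (2 * Real.pi))⁻¹ * Real.exp (-(1/2) * z ^ 2)
def ga1 (z : ℝ) : ℝ := z * ga z
def ga2 (z : ℝ) : ℝ := (z ^ 2 - 1) * ga z

lemma ga_pos (z : ℝ) : 0 < ga z := by unfold ga; positivity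

lemma ga_integral : ∫ z, ga z = 1 := by
  unfold ga
  rw [integral_const_mul, integral_gaussian]
  rw [show Real.pi / (1/2) = 2 * Real.pi by ring]
  apply inv_mul_cancel₀
  have := Real.pi_pos
  positivity

lemma exp_split (z : ℝ) : Real.exp (-(1/2) * z ^ 2)
    = Real.exp (-(1/4) * z ^ 2) * Real.exp (-(1/4) * z ^ 2) := by
  rw [← Real.exp_add]; congr 1; ring

lemma quad_exp (z : ℝ) : (1 + z ^ 2 / 4) * Real.exp (-(1/4) * z ^ 2) ≤ 1 := by
  have h1 := Real.add_one_le_exp (z ^ 2 / 4)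
  have h2 : Real.exp (z ^ 2 / 4) * Real.exp (-(1/4) * z ^ 2) = 1 := by
    rw [← Real.exp_add]; simp; ring
  have h3 := Real.exp_pos (-(1/4) * z ^ 2)
  nlinarith

lemma ker_poly {q : ℝ → ℝ} (hq : Continuous q) (h : ∀ z, |q z| ≤ 4 * (1 + z ^ 2 / 4)) :
    Ker (fun z => q z * ga z) := by
  refine ⟨hq.mul (by unfold ga; fun_prop), 4 * (Real.sqrt (2 * Real.pi))⁻¹, by positivity, ?_⟩
  intro z
  rw [abs_mul, abs_of_pos (ga_pos z), ga, exp_split]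
  have h1 := quad_exp z
  set e := Real.exp (-(1/4) * z ^ 2)
  have he : 0 < e := Real.exp_pos _
  have hs : 0 ≤ (Real.sqrt (2 * Real.pi))⁻¹ := by positivity
  calc |q z| * ((Real.sqrt (2 * Real.pi))⁻¹ * (e * e))
      = (Real.sqrt (2 * Real.pi))⁻¹ * e * (|q z| * e) := by ring
    _ ≤ (Real.sqrt (2 * Real.pi))⁻¹ * e * (4 * (1 + z ^ 2 / 4) * e) := by
        gcongr; exact h z
    _ = (Real.sqrt (2 * Real.pi))⁻¹ * e * 4 * ((1 + z ^ 2 / 4) * e) := by ring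
    _ ≤ (Real.sqrt (2 * Real.pi))⁻¹ * e * 4 * 1 := by gcongr
    _ = _ := by ring

lemma ker_ga : Ker ga := by
  have := ker_poly (q := fun _ => 1) continuous_const (fun z => by
    simp only [abs_one]; nlinarith [sq_nonneg z])
  simpa using this

lemma ker_ga1 : Ker ga1 :=
  ker_poly (q := fun z => z) continuous_id (fun z => by
    rw [← sq_abs z]; nlinarith [sq_nonneg (|z| - 1), abs_nonneg z])

lemma ker_ga2 : Ker ga2 :=
  ker_poly (q := fun z => z ^ 2 - 1) (by fun_prop) (fun z => by
    rw [abs_le]; constructor <;> nlinarith [sq_nonneg z])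

lemma Ker.neg {k : ℝ → ℝ} (hk : Ker k) : Ker (fun z => - k z) := by
  obtain ⟨C, h0, h⟩ := hk.dom
  exact ⟨hk.cont.neg, C, h0, fun z => by rw [abs_neg]; exact h z⟩

lemma GA_neg (k : ℝ → ℝ) (σ : ℝ) (g : ℝ → ℝ) (x : ℝ) :
    GA (fun z => - k z) σ g x = - GA k σ g x := by
  unfold GA
  rw [← integral_neg]
  congr 1; ext z; ring

lemma ga_deriv (z : ℝ) : HasDerivAt ga (-ga1 z) z := by
  have h1 : HasDerivAt (fun z : ℝ => -(1/2) * z ^ 2) (-z) z := by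
    refine ((hasDerivAt_pow 2 z).const_mul (-(1/2))).congr_deriv ?_
    simp
  refine (h1.exp.const_mul (Real.sqrt (2 * Real.pi))⁻¹).congr_deriv ?_
  unfold ga1 ga; ring

lemma ga1_deriv (z : ℝ) : HasDerivAt ga1 (-ga2 z) z := by
  refine ((hasDerivAt_id z).mul (ga_deriv z)).congr_deriv ?_
  unfold ga2 ga1; simp; ring

section
variable {g : ℝ → ℝ} {B : ℝ}

lemma ga_dx (hg : Continuous g) (hB : ∀ y, |g y| ≤ B) {σ : ℝ} (hσ : 0 < σ) (x : ℝ) :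
    HasDerivAt (GA ga σ g) (σ⁻¹ * GA ga1 σ g x) x := by
  have := GA_deriv_x ker_ga ker_ga1.neg ga_deriv hg hB hσ x
  rw [GA_neg] at this
  simpa using this

lemma ga1_dx (hg : Continuous g) (hB : ∀ y, |g y| ≤ B) {σ : ℝ} (hσ : 0 < σ) (x : ℝ) :
    HasDerivAt (GA ga1 σ g) (σ⁻¹ * GA ga2 σ g x) x := by
  have := GA_deriv_x ker_ga1 ker_ga2.neg ga1_deriv hg hB hσ x
  rw [GA_neg] at this
  simpa using this

lemma ga_dσ (hg : Continuous g) (hB : ∀ y, |g y| ≤ B) {σ : ℝ} (hσ : 0 < σ) (x : ℝ) :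
    HasDerivAt (fun σ => GA ga σ g x) (σ⁻¹ * GA ga2 σ g x) σ := by
  have e : (fun z => ga z + z * -ga1 z) = fun z => - ga2 z := by
    ext z; unfold ga1 ga2; ring
  have := GA_deriv_σ ker_ga (by rw [e]; exact ker_ga2.neg) ga_deriv hg hB hσ x
  rw [e, GA_neg] at this
  simpa using this

lemma ga_const (c σ x : ℝ) : GA ga σ (fun _ => c) x = c := by
  unfold GA
  rw [integral_mul_const, ga_integral, one_mul]

lemma ga2_integral : ∫ z, ga2 z = 0 := by
  have h1 := ga_dσ (g := fun _ => (1:ℝ)) (B := 1) continuous_const (by simp) one_pos 0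
  have h2 : (fun σ => GA ga σ (fun _ => (1:ℝ)) 0) = fun _ => 1 := by
    ext σ; exact ga_const 1 σ 0
  rw [h2] at h1
  have := h1.unique (hasDerivAt_const _ _)
  simpa [GA] using this

lemma ker_moment {k : ℝ → ℝ} (hk : Ker k) : Integrable (fun z => |k z| * (1 + |z|)) := by
  obtain ⟨C, h0, h⟩ := hk.dom
  refine ((gauss_int (by norm_num : (0:ℝ) < 1/8)).const_mul (3 * C)).mono'
    (hk.cont.abs.mul (by fun_prop)).aestronglyMeasurable ?_
  refine Eventually.of_forall fun z => ?_
  rw [Real.norm_eq_abs, abs_of_nonneg (by positivity)]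
  have h1 := Real.add_one_le_exp (z ^ 2 / 8)
  have h2 : 1 + |z| ≤ 3 * Real.exp (z ^ 2 / 8) := by
    have : 1 + |z| ≤ 3 * (z ^ 2 / 8 + 1) := by
      rw [← sq_abs z]; nlinarith [sq_nonneg (|z| - 4/3)]
    linarith
  have h3 : Real.exp (-(1/4) * z ^ 2) * Real.exp (z ^ 2 / 8) = Real.exp (-(1/8) * z ^ 2) := by
    rw [← Real.exp_add]; congr 1; ring
  calc |k z| * (1 + |z|) ≤ (C * Real.exp (-(1/4) * z ^ 2)) * (3 * Real.exp (z ^ 2 / 8)) := by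
        gcongr; exact h z
    _ = 3 * C * (Real.exp (-(1/4) * z ^ 2) * Real.exp (z ^ 2 / 8)) := by ring
    _ = _ := by rw [h3]

def M2 : ℝ := ∫ z, |ga2 z| * (1 + |z|)

lemma M2_nonneg : 0 ≤ M2 := integral_nonneg fun z => by positivity

/-- Hoelder gain -/
lemma ga2_holder (hg : Continuous g) (hB : ∀ y, |g y| ≤ B) {C K α : ℝ} (hC : 0 ≤ C)
    (hK : 0 ≤ K) (hα : α ∈ Ioo (0:ℝ) 1)
    (hH : ∀ y y', |g y - g y'| ≤ C * |y - y'| ^ α + K * |y - y'|) {σ : ℝ} (hσ : 0 < σ) (x : ℝ) :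
    |GA ga2 σ g x| ≤ M2 * (C * σ ^ α + K * σ) := by
  have e : GA ga2 σ g x = ∫ z, ga2 z * (g (x + σ * z) - g x) := by
    have h2 : ∀ z, ga2 z * (g (x + σ * z) - g x) = ga2 z * g (x + σ * z) - ga2 z * g x := by
      intro z; ring
    simp_rw [h2]
    rw [integral_sub (ker_ga2.integrable_mul hg hB σ x) (ker_ga2.integrable.mul_const _),
      integral_mul_const, ga2_integral]
    simp [GA]
  rw [e, M2, show (∫ z, |ga2 z| * (1 + |z|)) * (C * σ ^ α + K * σ)
    = ∫ z, |ga2 z| * (1 + |z|) * (C * σ ^ α + K * σ) from (integral_mul_const _ _).symm,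
    ← Real.norm_eq_abs]
  refine norm_integral_le_of_norm_le ((ker_moment ker_ga2).mul_const _) ?_
  refine Eventually.of_forall fun z => ?_
  rw [norm_mul, Real.norm_eq_abs, Real.norm_eq_abs, mul_assoc]
  refine mul_le_mul_of_nonneg_left ?_ (abs_nonneg _)
  have h1 := hH (x + σ * z) x
  rw [add_sub_cancel_left, abs_mul, abs_of_pos hσ, Real.mul_rpow hσ.le (abs_nonneg z)] at h1
  have h2 : |z| ^ α ≤ 1 + |z| := by
    by_cases hz : |z| ≤ 1
    · have := Real.rpow_le_one (abs_nonneg z) hz hα.1.le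
      linarith [abs_nonneg z]
    · push Not at hz
      have := Real.rpow_le_rpow_of_exponent_le hz.le hα.2.le
      rw [Real.rpow_one] at this
      linarith
  have h3 : 0 ≤ σ ^ α := Real.rpow_nonneg hσ.le _
  calc |g (x + σ * z) - g x| ≤ C * (σ ^ α * |z| ^ α) + K * (σ * |z|) := h1
    _ ≤ C * (σ ^ α * (1 + |z|)) + K * (σ * (1 + |z|)) := by gcongr; linarith
    _ = _ := by ring

lemma ga_nonneg (h0 : ∀ y, 0 ≤ g y) (σ x : ℝ) : 0 ≤ GA ga σ g x :=
  integral_nonneg fun z => mul_nonneg (ga_pos z).le (h0 _)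

lemma ga_le (hg : Continuous g) (hB : ∀ y, |g y| ≤ B) {c : ℝ} (hc : ∀ y, g y ≤ c) (σ x : ℝ) :
    GA ga σ g x ≤ c := by
  rw [← ga_const c σ x]
  refine integral_mono (ker_ga.integrable_mul hg hB σ x)
    (ker_ga.integrable.mul_const c) fun z => ?_
  exact mul_le_mul_of_nonneg_left (hc _) (ga_pos z).le

lemma ga_abs (hB : ∀ y, |g y| ≤ B) (σ x : ℝ) : |GA ga σ g x| ≤ B := by
  have := GA_bound ker_ga hB σ x
  simp_rw [abs_of_pos (ga_pos _)] at this
  rwa [ga_integral, one_mul] at this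

lemma ga_zero (x : ℝ) : GA ga 0 g x = g x := by
  unfold GA
  simp only [zero_mul, add_zero]
  rw [integral_mul_const, ga_integral, one_mul]

end

/-- the heat semigroup -/
def Ps (d τ : ℝ) (g : ℝ → ℝ) (x : ℝ) : ℝ := GA ga (Real.sqrt (2 * d * τ)) g x

lemma sqrt_deriv {d τ : ℝ} (hd : 0 < d) (hτ : 0 < τ) :
    HasDerivAt (fun τ => Real.sqrt (2 * d * τ)) (d * (Real.sqrt (2 * d * τ))⁻¹) τ := by
  have h1 : HasDerivAt (fun τ : ℝ => 2 * d * τ) (2 * d) τ := by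
    simpa using (hasDerivAt_id τ).const_mul (2 * d)
  refine (h1.sqrt (by positivity)).congr_deriv ?_
  have : 0 < Real.sqrt (2 * d * τ) := by positivity
  field_simp

section
variable {g : ℝ → ℝ} {B d τ : ℝ}
lemma Ps_dt (hg : Continuous g) (hB : ∀ y, |g y| ≤ B) (hd : 0 < d) (hτ : 0 < τ) (x : ℝ) :
    HasDerivAt (fun τ => Ps d τ g x) (d * ((2 * d * τ)⁻¹ * GA ga2 (Real.sqrt (2 * d * τ)) g x)) τ := by
  have hσ : 0 < Real.sqrt (2 * d * τ) := by positivity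
  have := (ga_dσ hg hB hσ x).comp τ (sqrt_deriv hd hτ)
  refine this.congr_deriv ?_
  rw [show (2 * d * τ)⁻¹ = (Real.sqrt (2 * d * τ))⁻¹ * (Real.sqrt (2 * d * τ))⁻¹ by
    rw [← mul_inv, Real.mul_self_sqrt (by positivity)]]
  ring

lemma Ps_jet (hg : Continuous g) (hB : ∀ y, |g y| ≤ B) (hd : 0 < d) (hτ : 0 < τ) (x : ℝ) :
    ∃ vxx, Jet (fun τ y => Ps d τ g y) τ x (d * vxx) vxx := by
  have hσ : 0 < Real.sqrt (2 * d * τ) := by positivity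
  refine ⟨(2 * d * τ)⁻¹ * GA ga2 (Real.sqrt (2 * d * τ)) g x,
    (Ps_dt hg hB hd hτ x).hasDerivWithinAt,
    fun y => (Real.sqrt (2 * d * τ))⁻¹ * GA ga1 (Real.sqrt (2 * d * τ)) g y, ?_, ?_⟩
  · exact Eventually.of_forall fun y => ga_dx hg hB hσ y
  · refine ((ga1_dx hg hB hσ x).const_mul _).congr_deriv ?_
    rw [show (2 * d * τ)⁻¹ = (Real.sqrt (2 * d * τ))⁻¹ * (Real.sqrt (2 * d * τ))⁻¹ by
      rw [← mul_inv, Real.mul_self_sqrt (by positivity)]]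
    ring

lemma Ps_cont (hg : Continuous g) (hB : ∀ y, |g y| ≤ B) :
    Continuous (fun q : ℝ × ℝ => Ps d q.1 g q.2) := by
  unfold Ps
  exact GA_cont ker_ga (G := fun _ => g) (hg.comp continuous_snd) (fun _ => hB)
    (by fun_prop) (by fun_prop)

lemma Ps_zero (x : ℝ) : Ps d 0 g x = g x := by
  unfold Ps; rw [mul_zero, Real.sqrt_zero, ga_zero]

/-- Harnack type inequality -/
lemma Ps_harnack (hg : Continuous g) (hB : ∀ y, |g y| ≤ B) (h0 : ∀ y, 0 ≤ g y) (hd : 0 < d)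
    (hτ : 0 < τ) {D x y : ℝ} (hxy : |x - y| ≤ D) :
    (Real.sqrt 2)⁻¹ * Real.exp (-(D ^ 2 / (2 * d * τ))) * Ps d τ g x ≤ Ps d (2 * τ) g y := by
  have hσ : 0 < Real.sqrt (2 * d * τ) := by positivity
  have hσ2 : Real.sqrt (2 * d * (2 * τ)) = Real.sqrt 2 * Real.sqrt (2 * d * τ) := by
    rw [← Real.sqrt_mul (by norm_num)]; congr 1; ring
  unfold Ps
  rw [hσ2, GA_kernel_form hσ, GA_kernel_form (by positivity)]
  set σ := Real.sqrt (2 * d * τ) with hσdef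
  have hsq : σ ^ 2 = 2 * d * τ := Real.sq_sqrt (by positivity)
  have hs2 : 0 < Real.sqrt 2 := by positivity
  have hi : ∀ {s : ℝ} (hs : 0 < s) (x : ℝ), Integrable (fun y => s⁻¹ * ga ((y - x) / s) * g y) := by
    intro s hs x
    have h1 := ker_ga.integrable.comp_div hs.ne'
    have h2 := h1.comp_sub_right x
    refine ((h2.const_mul s⁻¹).mul_const B).mono' ?_ ?_
    · refine ((continuous_const.mul (ker_ga.cont.comp (by fun_prop))).mul hg).aestronglyMeasurable
    · refine Eventually.of_forall fun y => ?_
      rw [norm_mul, norm_mul, Real.norm_of_nonneg (ga_pos _).le, Real.norm_of_nonneg (by positivity)]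
      have := ga_pos ((y - x) / s)
      gcongr
      exact hB y
  rw [← integral_const_mul]
  refine integral_mono ((hi hσ x).const_mul _) (hi (by positivity) y) fun w => ?_
  simp only
  have hk : Real.exp (-(D ^ 2 / (2 * d * τ))) * ga ((w - x) / σ)
      ≤ ga ((w - y) / (Real.sqrt 2 * σ)) := by
    unfold ga
    rw [mul_left_comm, ← Real.exp_add]
    gcongr
    have h1 : ((w - y) / (Real.sqrt 2 * σ)) ^ 2 = (w - y) ^ 2 / (2 * σ ^ 2) := by
      rw [div_pow, mul_pow, Real.sq_sqrt (by norm_num)]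
    rw [h1, div_pow, hsq, ← hsq]
    have h2 : (w - y) ^ 2 / (2 * σ ^ 2) ≤ (w - x) ^ 2 / σ ^ 2 + D ^ 2 / σ ^ 2 := by
      rw [← add_div, div_le_div_iff₀ (by positivity) (by positivity)]
      have h3 : (x - y) ^ 2 ≤ D ^ 2 := by
        rw [← sq_abs (x - y)]; gcongr
      have h4 : (w - y) ^ 2 ≤ 2 * (w - x) ^ 2 + 2 * (x - y) ^ 2 := by
        nlinarith [sq_nonneg ((w - x) - (x - y))]
      have : 0 < σ ^ 2 := by positivity
      nlinarith
    have h5 : 0 ≤ D ^ 2 / σ ^ 2 := by positivity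
    linarith
  have : (Real.sqrt 2)⁻¹ * Real.exp (-(D ^ 2 / (2 * d * τ))) * (σ⁻¹ * ga ((w - x) / σ) * g w)
      = ((Real.sqrt 2 * σ)⁻¹ * g w) * (Real.exp (-(D ^ 2 / (2 * d * τ))) * ga ((w - x) / σ)) := by
    rw [mul_inv]; ring
  rw [this]
  have h6 : 0 ≤ (Real.sqrt 2 * σ)⁻¹ * g w := mul_nonneg (by positivity) (h0 w)
  calc _ ≤ ((Real.sqrt 2 * σ)⁻¹ * g w) * ga ((w - y) / (Real.sqrt 2 * σ)) := by gcongr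
    _ = _ := by ring
end

end

section

open MeasureTheory

lemma sig_integrable {d : ℝ} (hd : 0 < d) {β : ℝ} (hβ : -2 < β) {a b : ℝ} (ha : 0 ≤ a)
    (hb : 0 ≤ b) :
    IntervalIntegrable (fun τ => (Real.sqrt (2 * d * τ)) ^ β) volume a b := by
  have h := (intervalIntegral.intervalIntegrable_rpow' (a := a) (b := b) (r := β / 2)
    (by linarith)).const_mul ((2 * d) ^ (β / 2))
  refine h.congr (fun τ hτ => ?_)
  have h0 : 0 ≤ τ := by
    have := hτ.1
    exact (le_min ha hb).trans this.le
  rw [Real.sqrt_eq_rpow, ← Real.rpow_mul (by positivity), Real.mul_rpow (by positivity) h0]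
  congr 2 <;> ring

def bnd (d M C K α τ : ℝ) : ℝ :=
  M * (C * (Real.sqrt (2 * d * τ)) ^ (α - 2) + K * (Real.sqrt (2 * d * τ)) ^ (-1:ℝ))

lemma bnd_integrable {d M C K α : ℝ} (hd : 0 < d) (hα : 0 < α) {a b : ℝ} (ha : 0 ≤ a)
    (hb : 0 ≤ b) : IntervalIntegrable (bnd d M C K α) volume a b :=
  (((sig_integrable hd (by linarith) ha hb).const_mul C).add
    ((sig_integrable hd (by norm_num) ha hb).const_mul K)).const_mul M

lemma bnd_anti {d M C K α : ℝ} (hd : 0 < d) (hM : 0 ≤ M) (hC : 0 ≤ C) (hK : 0 ≤ K)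
    (hα : α < 1) {a b : ℝ} (ha : 0 < a) (hab : a ≤ b) : bnd d M C K α b ≤ bnd d M C K α a := by
  unfold bnd
  have h1 : Real.sqrt (2 * d * a) ≤ Real.sqrt (2 * d * b) := Real.sqrt_le_sqrt (by gcongr)
  have h0 : 0 < Real.sqrt (2 * d * a) := by positivity
  have h2 := Real.rpow_le_rpow_of_nonpos h0 h1 (show α - 2 ≤ 0 by linarith)
  have h3 := Real.rpow_le_rpow_of_nonpos h0 h1 (show (-1:ℝ) ≤ 0 by norm_num)
  gcongr

def DV (d : ℝ) (F : ℝ → ℝ → ℝ) (t x : ℝ) : ℝ := ∫ τ in (0:ℝ)..t, Ps d τ (F (t - τ)) x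
def DW1 (d : ℝ) (F : ℝ → ℝ → ℝ) (t x : ℝ) : ℝ :=
  ∫ τ in (0:ℝ)..t, (Real.sqrt (2 * d * τ))⁻¹ * GA ga1 (Real.sqrt (2 * d * τ)) (F (t - τ)) x
def DW2 (d : ℝ) (F : ℝ → ℝ → ℝ) (t x : ℝ) : ℝ :=
  ∫ τ in (0:ℝ)..t, (2 * d * τ)⁻¹ * GA ga2 (Real.sqrt (2 * d * τ)) (F (t - τ)) x

section
variable {d : ℝ} {F : ℝ → ℝ → ℝ} {B : ℝ}

lemma GAF_cont {k : ℝ → ℝ} (hk : Ker k) (hF : Continuous (fun q : ℝ × ℝ => F q.1 q.2))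
    (hB : ∀ s y, |F s y| ≤ B) {X : Type*} [TopologicalSpace X] [FirstCountableTopology X]
    {τ s x : X → ℝ} (hτ : Continuous τ) (hs : Continuous s) (hx : Continuous x) :
    Continuous (fun q => GA k (Real.sqrt (2 * d * τ q)) (F (s q)) (x q)) :=
  GA_cont hk (G := fun q => F (s q))
    (hF.comp (f := fun r : X × ℝ => (s r.1, r.2)) (by fun_prop)) (fun q y => hB _ y)
    (by fun_prop) hx

lemma F_cont (hF : Continuous (fun q : ℝ × ℝ => F q.1 q.2)) (s : ℝ) : Continuous (F s) :=
  hF.comp (f := fun y => (s, y)) (by fun_prop)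

lemma DV_cont (hF : Continuous (fun q : ℝ × ℝ => F q.1 q.2)) (hB : ∀ s y, |F s y| ≤ B) :
    Continuous (fun q : ℝ × ℝ => DV d F q.1 q.2) := by
  unfold DV
  refine intervalIntegral.continuous_parametric_intervalIntegral_of_continuous
    (f := fun (q : ℝ × ℝ) τ => Ps d τ (F (q.1 - τ)) q.2) ?_ continuous_fst
  unfold Ps Function.uncurry
  exact GAF_cont ker_ga hF hB (by fun_prop) (by fun_prop) (by fun_prop)

lemma DV_dx (hd : 0 < d) (hF : Continuous (fun q : ℝ × ℝ => F q.1 q.2))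
    (hB : ∀ s y, |F s y| ≤ B) {t : ℝ} (ht : 0 ≤ t) (x : ℝ) :
    HasDerivAt (DV d F t) (DW1 d F t x) x := by
  have := intervalIntegral.hasDerivAt_integral_of_dominated_loc_of_deriv_le (μ := volume)
    (a := 0) (b := t) (F := fun x τ => Ps d τ (F (t - τ)) x)
    (F' := fun x τ => (Real.sqrt (2 * d * τ))⁻¹ * GA ga1 (Real.sqrt (2 * d * τ)) (F (t - τ)) x)
    (bound := fun τ => (∫ z, |ga1 z|) * B * (Real.sqrt (2 * d * τ)) ^ (-1:ℝ))
    (x₀ := x) (s := univ) univ_mem ?_ ?_ ?_ ?_ ?_ ?_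
  · exact this.2
  · refine Eventually.of_forall fun x => Continuous.aestronglyMeasurable ?_
    exact GAF_cont ker_ga hF hB (by fun_prop) (by fun_prop) (by fun_prop)
  · refine Continuous.intervalIntegrable ?_ _ _
    exact GAF_cont ker_ga hF hB (by fun_prop) (by fun_prop) (by fun_prop)
  · refine AEStronglyMeasurable.mul ?_ ?_
    · exact (by fun_prop : Measurable fun τ => (Real.sqrt (2 * d * τ))⁻¹).aestronglyMeasurable
    · exact (GAF_cont ker_ga1 hF hB continuous_id (by fun_prop) (by fun_prop)).aestronglyMeasurable
  · refine Eventually.of_forall fun τ hτ x _ => ?_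
    rw [norm_mul, Real.norm_eq_abs, Real.norm_eq_abs, Real.rpow_neg_one, abs_of_nonneg
      (by positivity), mul_comm]
    exact mul_le_mul_of_nonneg_right (GA_bound ker_ga1 (hB _) _ _) (by positivity)
  · exact (sig_integrable hd (by norm_num) le_rfl ht).const_mul _
  · refine Eventually.of_forall fun τ hτ x _ => ?_
    rw [uIoc_of_le ht] at hτ
    have h0 := hτ.1
    exact ga_dx (F_cont hF _) (hB _) (by positivity) x

lemma DV_lip (hd : 0 < d) (hF : Continuous (fun q : ℝ × ℝ => F q.1 q.2))
    (hB : ∀ s y, |F s y| ≤ B) (T : ℝ) :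
    ∃ Λ, 0 ≤ Λ ∧ ∀ t, 0 ≤ t → t ≤ T → ∀ x y, |DV d F t x - DV d F t y| ≤ Λ * |x - y| := by
  have hB0 : 0 ≤ B := (abs_nonneg _).trans (hB 0 0)
  have hI : 0 ≤ ∫ z, |ga1 z| := integral_nonneg fun z => abs_nonneg _
  by_cases hT : 0 ≤ T
  swap
  · exact ⟨0, le_rfl, fun t h1 h2 => absurd (h1.trans h2) hT⟩
  refine ⟨∫ τ in (0:ℝ)..T, (∫ z, |ga1 z|) * B * (Real.sqrt (2 * d * τ)) ^ (-1:ℝ), ?_, ?_⟩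
  · exact intervalIntegral.integral_nonneg hT fun τ _ => by positivity
  intro t ht htT x y
  have key : ∀ x, |DW1 d F t x|
      ≤ ∫ τ in (0:ℝ)..T, (∫ z, |ga1 z|) * B * (Real.sqrt (2 * d * τ)) ^ (-1:ℝ) := by
    intro x
    rw [← Real.norm_eq_abs, DW1]
    refine (intervalIntegral.norm_integral_le_of_norm_le
      (g := fun τ => (∫ z, |ga1 z|) * B * (Real.sqrt (2 * d * τ)) ^ (-1:ℝ)) ht ?_ ?_).trans ?_
    · refine Eventually.of_forall fun τ hτ => ?_
      rw [norm_mul, Real.norm_eq_abs, Real.norm_eq_abs, Real.rpow_neg_one, abs_of_nonneg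
        (by positivity), mul_comm]
      exact mul_le_mul_of_nonneg_right (GA_bound ker_ga1 (hB _) _ _) (by positivity)
    · exact (sig_integrable hd (by norm_num) le_rfl ht).const_mul _
    · refine intervalIntegral.integral_mono_interval le_rfl ht htT ?_ ?_
      · exact Eventually.of_forall fun τ => by
          simp only [Pi.zero_apply]; positivity
      · exact (sig_integrable hd (by norm_num) le_rfl hT).const_mul _
  have := convex_univ.norm_image_sub_le_of_norm_hasDerivWithin_le (f := DV d F t)
    (f' := DW1 d F t) (fun x _ => (DV_dx hd hF hB ht x).hasDerivWithinAt)
    (fun x _ => key x) (mem_univ y) (mem_univ x)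
  exact this

variable {C K α T : ℝ}

lemma gaF2_bound (hd : 0 < d) (hF : Continuous (fun q : ℝ × ℝ => F q.1 q.2))
    (hB : ∀ s y, |F s y| ≤ B) (hC : 0 ≤ C) (hK : 0 ≤ K) (hα : α ∈ Ioo (0:ℝ) 1) {s : ℝ}
    (hH : ∀ y y', |F s y - F s y'| ≤ C * |y - y'| ^ α + K * |y - y'|)
    {τ : ℝ} (hτ : 0 < τ) (x : ℝ) :
    |(2 * d * τ)⁻¹ * GA ga2 (Real.sqrt (2 * d * τ)) (F s) x| ≤ bnd d M2 C K α τ := by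
  have hσ : 0 < Real.sqrt (2 * d * τ) := by positivity
  have h1 := ga2_holder (F_cont hF s) (hB s) hC hK hα hH hσ x
  have h2 : 2 * d * τ = (Real.sqrt (2 * d * τ)) ^ 2 := (Real.sq_sqrt (by positivity)).symm
  rw [abs_mul, abs_of_pos (by positivity)]
  unfold bnd
  set σ := Real.sqrt (2 * d * τ)
  rw [h2]
  have h3 : σ ^ (α - 2) = (σ ^ 2)⁻¹ * σ ^ α := by
    rw [Real.rpow_sub hσ, div_eq_inv_mul]; norm_num
  have h4 : σ ^ (-1:ℝ) = (σ ^ 2)⁻¹ * σ := by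
    rw [Real.rpow_neg_one]; field_simp
  rw [h3, h4]
  calc (σ ^ 2)⁻¹ * |GA ga2 σ (F s) x| ≤ (σ ^ 2)⁻¹ * (M2 * (C * σ ^ α + K * σ)) := by gcongr
    _ = _ := by ring

lemma DW1_dx (hd : 0 < d) (hF : Continuous (fun q : ℝ × ℝ => F q.1 q.2))
    (hB : ∀ s y, |F s y| ≤ B) (hC : 0 ≤ C) (hK : 0 ≤ K) (hα : α ∈ Ioo (0:ℝ) 1)
    (hH : ∀ s, 0 ≤ s → s ≤ T → ∀ y y', |F s y - F s y'| ≤ C * |y - y'| ^ α + K * |y - y'|)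
    {t : ℝ} (ht : 0 ≤ t) (htT : t ≤ T) (x : ℝ) :
    HasDerivAt (DW1 d F t) (DW2 d F t x) x := by
  have := intervalIntegral.hasDerivAt_integral_of_dominated_loc_of_deriv_le (μ := volume)
    (a := 0) (b := t)
    (F := fun x τ => (Real.sqrt (2 * d * τ))⁻¹ * GA ga1 (Real.sqrt (2 * d * τ)) (F (t - τ)) x)
    (F' := fun x τ => (2 * d * τ)⁻¹ * GA ga2 (Real.sqrt (2 * d * τ)) (F (t - τ)) x)
    (bound := bnd d M2 C K α)
    (x₀ := x) (s := univ) univ_mem ?_ ?_ ?_ ?_ ?_ ?_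
  · exact this.2
  · refine Eventually.of_forall fun x => AEStronglyMeasurable.mul ?_ ?_
    · exact (by fun_prop : Measurable fun τ => (Real.sqrt (2 * d * τ))⁻¹).aestronglyMeasurable
    · exact (GAF_cont ker_ga1 hF hB continuous_id (by fun_prop) (by fun_prop)).aestronglyMeasurable
  · refine ((sig_integrable hd (show (-2:ℝ) < -1 by norm_num) le_rfl ht).const_mul
      ((∫ z, |ga1 z|) * B)).mono_fun ?_ ?_
    · refine AEStronglyMeasurable.mul ?_ ?_
      · exact (by fun_prop : Measurable fun τ => (Real.sqrt (2 * d * τ))⁻¹).aestronglyMeasurable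
      · exact (GAF_cont ker_ga1 hF hB continuous_id (by fun_prop) (by fun_prop)).aestronglyMeasurable
    · refine Eventually.of_forall fun τ => ?_
      have hB0 : 0 ≤ B := (abs_nonneg _).trans (hB 0 0)
      have hI : 0 ≤ ∫ z, |ga1 z| := integral_nonneg fun z => abs_nonneg _
      simp only [norm_mul, Real.norm_eq_abs, Real.rpow_neg_one]
      rw [mul_comm, abs_of_nonneg hI, abs_of_nonneg hB0]
      exact mul_le_mul_of_nonneg_right (GA_bound ker_ga1 (hB _) _ _) (abs_nonneg _)
  · refine AEStronglyMeasurable.mul ?_ ?_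
    · exact (by fun_prop : Measurable fun τ => (2 * d * τ)⁻¹).aestronglyMeasurable
    · exact (GAF_cont ker_ga2 hF hB continuous_id (by fun_prop) (by fun_prop)).aestronglyMeasurable
  · refine Eventually.of_forall fun τ hτ x _ => ?_
    rw [uIoc_of_le ht] at hτ
    exact gaF2_bound hd hF hB hC hK hα (hH _ (by linarith [hτ.2]) (by linarith [hτ.1])) hτ.1 x
  · exact bnd_integrable hd hα.1 le_rfl ht
  · refine Eventually.of_forall fun τ hτ x _ => ?_
    rw [uIoc_of_le ht] at hτ
    have h0 := hτ.1
    refine ((ga1_dx (F_cont hF _) (hB _) (by positivity) x).const_mul _).congr_deriv ?_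
    rw [← mul_assoc, ← mul_inv, Real.mul_self_sqrt (by positivity)]

lemma DW2_cont_t (hd : 0 < d) (hF : Continuous (fun q : ℝ × ℝ => F q.1 q.2))
    (hB : ∀ s y, |F s y| ≤ B) (hC : 0 ≤ C) (hK : 0 ≤ K) (hα : α ∈ Ioo (0:ℝ) 1)
    (hH : ∀ s, 0 ≤ s → s ≤ T → ∀ y y', |F s y - F s y'| ≤ C * |y - y'| ^ α + K * |y - y'|)
    (x : ℝ) {t : ℝ} (ht : t ∈ Ioo 0 T) : ContinuousAt (fun t => DW2 d F t x) t := by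
  have hT : 0 < T := ht.1.trans ht.2
  set G : ℝ → ℝ → ℝ := fun t τ => (2 * d * τ)⁻¹ * GA ga2 (Real.sqrt (2 * d * τ)) (F (t - τ)) x
    with hG
  have hmeas : ∀ t, Measurable (G t) := fun t =>
    (by fun_prop : Measurable fun τ => (2 * d * τ)⁻¹).mul
      (GAF_cont ker_ga2 hF hB continuous_id (by fun_prop) (by fun_prop)).measurable
  have e : (fun t => DW2 d F t x) =ᶠ[𝓝 t]
      fun t => ∫ τ in (0:ℝ)..T, (Iic t).indicator (G t) τ := by
    filter_upwards [Ioo_mem_nhds ht.1 ht.2] with s hs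
    rw [DW2, intervalIntegral.integral_of_le hs.1.le, intervalIntegral.integral_of_le hT.le,
      setIntegral_indicator measurableSet_Iic]
    congr 2
    ext τ
    simp only [mem_Ioc, mem_inter_iff, mem_Iic]
    constructor
    · rintro ⟨a, b⟩; exact ⟨⟨a, b.trans hs.2.le⟩, b⟩
    · rintro ⟨⟨a, b⟩, c⟩; exact ⟨a, c⟩
  refine ContinuousAt.congr ?_ e.symm
  refine intervalIntegral.continuousAt_of_dominated_interval (bound := bnd d M2 C K α) ?_ ?_ ?_ ?_
  · exact Eventually.of_forall fun s =>
      ((hmeas s).indicator measurableSet_Iic).aestronglyMeasurable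
  · filter_upwards [Ioo_mem_nhds ht.1 ht.2] with s hs
    refine Eventually.of_forall fun τ hτ => ?_
    rw [uIoc_of_le hT.le] at hτ
    by_cases h : τ ≤ s
    · rw [indicator_of_mem (show τ ∈ Iic s from h)]
      exact gaF2_bound hd hF hB hC hK hα (hH _ (by linarith) (by linarith [hs.2, hτ.1])) hτ.1 x
    · rw [indicator_of_notMem (show τ ∉ Iic s from h), norm_zero]
      have h0 : 0 < τ := hτ.1
      have := M2_nonneg
      unfold bnd
      positivity
  · exact bnd_integrable hd hα.1 le_rfl hT.le
  · have hne : ∀ᵐ τ : ℝ, τ ≠ t := by simp [ae_iff, measure_singleton]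
    filter_upwards [hne] with τ hτ _
    have hcont : Continuous (fun t => G t τ) :=
      continuous_const.mul (GAF_cont (τ := fun _ => τ) ker_ga2 hF hB (by fun_prop) (by fun_prop)
        (by fun_prop))
    rcases lt_or_gt_of_ne hτ with h | h
    · refine hcont.continuousAt.congr ?_
      filter_upwards [Ioi_mem_nhds h] with s hs
      rw [indicator_of_mem]
      have hs' : τ < s := hs
      exact hs'.le
    · refine (continuousAt_const (y := (0:ℝ))).congr ?_
      filter_upwards [Iio_mem_nhds h] with s hs
      rw [indicator_of_notMem]
      have hs' : s < τ := hs
      exact fun h => absurd (show τ ≤ s from h) (not_le.2 hs')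

lemma DV_dt_right (hd : 0 < d) (hF : Continuous (fun q : ℝ × ℝ => F q.1 q.2))
    (hB : ∀ s y, |F s y| ≤ B) (hC : 0 ≤ C) (hK : 0 ≤ K) (hα : α ∈ Ioo (0:ℝ) 1)
    (hH : ∀ s, 0 ≤ s → s ≤ T → ∀ y y', |F s y - F s y'| ≤ C * |y - y'| ^ α + K * |y - y'|)
    (x : ℝ) {t : ℝ} (ht : t ∈ Ioo 0 T) :
    HasDerivWithinAt (fun t => DV d F t x) (d * DW2 d F t x + F t x) (Ici t) t := by
  have hcP : ∀ {X : Type} [TopologicalSpace X] [FirstCountableTopology X] {τ s : X → ℝ},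
      Continuous τ → Continuous s → Continuous (fun q => Ps d (τ q) (F (s q)) x) := by
    intro X _ _ τ s h1 h2
    exact GAF_cont ker_ga hF hB h1 h2 continuous_const
  -- split
  have hsplit : ∀ k, DV d F (t + k) x
      = (∫ τ in (0:ℝ)..t, Ps d (τ + k) (F (t - τ)) x)
        + ∫ τ in (0:ℝ)..k, Ps d τ (F (t + k - τ)) x := by
    intro k
    have h1 := intervalIntegral.integral_comp_add_right (a := 0) (b := t)
      (fun τ => Ps d τ (F (t + k - τ)) x) k
    have h2 : (∫ τ in (0:ℝ)..t, Ps d (τ + k) (F (t - τ)) x)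
        = ∫ τ in (0:ℝ)..t, Ps d (τ + k) (F (t + k - (τ + k))) x := by
      congr 1; ext τ; congr 2; ring
    rw [h2, h1, zero_add, add_comm (∫ τ in k..t + k, _), DV,
      intervalIntegral.integral_add_adjacent_intervals]
    · exact (hcP continuous_id (by fun_prop)).intervalIntegrable _ _
    · exact (hcP continuous_id (by fun_prop)).intervalIntegrable _ _
  -- first part
  have hψ : HasDerivWithinAt (fun k => ∫ τ in (0:ℝ)..t, Ps d (τ + k) (F (t - τ)) x)
      (d * DW2 d F t x) (Ici 0) 0 := by
    rw [hasDerivWithinAt_iff_tendsto_slope]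
    have hset : Ici (0:ℝ) \ {0} = Ioi 0 := by ext; simp [lt_iff_le_and_ne, eq_comm]
    rw [hset]
    have e : ∀ k : ℝ, slope (fun k => ∫ τ in (0:ℝ)..t, Ps d (τ + k) (F (t - τ)) x) 0 k
        = ∫ τ in (0:ℝ)..t, k⁻¹ * (Ps d (τ + k) (F (t - τ)) x - Ps d τ (F (t - τ)) x) := by
      intro k
      rw [slope_def_field, intervalIntegral.integral_const_mul, intervalIntegral.integral_sub]
      · simp; ring
      · exact (hcP (by fun_prop) (by fun_prop)).intervalIntegrable _ _
      · exact (hcP continuous_id (by fun_prop)).intervalIntegrable _ _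
    rw [DW2, ← intervalIntegral.integral_const_mul]
    refine Tendsto.congr (fun k => (e k).symm) ?_
    refine intervalIntegral.tendsto_integral_filter_of_dominated_convergence
      (fun τ => d * bnd d M2 C K α τ) ?_ ?_ ?_ ?_
    · refine Eventually.of_forall fun k => Continuous.aestronglyMeasurable ?_
      exact continuous_const.mul ((hcP (by fun_prop) (by fun_prop)).sub
        (hcP continuous_id (by fun_prop)))
    · filter_upwards [self_mem_nhdsWithin] with k hk
      have hk : 0 < k := hk
      refine Eventually.of_forall fun τ hτ => ?_
      rw [uIoc_of_le ht.1.le] at hτ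
      have hb := norm_image_sub_le_of_norm_deriv_le_segment' (a := τ) (b := τ + k)
        (f := fun r => Ps d r (F (t - τ)) x)
        (f' := fun r => d * ((2 * d * r)⁻¹ * GA ga2 (Real.sqrt (2 * d * r)) (F (t - τ)) x))
        (C := d * bnd d M2 C K α τ)
        (fun r hr => (Ps_dt (F_cont hF _) (hB _) hd (lt_of_lt_of_le hτ.1 hr.1) x).hasDerivWithinAt)
        (fun r hr => by
          rw [norm_mul, Real.norm_eq_abs, Real.norm_eq_abs, abs_of_pos hd]
          have h1 := gaF2_bound hd hF hB hC hK hα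
            (hH (t - τ) (by linarith [hτ.2]) (by linarith [hτ.1, ht.2]))
            (lt_of_lt_of_le hτ.1 hr.1) x
          have h2 := bnd_anti (d := d) hd M2_nonneg hC hK hα.2 hτ.1 hr.1
          exact mul_le_mul_of_nonneg_left (h1.trans h2) hd.le)
        (τ + k) ⟨by linarith, le_rfl⟩
      rw [norm_mul, norm_inv, Real.norm_of_nonneg hk.le, inv_mul_le_iff₀ hk]
      refine hb.trans (le_of_eq ?_)
      ring
    · exact (bnd_integrable hd hα.1 le_rfl ht.1.le).const_mul d
    · refine Eventually.of_forall fun τ hτ => ?_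
      rw [uIoc_of_le ht.1.le] at hτ
      have h1 := (Ps_dt (d := d) (F_cont hF (t - τ)) (hB _) hd hτ.1 x)
      have h2 := h1.hasDerivWithinAt (s := Ioi τ)
      rw [hasDerivWithinAt_iff_tendsto_slope' (by simp)] at h2
      have h3 : Tendsto (fun k : ℝ => τ + k) (𝓝[>] 0) (𝓝[>] τ) := by
        refine tendsto_nhdsWithin_of_tendsto_nhds_of_eventually_within _ ?_ ?_
        · have : Tendsto (fun k : ℝ => τ + k) (𝓝 0) (𝓝 (τ + 0)) :=
            (continuous_const.add continuous_id).tendsto _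
          rw [add_zero] at this
          exact this.mono_left nhdsWithin_le_nhds
        · filter_upwards [self_mem_nhdsWithin] with k hk
          have : 0 < k := hk
          show τ < τ + k
          linarith
      refine (h2.comp h3).congr fun k => ?_
      simp only [Function.comp, slope_def_field, add_sub_cancel_left]
      rw [div_eq_inv_mul]
  -- second part
  have hφ : HasDerivWithinAt (fun k => ∫ τ in (0:ℝ)..k, Ps d τ (F (t + k - τ)) x)
      (F t x) (Ici 0) 0 := by
    have hc : Continuous (fun q : ℝ × ℝ => Ps d q.1 (F (t + q.2 - q.1)) x) :=
      hcP (by fun_prop) (by fun_prop)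
    rw [hasDerivWithinAt_iff_isLittleO, Asymptotics.isLittleO_iff]
    intro ε hε
    have h1 := Metric.continuous_iff.1 hc (0, 0) ε hε
    obtain ⟨δ, hδ, h2⟩ := h1
    have h3 : ∀ᶠ k in 𝓝[Ici (0:ℝ)] 0, k < δ :=
      nhdsWithin_le_nhds (Iio_mem_nhds hδ)
    filter_upwards [h3, self_mem_nhdsWithin] with k hk hk0
    have hk0 : 0 ≤ k := hk0
    simp only [intervalIntegral.integral_same, sub_zero, smul_eq_mul]
    have h4 : (∫ τ in (0:ℝ)..k, Ps d τ (F (t + k - τ)) x) - k * F t x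
        = ∫ τ in (0:ℝ)..k, (Ps d τ (F (t + k - τ)) x - F t x) := by
      rw [intervalIntegral.integral_sub]
      · simp
      · exact (hcP continuous_id (by fun_prop)).intervalIntegrable _ _
      · exact intervalIntegrable_const
    rw [h4]
    have h5 := intervalIntegral.norm_integral_le_of_norm_le_const (a := 0) (b := k) (C := ε)
      (f := fun τ => Ps d τ (F (t + k - τ)) x - F t x) (fun τ hτ => by
        rw [uIoc_of_le hk0] at hτ
        have h6 := h2 (τ, k) (by
          rw [Prod.dist_eq, max_lt_iff, Real.dist_eq, Real.dist_eq]
          simp only [sub_zero]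
          rw [abs_of_pos hτ.1, abs_of_nonneg hk0]
          exact ⟨lt_of_le_of_lt hτ.2 hk, hk⟩)
        rw [Real.dist_eq] at h6
        simp only [Ps_zero, add_zero, sub_zero] at h6
        exact h6.le)
    simpa using h5
  have hsum := hψ.add hφ
  have hsum2 : HasDerivWithinAt (fun k => DV d F (t + k) x) (d * DW2 d F t x + F t x) (Ici 0) 0 := by
    refine hsum.congr_of_eventuallyEq (Eventually.of_forall fun k => ?_) ?_
    · exact hsplit k
    · exact hsplit 0
  have h7 : HasDerivWithinAt (fun s => s - t) 1 (Ici t) t :=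
    ((hasDerivAt_id t).sub_const t).hasDerivWithinAt
  have h8 := HasDerivWithinAt.scomp (t' := Ici (0:ℝ)) t (by simpa using hsum2) h7
    (fun s hs => by
      have : t ≤ s := hs
      simp only [mem_Ici]; linarith)
  refine (h8.congr_deriv (by simp)).congr_of_eventuallyEq ?_ ?_
  · exact Eventually.of_forall fun s => by simp
  · simp
end

lemma deriv_of_right {f f' : ℝ → ℝ} {A B : ℝ}
    (h : ∀ t ∈ Ioo A B, HasDerivWithinAt f (f' t) (Ici t) t) (hf : ContinuousOn f (Ioo A B))
    (hc : ContinuousOn f' (Ioo A B)) {t : ℝ} (ht : t ∈ Ioo A B) : HasDerivAt f (f' t) t := by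
  obtain ⟨a, ha1, ha2⟩ := exists_between ht.1
  obtain ⟨b, hb1, hb2⟩ := exists_between ht.2
  have hsub : Icc a b ⊆ Ioo A B := fun s hs => ⟨lt_of_lt_of_le ha1 hs.1, lt_of_le_of_lt hs.2 hb2⟩
  have hg : ∀ s ∈ Icc a b, HasDerivAt (fun u => f a + ∫ r in a..u, f' r) (f' s) s := by
    intro s hs
    have hs' := hsub hs
    refine HasDerivAt.const_add _ (intervalIntegral.integral_hasDerivAt_right ?_ ?_ ?_)
    · refine ContinuousOn.intervalIntegrable (hc.mono ?_)
      rw [uIcc_of_le hs.1]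
      exact fun r hr => hsub ⟨hr.1, hr.2.trans hs.2⟩
    · exact hc.stronglyMeasurableAtFilter isOpen_Ioo s hs'
    · exact hc.continuousAt (isOpen_Ioo.mem_nhds hs')
  have heq := eq_of_has_deriv_right_eq (f := f) (f' := f')
    (g := fun u => f a + ∫ r in a..u, f' r) (a := a) (b := b)
    (fun s hs => h s (hsub ⟨hs.1, hs.2.le⟩))
    (fun s hs => (hg s ⟨hs.1, hs.2.le⟩).hasDerivWithinAt) (hf.mono hsub)
    (fun s hs => (hg s hs).continuousAt.continuousWithinAt) (by simp)
  refine (hg t ⟨ha2.le, hb1.le⟩).congr_of_eventuallyEq ?_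
  filter_upwards [Ioo_mem_nhds ha2 hb1] with s hs
  exact heq s ⟨hs.1.le, hs.2.le⟩

end

section

open MeasureTheory

lemma exp_int_bound {l : ℝ} (hl : 0 < l) {t : ℝ} (ht : 0 ≤ t) :
    ∫ τ in (0:ℝ)..t, Real.exp (l * (t - τ)) ≤ Real.exp (l * t) / l := by
  have h1 : ∀ τ ∈ uIcc 0 t, HasDerivAt (fun τ => - (Real.exp (l * (t - τ)) / l))
      (Real.exp (l * (t - τ))) τ := by
    intro τ _
    have h2 : HasDerivAt (fun τ => l * (t - τ)) (-l) τ := by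
      simpa using ((hasDerivAt_id τ).const_sub t).const_mul l
    refine (h2.exp.div_const l).neg.congr_deriv ?_
    field_simp
  rw [intervalIntegral.integral_eq_sub_of_hasDerivAt h1
    ((by fun_prop : Continuous fun τ => Real.exp (l * (t - τ))).intervalIntegrable _ _)]
  have : 0 < Real.exp (l * (t - t)) / l := by positivity
  simp only [sub_zero]
  linarith

lemma DV_bound {d B : ℝ} {F : ℝ → ℝ → ℝ} (hB : ∀ s y, |F s y| ≤ B) {t : ℝ} (ht : 0 ≤ t) (x : ℝ) :
    |DV d F t x| ≤ B * t := by
  have := intervalIntegral.norm_integral_le_of_norm_le_const (a := 0) (b := t) (C := B)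
    (f := fun τ => Ps d τ (F (t - τ)) x) (fun τ _ => ga_abs (hB _) _ _)
  rwa [sub_zero, abs_of_nonneg ht] at this

lemma GA_sub {k g g' : ℝ → ℝ} (hk : Ker k) (hg : Continuous g) (hg' : Continuous g') {B : ℝ}
    (hB : ∀ y, |g y| ≤ B) (hB' : ∀ y, |g' y| ≤ B) (σ x : ℝ) :
    GA k σ g x - GA k σ g' x = GA k σ (fun y => g y - g' y) x := by
  unfold GA
  rw [← integral_sub (hk.integrable_mul hg hB σ x) (hk.integrable_mul hg' hB' σ x)]
  congr 1; ext z; ring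

lemma DV_diff {d B l A : ℝ} {F F' : ℝ → ℝ → ℝ} (hl : 0 < l)
    (hF : Continuous (fun q : ℝ × ℝ => F q.1 q.2)) (hB : ∀ s y, |F s y| ≤ B)
    (hF' : Continuous (fun q : ℝ × ℝ => F' q.1 q.2)) (hB' : ∀ s y, |F' s y| ≤ B)
    (hA : ∀ s y, 0 ≤ s → |F s y - F' s y| ≤ A * Real.exp (l * s)) (hA0 : 0 ≤ A)
    {t : ℝ} (ht : 0 ≤ t) (x : ℝ) :
    |DV d F t x - DV d F' t x| ≤ A * (Real.exp (l * t) / l) := by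
  have hi : ∀ F : ℝ → ℝ → ℝ, Continuous (fun q : ℝ × ℝ => F q.1 q.2) → (∀ s y, |F s y| ≤ B) →
      IntervalIntegrable (fun τ => Ps d τ (F (t - τ)) x) volume 0 t := by
    intro F hF hB
    exact (GAF_cont (τ := fun τ => τ) ker_ga hF hB (by fun_prop) (by fun_prop)
      (by fun_prop)).intervalIntegrable _ _
  rw [DV, DV, ← intervalIntegral.integral_sub (hi F hF hB) (hi F' hF' hB')]
  rw [← Real.norm_eq_abs]
  refine (intervalIntegral.norm_integral_le_of_norm_le
    (g := fun τ => A * Real.exp (l * (t - τ))) ht ?_ ?_).trans ?_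
  · refine Eventually.of_forall fun τ hτ => ?_
    unfold Ps
    rw [GA_sub ker_ga (F_cont hF _) (F_cont hF' _) (hB _) (hB' _)]
    exact ga_abs (fun y => hA _ y (by linarith [hτ.2])) _ _
  · exact (by fun_prop : Continuous fun τ => A * Real.exp (l * (t - τ))).intervalIntegrable _ _
  · rw [intervalIntegral.integral_const_mul]
    exact mul_le_mul_of_nonneg_left (exp_int_bound hl ht) hA0

lemma mild_exists {d K B κ : ℝ} (hK : 0 < K) (hκ : 0 ≤ κ) {g : ℝ → ℝ → ℝ → ℝ}
    (hg : Continuous (fun q : ℝ × ℝ × ℝ => g q.1 q.2.1 q.2.2)) (hB : ∀ t x u, |g t x u| ≤ B)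
    (hl : ∀ t x u v, |g t x u - g t x v| ≤ K * |u - v|) :
    ∃ v : ℝ → ℝ → ℝ, Continuous (fun q : ℝ × ℝ => v q.1 q.2) ∧
      ∀ t, 0 ≤ t → ∀ x, v t x = κ + DV d (fun s y => g s y (v s y)) t x := by
  set l : ℝ := 2 * K with hldef
  have hlp : 0 < l := by positivity
  have hB0 : 0 ≤ B := (abs_nonneg _).trans (hB 0 0 0)
  let Fw : BoundedContinuousFunction (ℝ × ℝ) ℝ → ℝ → ℝ → ℝ :=
    fun w s y => g s y (Real.exp (l * max s 0) * w (s, y))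
  have hFc : ∀ w, Continuous (fun q : ℝ × ℝ => Fw w q.1 q.2) := by
    intro w
    have : Continuous (fun q : ℝ × ℝ => (q.1, q.2, Real.exp (l * max q.1 0) * w (q.1, q.2))) := by
      have := w.continuous
      fun_prop
    exact hg.comp this
  have hFB : ∀ w s y, |Fw w s y| ≤ B := fun w s y => hB _ _ _
  have hbnd : ∀ t : ℝ, 0 ≤ t → Real.exp (-l * t) * (κ + B * t) ≤ κ + B / l := by
    intro t ht
    have h1 : Real.exp (-l * t) ≤ 1 := by
      rw [Real.exp_le_one_iff]; nlinarith
    have h2 : t * Real.exp (-l * t) ≤ 1 / l := by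
      have h3 := Real.add_one_le_exp (l * t)
      have h4 : Real.exp (l * t) * Real.exp (-l * t) = 1 := by
        rw [← Real.exp_add]; simp
      have h5 := Real.exp_pos (-l * t)
      rw [le_div_iff₀ hlp]
      nlinarith
    calc Real.exp (-l * t) * (κ + B * t) = Real.exp (-l * t) * κ + B * (t * Real.exp (-l * t)) := by
          ring
      _ ≤ 1 * κ + B * (1 / l) := by gcongr
      _ = _ := by ring
  let Φ : BoundedContinuousFunction (ℝ × ℝ) ℝ → BoundedContinuousFunction (ℝ × ℝ) ℝ := fun w =>
    BoundedContinuousFunction.ofNormedAddCommGroup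
      (fun q : ℝ × ℝ => Real.exp (-l * max q.1 0) * (κ + DV d (Fw w) (max q.1 0) q.2))
      (by
        have h1 := (DV_cont (d := d) (hFc w) (hFB w)).comp
          (f := fun q : ℝ × ℝ => (max q.1 0, q.2)) (by fun_prop)
        have h2 : Continuous (fun q : ℝ × ℝ => Real.exp (-l * max q.1 0)) := by fun_prop
        exact h2.mul (continuous_const.add h1))
      (κ + B / l)
      (by
        rintro ⟨t, x⟩
        simp only
        have h0 : 0 ≤ max t 0 := le_max_right _ _
        rw [norm_mul, Real.norm_of_nonneg (Real.exp_pos _).le]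
        refine le_trans ?_ (hbnd _ h0)
        refine mul_le_mul_of_nonneg_left ?_ (Real.exp_pos _).le
        refine (norm_add_le _ _).trans ?_
        rw [Real.norm_of_nonneg hκ]
        exact add_le_add le_rfl (DV_bound (hFB w) h0 x))
  have hΦ : ContractingWith (1/2 : NNReal) Φ := by
    refine ⟨by norm_num, LipschitzWith.of_dist_le_mul fun w w' => ?_⟩
    rw [BoundedContinuousFunction.dist_le (by positivity)]
    rintro ⟨t, x⟩
    show dist (Real.exp (-l * max t 0) * (κ + DV d (Fw w) (max t 0) x))
      (Real.exp (-l * max t 0) * (κ + DV d (Fw w') (max t 0) x)) ≤ _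
    have h0 : 0 ≤ max t 0 := le_max_right _ _
    have h1 := DV_diff (d := d) (A := K * dist w w') hlp (hFc w) (hFB w) (hFc w') (hFB w')
      (fun s y hs => by
        refine (hl _ _ _ _).trans ?_
        rw [max_eq_left hs, ← mul_sub, abs_mul, abs_of_pos (Real.exp_pos _)]
        have h2 := BoundedContinuousFunction.dist_coe_le_dist (f := w) (g := w') (s, y)
        rw [Real.dist_eq] at h2
        have := Real.exp_pos (l * s)
        calc K * (Real.exp (l * s) * |w (s, y) - w' (s, y)|)
            ≤ K * (Real.exp (l * s) * dist w w') := by gcongr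
          _ = _ := by ring) (by positivity) h0 x
    rw [Real.dist_eq, ← mul_sub, add_sub_add_left_eq_sub, abs_mul, abs_of_pos (Real.exp_pos _)]
    have h3 : Real.exp (-l * max t 0) * Real.exp (l * max t 0) = 1 := by
      rw [← Real.exp_add]; simp
    calc Real.exp (-l * max t 0) * |DV d (Fw w) (max t 0) x - DV d (Fw w') (max t 0) x|
        ≤ Real.exp (-l * max t 0) * (K * dist w w' * (Real.exp (l * max t 0) / l)) := by gcongr
      _ = (Real.exp (-l * max t 0) * Real.exp (l * max t 0)) * (K / l) * dist w w' := by ring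
      _ = (K / l) * dist w w' := by rw [h3, one_mul]
      _ = _ := by
          rw [hldef, show K / (2 * K) = 1/2 by field_simp]
          norm_num
  set w := ContractingWith.fixedPoint Φ hΦ
  have hw : Φ w = w := hΦ.fixedPoint_isFixedPt
  refine ⟨fun t x => Real.exp (l * max t 0) * w (t, x), ?_, ?_⟩
  · have := w.continuous
    fun_prop
  · intro t ht x
    have h1 : w (t, x) = Real.exp (-l * max t 0) * (κ + DV d (Fw w) (max t 0) x) := by
      conv_lhs => rw [← hw]
      rfl
    simp only
    rw [h1, ← mul_assoc, ← Real.exp_add, max_eq_left ht]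
    simp
    rfl

lemma mild_solves {d K B κ : ℝ} (hd : 0 < d) (hK : 0 < K) (hκ : 0 ≤ κ) {g : ℝ → ℝ → ℝ → ℝ}
    (hg : Continuous (fun q : ℝ × ℝ × ℝ => g q.1 q.2.1 q.2.2)) (hB : ∀ t x u, |g t x u| ≤ B)
    (hl : ∀ t x u v, |g t x u - g t x v| ≤ K * |u - v|) {α C : ℝ} (hα : α ∈ Ioo (0:ℝ) 1)
    (hC : 0 ≤ C) (hH : ∀ t x y u, |g t x u - g t y u| ≤ C * |x - y| ^ α) :
    ∃ v : ℝ → ℝ → ℝ, Continuous (fun q : ℝ × ℝ => v q.1 q.2) ∧ (∀ x, v 0 x = κ) ∧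
      SolvesPDE d g v {q : ℝ × ℝ | 0 < q.1} ∧ ∀ t, 0 ≤ t → ∀ x, |v t x| ≤ κ + B * t := by
  obtain ⟨v, hvc, hv⟩ := mild_exists (d := d) hK hκ hg hB hl
  set F : ℝ → ℝ → ℝ := fun s y => g s y (v s y) with hF
  have hFc : Continuous (fun q : ℝ × ℝ => F q.1 q.2) :=
    hg.comp (f := fun q : ℝ × ℝ => (q.1, q.2, v q.1 q.2)) (by fun_prop)
  have hFB : ∀ s y, |F s y| ≤ B := fun s y => hB _ _ _
  refine ⟨v, hvc, fun x => ?_, ?_, ?_⟩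
  · rw [hv 0 le_rfl]; simp [DV]
  · rintro ⟨t, x⟩ ht
    have ht : 0 < t := ht
    obtain ⟨Λ, hΛ0, hΛ⟩ := DV_lip hd hFc hFB (t + 1)
    have hH' : ∀ s, 0 ≤ s → s ≤ t + 1 → ∀ y y',
        |F s y - F s y'| ≤ C * |y - y'| ^ α + (K * Λ) * |y - y'| := by
      intro s h0 h1 y y'
      have e : F s y - F s y' = (g s y (v s y) - g s y' (v s y))
          + (g s y' (v s y) - g s y' (v s y')) := by simp [hF]
      rw [e]
      refine (abs_add_le _ _).trans (add_le_add (hH _ _ _ _) ?_)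
      refine (hl _ _ _ _).trans ?_
      rw [hv s h0 y, hv s h0 y', add_sub_add_left_eq_sub, mul_assoc]
      exact mul_le_mul_of_nonneg_left (hΛ s h0 h1 y y') hK.le
    have hKΛ : 0 ≤ K * Λ := by positivity
    have e1 : v t = fun x => κ + DV d F t x := by ext x; exact hv t ht.le x
    have h1 : ∀ y, HasDerivAt (v t) (DW1 d F t y) y := by
      intro y; rw [e1]; exact (DV_dx hd hFc hFB ht.le y).const_add κ
    have e2 : deriv (v t) = DW1 d F t := by ext y; exact (h1 y).deriv
    have h2 : HasDerivAt (deriv (v t)) (DW2 d F t x) x := by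
      rw [e2]; exact DW1_dx hd hFc hFB hC hKΛ hα hH' ht.le (by linarith) x
    refine ⟨(h1 x).differentiableAt, h2.differentiableAt, ?_⟩
    simp only
    rw [h2.deriv]
    have h3 : HasDerivAt (fun t => DV d F t x) (d * DW2 d F t x + F t x) t := by
      refine deriv_of_right (A := 0) (B := t + 1) (f' := fun t => d * DW2 d F t x + F t x) ?_ ?_ ?_
        ⟨ht, by linarith⟩
      · intro s hs
        exact DV_dt_right hd hFc hFB hC hKΛ hα hH' x hs
      · exact ((DV_cont hFc hFB).comp (f := fun t => (t, x)) (by fun_prop)).continuousOn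
      · intro s hs
        refine ContinuousAt.continuousWithinAt ?_
        refine (continuousAt_const.mul (DW2_cont_t hd hFc hFB hC hKΛ hα hH' x hs)).add ?_
        exact (hFc.comp (f := fun t => (t, x)) (by fun_prop)).continuousAt
    refine (h3.const_add κ).congr_of_eventuallyEq ?_
    filter_upwards [Ioi_mem_nhds ht] with s hs
    exact hv s (le_of_lt hs) x
  · intro t ht x
    rw [hv t ht]
    refine (abs_add_le _ _).trans ?_
    rw [abs_of_nonneg hκ]
    exact add_le_add le_rfl (DV_bound hFB ht x)

lemma cauchy_exists {d ω L : ℝ} {f : ℝ → ℝ → ℝ → ℝ} (hd : 0 < d) (hω : 0 < ω) (hL : 0 < L)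
    (hf : BasicAssumptions ω L f) {R : ℝ} (hR : 0 < R) (hRM : ∀ t x, f t x R ≤ 0)
    {κ : ℝ} (hκ : 0 < κ) (hκR : κ ≤ R) :
    ∃ v : ℝ → ℝ → ℝ, Continuous (fun q : ℝ × ℝ => v q.1 q.2) ∧
      IsCauchySolution d f (fun _ => κ) v ∧ ∀ t, 0 ≤ t → ∀ x, 0 ≤ v t x ∧ v t x ≤ R := by
  set cl : ℝ → ℝ := fun u => max 0 (min u R) with hcl
  have hclc : Continuous cl := by fun_prop
  have hcl0 : ∀ u, 0 ≤ cl u := fun u => le_max_left _ _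
  have hclR : ∀ u, cl u ≤ R := fun u => max_le hR.le (min_le_right _ _)
  have hcll : ∀ u v, |cl u - cl v| ≤ |u - v| := by
    intro u v
    have h1 := abs_max_sub_max_le_max 0 (min u R) 0 (min v R)
    have h2 := abs_min_sub_min_le_max u R v R
    simp only [sub_self, abs_zero] at h1 h2
    have h3 : max 0 |min u R - min v R| = |min u R - min v R| := max_eq_right (abs_nonneg _)
    have h4 : max |u - v| 0 = |u - v| := max_eq_left (abs_nonneg _)
    rw [h3] at h1
    rw [h4] at h2
    exact h1.trans h2
  obtain ⟨K, hK, hKl⟩ := f_lip hω hL hf R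
  obtain ⟨B, hB0, hB⟩ := f_bdd hω hL hf R
  obtain ⟨α, hα, hH⟩ := hf.holder
  obtain ⟨C, hC, hH⟩ := hH R hR
  obtain ⟨v, hvc, hv0, hvp, hvb⟩ := mild_solves (g := fun t x u => f t x (cl u)) (B := B) (κ := κ)
    hd hK hκ.le
    (by
      have : Continuous (fun q : ℝ × ℝ × ℝ => (q.1, q.2.1, cl q.2.2)) := by fun_prop
      exact hf.cont.comp_continuous this (fun q => hcl0 _))
    (fun t x u => hB _ _ _ (hcl0 u) (hclR u))
    (fun t x u v => (hKl _ _ _ _ (hcl0 u) (hclR u) (hcl0 v) (hclR v)).trans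
      (mul_le_mul_of_nonneg_left (hcll u v) hK.le)) hα hC.le
    (fun t x y u => by
      refine (hH t t x y _ (hcl0 u) (hclR u)).trans (le_of_eq ?_)
      rw [sub_self, abs_zero, Real.zero_rpow (by linarith [hα.1]), zero_add])
  have hjet : ∀ t x, 0 < t → ∃ uxx, Jet v t x (d * uxx + f t x (cl (v t x))) uxx := by
    intro t x ht
    exact jet_of_solves hvp (Eventually.of_forall fun y => ht)
  have hcl1 : ∀ u, u ≤ 0 → cl u = 0 := by
    intro u hu
    simp [hcl, hu]
  have hcl2 : ∀ u, R ≤ u → cl u = R := by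
    intro u hu
    simp [hcl, hu, hR.le]
  have hcl3 : ∀ u, 0 ≤ u → u ≤ R → cl u = u := by
    intro u hu hu2
    simp [hcl, hu, hu2]
  have hΩ : ∀ T : ℝ, IsClosed {q : ℝ × ℝ | 0 ≤ q.1 ∧ q.1 ≤ T} := fun T =>
    (isClosed_le continuous_const continuous_fst).inter
      (isClosed_le continuous_fst continuous_const)
  have hleft : ∀ T t x : ℝ, 0 < t → t ≤ T →
      ∀ᶠ s in 𝓝[≤] t, (s, x) ∈ {q : ℝ × ℝ | 0 ≤ q.1 ∧ q.1 ≤ T} := by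
    intro T t x h0 hT
    filter_upwards [self_mem_nhdsWithin, nhdsWithin_le_nhds (Ioi_mem_nhds h0)] with s h1 h2
    have h1 : s ≤ t := h1
    have h2 : 0 < s := h2
    exact ⟨h2.le, h1.trans hT⟩
  have hbb : ∀ T t x : ℝ, 0 ≤ t → t ≤ T → |v t x| ≤ κ + B * T := by
    intro T t x h0 h1
    refine (hvb t h0 x).trans ?_
    gcongr
  have hlow : ∀ t, 0 ≤ t → ∀ x, 0 ≤ v t x := by
    intro T hT x
    have := maxPrinciple (d := d) (K := 0) (T := T) (B := κ + B * T) hd.le _ (hΩ T) (fun q hq => hq)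
      (fun t x => -v t x) hvc.neg.continuousOn
      (fun q hq => (neg_le_abs _).trans (hbb T q.1 q.2 hq.1 hq.2))
      (fun t x hq hw => by
        have ht0 : 0 < t := by
          rcases hq.1.lt_or_eq with h | h
          · exact h
          · simp only at h; rw [← h, hv0] at hw; linarith
        refine ⟨Eventually.of_forall fun y => hq, hleft T t x ht0 hq.2, ?_⟩
        obtain ⟨vxx, hj⟩ := hjet t x ht0
        rw [hcl1 _ (by linarith), hf.zero] at hj
        have := hj.cmul (-1)
        simp only [neg_mul, one_mul] at this
        exact ⟨_, _, this, by linarith⟩) T x ⟨hT, le_rfl⟩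
    linarith
  have hup : ∀ t, 0 ≤ t → ∀ x, v t x ≤ R := by
    intro T hT x
    have := maxPrinciple (d := d) (K := 0) (T := T) (B := κ + B * T) hd.le _ (hΩ T) (fun q hq => hq)
      (fun t x => v t x - R) (hvc.sub continuous_const).continuousOn
      (fun q hq => by
        have := (le_abs_self _).trans (hbb T q.1 q.2 hq.1 hq.2)
        linarith)
      (fun t x hq hw => by
        have ht0 : 0 < t := by
          rcases hq.1.lt_or_eq with h | h
          · exact h
          · simp only at h; rw [← h, hv0] at hw; linarith
        refine ⟨Eventually.of_forall fun y => hq, hleft T t x ht0 hq.2, ?_⟩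
        obtain ⟨vxx, hj⟩ := hjet t x ht0
        rw [hcl2 _ (by linarith)] at hj
        have h2 := hj.sub (Jet.const R t x)
        have := hRM t x
        exact ⟨_, _, h2, by linarith⟩) T x ⟨hT, le_rfl⟩
    linarith
  refine ⟨v, hvc, ⟨hv0, hvc.continuousOn, ?_, R, ?_⟩, fun t ht x => ⟨hlow t ht x, hup t ht x⟩⟩
  · rintro ⟨t, x⟩ ht
    have ht' : 0 < t := ht
    obtain ⟨h1, h2, h3⟩ := hvp (t, x) ht
    refine ⟨h1, h2, ?_⟩
    simp only at h3 ⊢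
    rwa [hcl3 _ (hlow t ht'.le x) (hup t ht'.le x)] at h3
  · intro t ht x
    rw [abs_of_nonneg (hlow t ht x)]
    exact hup t ht x

end

section

/-- everything we need to know about `f` and `p` -/
structure Ctx (d ω L R K pm : ℝ) (f : ℝ → ℝ → ℝ → ℝ) (p : ℝ → ℝ → ℝ) : Prop where
  hd : 0 < d
  hω : 0 < ω
  hL : 0 < L
  hR : 0 < R
  hK : 0 < K
  hpm : 0 < pm
  f0 : ∀ t x, f t x 0 = 0
  lip : ∀ t x u v : ℝ, 0 ≤ u → u ≤ R → 0 ≤ v → v ≤ R → |f t x u - f t x v| ≤ K * |u - v|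
  fper_t : ∀ t x u : ℝ, 0 ≤ u → f (t + ω) x u = f t x u
  fper_x : ∀ t x u : ℝ, 0 ≤ u → f t (x + L) u = f t x u
  pper_t : ∀ t x, p (t + ω) x = p t x
  pper_x : ∀ t x, p t (x + L) = p t x
  pc : Continuous (fun q : ℝ × ℝ => p q.1 q.2)
  psol : SolvesPDE d f p univ
  pge : ∀ t x, pm ≤ p t x
  ple : ∀ t x, p t x ≤ R
  cau : ∀ κ, 0 < κ → κ ≤ 1 → ∃ v : ℝ → ℝ → ℝ, Continuous (fun q : ℝ × ℝ => v q.1 q.2) ∧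
    (∀ x, v 0 x = κ) ∧ SolvesPDE d f v {q : ℝ × ℝ | 0 < q.1} ∧
    (∀ t, 0 ≤ t → ∀ x, 0 ≤ v t x ∧ v t x ≤ R) ∧
    ∀ ε > 0, ∃ S, ∀ t ≥ S, ∀ x, |v t x - p t x| ≤ ε

lemma per_nat {ω : ℝ} {g : ℝ → ℝ} (h : ∀ t, g (t + ω) = g t) (n : ℕ) (t : ℝ) :
    g (t + n * ω) = g t := by
  have : Function.Periodic g ω := h
  exact this.nat_mul n t

lemma exists_nat_mul_ge {ω : ℝ} (hω : 0 < ω) (A : ℝ) : ∃ n : ℕ, ∀ m : ℕ, n ≤ m → A ≤ m * ω := by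
  obtain ⟨n, hn⟩ := exists_nat_ge (A / ω)
  refine ⟨n, fun m hm => ?_⟩
  rw [div_le_iff₀ hω] at hn
  have : (n : ℝ) ≤ m := by exact_mod_cast hm
  nlinarith

lemma ctx_exists {d ω L : ℝ} {f : ℝ → ℝ → ℝ → ℝ} {p : ℝ → ℝ → ℝ} (hd : 0 < d) (hω : 0 < ω)
    (hL : 0 < L) (hf : BasicAssumptions ω L f) (hp : HypH d ω L f p) :
    ∃ R K pm, Ctx d ω L R K pm f p := by
  obtain ⟨M, hM, hfM⟩ := hf.neg_large
  set R := max M 1 with hR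
  have hRM : M ≤ R := le_max_left _ _
  have hR1 : 1 ≤ R := le_max_right _ _
  have hR0 : 0 < R := by linarith
  obtain ⟨K, hK, hlip⟩ := f_lip hω hL hf R
  have hc : ∀ κ, 0 < κ → κ ≤ 1 → ∃ v : ℝ → ℝ → ℝ, Continuous (fun q : ℝ × ℝ => v q.1 q.2) ∧
    (∀ x, v 0 x = κ) ∧ SolvesPDE d f v {q : ℝ × ℝ | 0 < q.1} ∧
    (∀ t, 0 ≤ t → ∀ x, 0 ≤ v t x ∧ v t x ≤ R) ∧
    ∀ ε > 0, ∃ S, ∀ t ≥ S, ∀ x, |v t x - p t x| ≤ ε := by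
    intro κ hκ hκ1
    obtain ⟨v, hvc, hv, hvb⟩ := cauchy_exists hd hω hL hf hR0 (fun t x => hfM t x R hRM) hκ
      (hκ1.trans hR1)
    refine ⟨v, hvc, hv.init, hv.pde, hvb, fun ε hε => ?_⟩
    obtain ⟨S, hS⟩ := hp.conv (fun _ => κ) continuous_const ⟨|κ|, fun _ => le_rfl⟩
      ⟨κ, hκ, fun _ => le_rfl⟩ v hv ε hε
    refine ⟨S, fun t ht x => ?_⟩
    have := hS S le_rfl (t - S) (by linarith) x
    simpa using this
  obtain ⟨v, hvc, hv0, -, hvb, hvconv⟩ := hc 1 one_pos le_rfl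
  have hpn : ∀ (n : ℕ) t x, p (t + n * ω) x = p t x := fun n t x =>
    per_nat (g := fun t => p t x) (fun t => hp.per_t t x) n t
  have hple : ∀ t x, p t x ≤ R := by
    intro t x
    refine le_of_forall_pos_le_add fun ε hε => ?_
    obtain ⟨S, hS⟩ := hvconv ε hε
    obtain ⟨n, hn⟩ := exists_nat_mul_ge hω (max S 0 - t)
    have h1 := hn n le_rfl
    have h2 : S ≤ t + n * ω := by have := le_max_left S 0; linarith
    have h3 : 0 ≤ t + n * ω := by have := le_max_right S 0; linarith
    have h4 := hS _ h2 x
    rw [hpn, abs_sub_le_iff] at h4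
    have := (hvb _ h3 x).2
    linarith
  have hpc : Continuous (fun q : ℝ × ℝ => p q.1 q.2) := by
    rw [continuous_iff_continuousAt]
    rintro ⟨t0, x0⟩
    have hU : IsOpen {q : ℝ × ℝ | t0 - 1 < q.1} := isOpen_lt continuous_const continuous_fst
    have hunif : TendstoUniformlyOn (fun (n : ℕ) (q : ℝ × ℝ) => v (q.1 + n * ω) q.2)
        (fun q => p q.1 q.2) atTop {q : ℝ × ℝ | t0 - 1 < q.1} := by
      rw [Metric.tendstoUniformlyOn_iff]
      intro ε hε
      obtain ⟨S, hS⟩ := hvconv (ε / 2) (by linarith)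
      obtain ⟨n, hn⟩ := exists_nat_mul_ge hω (S - (t0 - 1))
      filter_upwards [eventually_ge_atTop n] with m hm q hq
      have h1 := hn m hm
      have hq : t0 - 1 < q.1 := hq
      have h2 := hS (q.1 + m * ω) (by linarith) q.2
      rw [hpn] at h2
      rw [dist_comm, Real.dist_eq]
      linarith
    have := hunif.continuousOn (Eventually.frequently (Eventually.of_forall fun n => by
      have : Continuous (fun q : ℝ × ℝ => (q.1 + n * ω, q.2)) := by fun_prop
      exact (hvc.comp this).continuousOn))
    exact this.continuousAt (hU.mem_nhds (by simp))
  have hpm : ∃ pm, 0 < pm ∧ ∀ t x, pm ≤ p t x := by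
    have hcomp : IsCompact (Icc 0 ω ×ˢ Icc 0 L : Set (ℝ × ℝ)) := isCompact_Icc.prod isCompact_Icc
    obtain ⟨q, hq, hmin⟩ := hcomp.exists_isMinOn
      ⟨(0, 0), ⟨⟨le_rfl, hω.le⟩, ⟨le_rfl, hL.le⟩⟩⟩ hpc.continuousOn
    refine ⟨p q.1 q.2, hp.pos _ _, fun t x => ?_⟩
    have p1 : Function.Periodic (fun t => p t x) ω := fun t => hp.per_t t x
    obtain ⟨t', ht', e1⟩ := p1.exists_mem_Ico₀ hω t
    have p2 : Function.Periodic (fun x => p t' x) L := fun x => hp.per_x t' x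
    obtain ⟨x', hx', e2⟩ := p2.exists_mem_Ico₀ hL x
    have e : p t x = p t' x' := Eq.trans e1 e2
    rw [e]
    exact hmin (show (t', x') ∈ _ from ⟨⟨ht'.1, ht'.2.le⟩, ⟨hx'.1, hx'.2.le⟩⟩)
  obtain ⟨pm, hpm0, hpm⟩ := hpm
  exact ⟨R, K, pm, hd, hω, hL, hR0, hK, hpm0, hf.zero, hlip, hf.per_t, hf.per_x, hp.per_t,
    hp.per_x, hpc, hp.sol, hpm, hple, hc⟩

end

section

/-- maximum principle on a time slab of a closed set -/
lemma mp {d K s T B : ℝ} (hd : 0 ≤ d) (hs : 0 ≤ s) (G : Set (ℝ × ℝ)) (hG : IsClosed G)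
    (w : ℝ → ℝ → ℝ)
    (hc : ContinuousOn (fun q : ℝ × ℝ => w q.1 q.2) (G ∩ {q : ℝ × ℝ | s ≤ q.1 ∧ q.1 ≤ T}))
    (hB : ∀ t x, (t, x) ∈ G → s ≤ t → t ≤ T → w t x ≤ B)
    (hsub : ∀ t x, (t, x) ∈ G → s ≤ t → t ≤ T → 0 < w t x → s < t ∧ G ∈ 𝓝 (t, x) ∧
      ∃ wt wxx, Jet w t x wt wxx ∧ wt ≤ d * wxx + K * w t x) :
    ∀ t x, (t, x) ∈ G → s ≤ t → t ≤ T → w t x ≤ 0 := by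
  have hcl : IsClosed (G ∩ {q : ℝ × ℝ | s ≤ q.1 ∧ q.1 ≤ T}) :=
    hG.inter ((isClosed_le continuous_const continuous_fst).inter
      (isClosed_le continuous_fst continuous_const))
  intro t x h1 h2 h3
  refine maxPrinciple (d := d) (K := K) (T := T) (B := B) hd _ hcl
    (fun q hq => ⟨hs.trans hq.2.1, hq.2.2⟩) w hc (fun q hq => hB _ _ hq.1 hq.2.1 hq.2.2)
    ?_ t x ⟨h1, h2, h3⟩
  rintro t x ⟨hG1, ht1, ht2⟩ hw
  obtain ⟨hst, hn, hJ⟩ := hsub t x hG1 ht1 ht2 hw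
  refine ⟨?_, ?_, hJ⟩
  · have : ∀ᶠ y in 𝓝 x, (t, y) ∈ G :=
      (Continuous.prodMk_right t).continuousAt.eventually_mem hn
    filter_upwards [this] with y hy using ⟨hy, ht1, ht2⟩
  · have h1 : ∀ᶠ r in 𝓝 t, (r, x) ∈ G :=
      (Continuous.prodMk_left x).continuousAt.eventually_mem hn
    filter_upwards [nhdsWithin_le_nhds h1, nhdsWithin_le_nhds (lt_mem_nhds hst),
      self_mem_nhdsWithin] with r hr1 hr2 hr3
    exact ⟨hr1, hr2.le, le_trans hr3 ht2⟩

/-- an admissible solution, cleaned up -/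
structure Pre (d μ ω : ℝ) (f : ℝ → ℝ → ℝ → ℝ) (p u : ℝ → ℝ → ℝ) (h : ℝ → ℝ) : Prop where
  hcont : Continuous h
  ucont : Continuous (fun q : ℝ × ℝ => u q.1 q.2)
  uz : ∀ t, 0 ≤ t → ∀ x, h t ≤ x → u t x = 0
  pde : SolvesPDE d f u {q : ℝ × ℝ | 0 < q.1 ∧ q.2 < h q.1}
  up : ∀ t, 0 ≤ t → ∀ x, u t x ≤ p t x
  bdd : ∃ C, ∀ t, 0 ≤ t → ∀ x, |u t x| ≤ C
  stefan : ∀ t > (0:ℝ), HasDerivAt h (-μ * derivWithin (u t) (Set.Iic (h t)) (h t)) t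
  hdc : ContinuousOn (deriv h) (Ioi 0)
  u0 : ∀ x < h 0, 0 < u 0 x
  gap : ∃ ε > (0:ℝ), ∃ X : ℝ, ∀ x ≤ X, ε ≤ p 0 x - u 0 x
  conv : ∀ C : ℝ, ∀ ε > 0, ∃ N : ℕ, ∀ n : ℕ, N ≤ n → ∀ x ≤ C, |u ((n : ℝ) * ω) x - p 0 x| ≤ ε

lemma pre_of_sol {d μ ω L R K pm : ℝ} {f : ℝ → ℝ → ℝ → ℝ} {p : ℝ → ℝ → ℝ}
    (hf : BasicAssumptions ω L f) (X : Ctx d ω L R K pm f p)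
    {h₀ : ℝ} {u₀ : ℝ → ℝ} (hu₀ : memHplus h₀ u₀) (hle : ∀ x ≤ h₀, u₀ x ≤ p 0 x)
    (hgap : ∃ ε > (0:ℝ), ∃ X : ℝ, ∀ x ≤ X, ε ≤ p 0 x - u₀ x)
    {u : ℝ → ℝ → ℝ} {h : ℝ → ℝ} (hu : IsHalfFBPSolution d μ f h₀ u₀ u h)
    (hconv : ∀ C : ℝ, ∀ ε > 0, ∃ N : ℕ, ∀ n : ℕ, N ≤ n → ∀ x ≤ C,
        |u ((n : ℝ) * ω) x - p 0 x| ≤ ε) :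
    Pre d μ ω f p (fun t x => u (max t 0) x) (fun t => h (max t 0)) := by
  have uz : ∀ t, 0 ≤ t → ∀ x, h t ≤ x → u t x = 0 := by
    intro t ht x hx
    rcases hx.lt_or_eq with h1 | h1
    · exact hu.ext t ht x h1
    · rw [← h1]
      rcases ht.lt_or_eq with h2 | h2
      · exact hu.bc t h2
      · rw [← h2, hu.h_init, hu.init _ le_rfl, hu₀.2.2.1]
  have hcon : ContinuousOn h (Ici 0) := hu.h_smooth.continuousOn
  have hcont : Continuous (fun t => h (max t 0)) :=
    hcon.comp_continuous (by fun_prop) (fun t => mem_Ici.2 (le_max_right _ _))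
  have hFc : Continuous (fun q : ℝ × ℝ => u (max q.1 0) q.2) := by
    have : ContinuousOn (fun q : ℝ × ℝ => u (max q.1 0) q.2)
        ({q : ℝ × ℝ | q.2 ≤ h (max q.1 0)} ∪ {q : ℝ × ℝ | h (max q.1 0) ≤ q.2}) := by
      apply ContinuousOn.union_of_isClosed
      · exact hu.u_cont.comp (g := fun q : ℝ × ℝ => u q.1 q.2)
          (f := fun q : ℝ × ℝ => (max q.1 0, q.2)) (by fun_prop)
          (fun q hq => ⟨le_max_right _ _, hq⟩)
      · refine (continuousOn_const (c := (0:ℝ))).congr fun q hq => ?_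
        exact uz _ (le_max_right _ _) _ hq
      · exact isClosed_le continuous_snd (hcont.comp continuous_fst)
      · exact isClosed_le (hcont.comp continuous_fst) continuous_snd
    rw [← continuousOn_univ]
    refine this.mono fun q _ => ?_
    exact le_total q.2 (h (max q.1 0))
  have hm : ∀ t : ℝ, 0 ≤ t → max t 0 = t := fun t ht => max_eq_left ht
  have hme : ∀ t : ℝ, 0 < t → ∀ᶠ s in 𝓝 t, max s 0 = s := fun t ht =>
    (lt_mem_nhds ht).mono fun s hs => hm s (le_of_lt hs)
  have pde : SolvesPDE d f (fun t x => u (max t 0) x)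
      {q : ℝ × ℝ | 0 < q.1 ∧ q.2 < h (max q.1 0)} := by
    rintro ⟨t, x⟩ ⟨h1, h2⟩
    dsimp only at h1 h2
    rw [hm t h1.le] at h2
    obtain ⟨a, b, c⟩ := hu.pde (t, x) ⟨h1, h2⟩
    dsimp only at a b c ⊢
    rw [hm t h1.le]
    refine ⟨a, b, c.congr_of_eventuallyEq ?_⟩
    filter_upwards [hme t h1] with s hs
    rw [hs]
  have bdd : ∃ C, ∀ t, 0 ≤ t → ∀ x, |u (max t 0) x| ≤ C := by
    obtain ⟨C, hC⟩ := hu.bdd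
    exact ⟨C, fun t ht x => hC _ (le_max_right _ _) x⟩
  have up : ∀ t, 0 ≤ t → ∀ x, u (max t 0) x ≤ p t x := by
    obtain ⟨C, hC⟩ := bdd
    obtain ⟨K', hK', hl⟩ := f_lip X.hω X.hL hf (max C R)
    intro t ht x
    have hCR : C ≤ max C R := le_max_left _ _
    have hRR : R ≤ max C R := le_max_right _ _
    have key := mp (d := d) (K := K') (s := 0) (T := t) (B := C) X.hd.le le_rfl univ isClosed_univ
      (fun t x => u (max t 0) x - p t x) ((hFc.sub X.pc).continuousOn) ?_ ?_ t x (mem_univ _) ht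
      le_rfl
    · linarith
    · intro t x _ ht _
      have h1 := (abs_le.1 (hC t ht x)).2
      have h2 := X.pge t x
      have h3 := X.hpm
      linarith
    · intro t x _ ht _ hw
      have h2 := X.pge t x
      have h3 := X.hpm
      have hxh : x < h (max t 0) := by
        by_contra hx
        push Not at hx
        rw [uz _ (le_max_right _ _) x hx] at hw
        linarith
      have ht0 : 0 < t := by
        rcases ht.lt_or_eq with h | h
        · exact h
        · exfalso
          rw [← h, max_self] at hw hxh
          rw [hu.h_init] at hxh
          have := hle x hxh.le
          rw [← hu.init x hxh.le, ← h] at *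
          linarith
      refine ⟨ht0, univ_mem, ?_⟩
      obtain ⟨uxx, hJ⟩ := jet_of_solves pde (t := t) (x := x) (by
        filter_upwards [gt_mem_nhds hxh] with y hy using ⟨ht0, hy⟩)
      obtain ⟨pxx, hJp⟩ := jet_of_solves X.psol (t := t) (x := x) (by simp)
      refine ⟨_, _, hJ.sub hJp, ?_⟩
      have h4 := hl t x (u (max t 0) x) (p t x) (by linarith)
        (((abs_le.1 (hC t ht x)).2).trans hCR) (by linarith) ((X.ple t x).trans hRR)
      rw [abs_of_pos hw] at h4
      have h5 := (abs_le.1 h4).2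
      linarith
  refine ⟨hcont, hFc, ?_, pde, up, bdd, ?_, ?_, ?_, ?_, ?_⟩
  · intro t _ x hx
    exact uz _ (le_max_right _ _) x hx
  · intro t ht
    rw [hm t ht.le]
    refine (hu.stefan t ht).congr_of_eventuallyEq ?_
    filter_upwards [hme t ht] with s hs
    rw [hs]
  · have h1 : ContinuousOn (deriv h) (Ioi 0) :=
      (hu.h_smooth.mono Ioi_subset_Ici_self).continuousOn_deriv_of_isOpen isOpen_Ioi le_rfl
    refine h1.congr fun t ht => ?_
    apply EventuallyEq.deriv_eq
    filter_upwards [hme t ht] with s hs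
    rw [hs]
  · intro x hx
    rw [max_self] at hx ⊢
    rw [hu.h_init] at hx
    rw [hu.init x hx.le]
    exact hu₀.2.2.2 x hx
  · obtain ⟨ε, hε, X, hX⟩ := hgap
    refine ⟨ε, hε, min X h₀, fun x hx => ?_⟩
    rw [max_self, hu.init x (hx.trans (min_le_right _ _))]
    exact hX x (hx.trans (min_le_left _ _))
  · intro C ε hε
    obtain ⟨N, hN⟩ := hconv C ε hε
    refine ⟨N, fun n hn x hx => ?_⟩
    have : (0:ℝ) ≤ n * ω := by have := X.hω; positivity
    rw [hm _ this]
    exact hN n hn x hx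

variable {d μ ω L R K pm : ℝ} {f : ℝ → ℝ → ℝ → ℝ} {p u : ℝ → ℝ → ℝ} {h : ℝ → ℝ}

lemma Ctx.fle (X : Ctx d ω L R K pm f p) {t x a : ℝ} (h0 : 0 ≤ a) (h1 : a ≤ R) :
    |f t x a| ≤ K * a := by
  have := X.lip t x a 0 h0 h1 le_rfl X.hR.le
  rwa [X.f0, sub_zero, sub_zero, abs_of_nonneg h0] at this

lemma Ctx.flip (X : Ctx d ω L R K pm f p) {t x a b : ℝ} (h0 : 0 ≤ b) (hab : b ≤ a) (h1 : a ≤ R) :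
    |f t x a - f t x b| ≤ K * (a - b) := by
  have := X.lip t x a b (h0.trans hab) h1 h0 (hab.trans h1)
  rwa [abs_of_nonneg (sub_nonneg.2 hab)] at this

lemma Pre.jet (P : Pre d μ ω f p u h) {t x : ℝ} (ht : 0 < t) (hx : x < h t) :
    ∃ uxx, Jet u t x (d * uxx + f t x (u t x)) uxx :=
  jet_of_solves P.pde (by filter_upwards [gt_mem_nhds hx] with y hy using ⟨ht, hy⟩)

lemma Pre.lt_of_pos (P : Pre d μ ω f p u h) {t x : ℝ} (ht : 0 ≤ t) (hu : 0 < u t x) : x < h t := by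
  by_contra hx
  push Not at hx
  rw [P.uz t ht x hx] at hu
  exact lt_irrefl _ hu

end

section

variable {d μ ω L R K pm : ℝ} {f : ℝ → ℝ → ℝ → ℝ} {p u : ℝ → ℝ → ℝ} {h : ℝ → ℝ}

lemma Jet.cexp (c K s t x : ℝ) : Jet (fun r (_ : ℝ) => c * Real.exp (-K * (r - s))) t x
    (-K * (c * Real.exp (-K * (t - s)))) 0 := by
  have h1 := (Jet.exp (K * s) (-K) 0 t x).cmul c
  have e : ∀ r y : ℝ, K * s + -K * r + 0 * y = -K * (r - s) := fun r y => by ring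
  simp only [e] at h1
  convert h1 using 1 <;> ring

/-- local positivity -/
lemma Pre.lp (X : Ctx d ω L R K pm f p) (P : Pre d μ ω f p u h) {s T a b : ℝ} (hs : 0 ≤ s)
    (ha : ∀ t, s ≤ t → t ≤ T → 0 < u t a) (hb : ∀ t, s ≤ t → t ≤ T → 0 < u t b)
    (h0 : ∀ x, a ≤ x → x ≤ b → 0 < u s x) :
    ∀ t x, s ≤ t → t ≤ T → a ≤ x → x ≤ b → 0 < u t x := by
  intro t' x' ht' htT' hax' hxb'
  by_contra hneg
  push Not at hneg
  have hsT : s ≤ T := ht'.trans htT'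
  have hab : a ≤ b := hax'.trans hxb'
  set Z : Set (ℝ × ℝ) := (Icc s T ×ˢ Icc a b) ∩ {q | u q.1 q.2 ≤ 0} with hZ
  have hZc : IsCompact Z := (isCompact_Icc.prod isCompact_Icc).inter_right
    (isClosed_le P.ucont continuous_const)
  have hZne : Z.Nonempty := ⟨(t', x'), ⟨⟨ht', htT'⟩, hax', hxb'⟩, hneg⟩
  obtain ⟨⟨t1, x1⟩, ⟨⟨⟨h11, h12⟩, h13, h14⟩, h15⟩, hmin⟩ :=
    hZc.exists_isMinOn hZne continuous_fst.continuousOn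
  dsimp only at h11 h12 h13 h14
  have h15 : u t1 x1 ≤ 0 := h15
  have hst1 : s < t1 := by
    rcases h11.lt_or_eq with h | h
    · exact h
    · rw [← h] at h15
      exact absurd h15 (not_le.2 (h0 x1 h13 h14))
  have hposlt : ∀ t x, s ≤ t → t < t1 → a ≤ x → x ≤ b → 0 < u t x := by
    intro t x h1 h2 h3 h4
    by_contra h5
    push Not at h5
    have := hmin (show (t, x) ∈ Z from ⟨⟨⟨h1, h2.le.trans h12⟩, h3, h4⟩, h5⟩)
    exact absurd (show t1 ≤ t from this) (not_le.2 h2)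
  have hnn : ∀ t x, s ≤ t → t ≤ t1 → a ≤ x → x ≤ b → 0 ≤ u t x := by
    intro t x h1 h2 h3 h4
    rcases h2.lt_or_eq with h5 | h5
    · exact (hposlt t x h1 h5 h3 h4).le
    · rw [h5]
      have hc : ContinuousWithinAt (fun r => u r x) (Iio t1) t1 :=
        (P.ucont.comp (Continuous.prodMk_left x)).continuousWithinAt
      refine ge_of_tendsto hc ?_
      filter_upwards [self_mem_nhdsWithin, nhdsWithin_le_nhds (lt_mem_nhds hst1)] with r h6 h7
      exact (hposlt r x (le_of_lt h7) h6 h3 h4).le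
  -- lower bound kappa
  obtain ⟨κ, hκ, hκ1, hκ2, hκ3⟩ : ∃ κ > 0, (∀ t, s ≤ t → t ≤ T → κ ≤ u t a) ∧
      (∀ t, s ≤ t → t ≤ T → κ ≤ u t b) ∧ (∀ x, a ≤ x → x ≤ b → κ ≤ u s x) := by
    obtain ⟨ta, hta, hma⟩ := (isCompact_Icc (a := s) (b := T)).exists_isMinOn ⟨s, le_rfl, hsT⟩
      (P.ucont.comp (Continuous.prodMk_left a)).continuousOn
    obtain ⟨tb, htb, hmb⟩ := (isCompact_Icc (a := s) (b := T)).exists_isMinOn ⟨s, le_rfl, hsT⟩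
      (P.ucont.comp (Continuous.prodMk_left b)).continuousOn
    obtain ⟨xc, hxc, hmc⟩ := (isCompact_Icc (a := a) (b := b)).exists_isMinOn ⟨a, le_rfl, hab⟩
      (P.ucont.comp (Continuous.prodMk_right s)).continuousOn
    refine ⟨min (u ta a) (min (u tb b) (u s xc)), lt_min (ha ta hta.1 hta.2)
      (lt_min (hb tb htb.1 htb.2) (h0 xc hxc.1 hxc.2)), ?_, ?_, ?_⟩
    · intro t h1 h2
      exact (min_le_left _ _).trans (hma ⟨h1, h2⟩)
    · intro t h1 h2
      exact (min_le_right _ _).trans ((min_le_left _ _).trans (hmb ⟨h1, h2⟩))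
    · intro t h1 h2
      exact (min_le_right _ _).trans ((min_le_right _ _).trans (hmc ⟨h1, h2⟩))
  have hE : ∀ t, s ≤ t → κ * Real.exp (-K * (t - s)) ≤ κ := by
    intro t ht
    have : Real.exp (-K * (t - s)) ≤ 1 := by
      rw [Real.exp_le_one_iff]
      nlinarith [X.hK]
    nlinarith
  have key := mp (d := d) (K := 0) (s := s) (T := t1) (B := κ) X.hd.le hs {q : ℝ × ℝ | a ≤ q.2 ∧ q.2 ≤ b}
    ((isClosed_le continuous_const continuous_snd).inter (isClosed_le continuous_snd continuous_const))
    (fun t x => κ * Real.exp (-K * (t - s)) - u t x)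
    (Continuous.continuousOn (by have := P.ucont; fun_prop)) ?_ ?_ t1 x1 ⟨h13, h14⟩ h11 le_rfl
  · have : 0 < κ * Real.exp (-K * (t1 - s)) := by positivity
    linarith
  · intro t x hx h1 h2
    have := hnn t x h1 h2 hx.1 hx.2
    have := hE t h1
    linarith
  · intro t x hx h1 h2 hw
    obtain ⟨hax, hxb⟩ := hx
    dsimp only at hax hxb
    have e1 := hE t h1
    have hst : s < t := by
      rcases h1.lt_or_eq with h | h
      · exact h
      · have := hκ3 x hax hxb
        rw [← h] at hw e1
        linarith
    have hax' : a < x := by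
      rcases hax.lt_or_eq with h | h
      · exact h
      · have := hκ1 t h1 (h2.trans h12)
        rw [← h] at hw
        linarith
    have hxb' : x < b := by
      rcases hxb.lt_or_eq with h | h
      · exact h
      · have := hκ2 t h1 (h2.trans h12)
        rw [h] at hw
        linarith
    refine ⟨hst, ?_, ?_⟩
    · refine IsOpen.mem_nhds ((isOpen_lt continuous_const continuous_snd).inter
        (isOpen_lt continuous_snd continuous_const)) ⟨hax', hxb'⟩ |> fun hh => mem_of_superset hh ?_
      rintro q ⟨hq1, hq2⟩
      exact ⟨le_of_lt hq1, le_of_lt hq2⟩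
    · have hxh : x < h t := hxb'.trans (P.lt_of_pos (hs.trans h1) (hb t h1 (h2.trans h12)))
      obtain ⟨uxx, hJ⟩ := P.jet (lt_of_le_of_lt hs hst) hxh
      refine ⟨_, _, (Jet.cexp κ K s t x).sub hJ, ?_⟩
      have hu0 := hnn t x h1 h2 hax hxb
      have hf := (abs_le.1 (X.fle (t := t) (x := x) hu0
        ((P.up t (hs.trans h1) x).trans (X.ple t x)))).1
      nlinarith [X.hK]

lemma Pre.oc (X : Ctx d ω L R K pm f p) (P : Pre d μ ω f p u h) :
    ∀ t, 0 ≤ t → ∀ a b c, a ≤ c → c ≤ b → 0 < u t a → 0 < u t b → 0 < u t c := by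
  by_contra hcon
  push Not at hcon
  set Bad : Set ℝ := {t | 0 ≤ t ∧ ∃ a b c, a ≤ c ∧ c ≤ b ∧ 0 < u t a ∧ 0 < u t b ∧ u t c ≤ 0} with hBad
  have hne : Bad.Nonempty := hcon
  have hbb : BddBelow Bad := ⟨0, fun t ht => ht.1⟩
  set τ := sInf Bad with hτ
  have hτ0 : 0 ≤ τ := le_csInf hne fun t ht => ht.1
  have hgood : ∀ t, 0 ≤ t → t < τ → ∀ a b c, a ≤ c → c ≤ b → 0 < u t a → 0 < u t b → 0 < u t c := by
    intro t h0 h1 a b c h2 h3 h4 h5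
    by_contra h6
    push Not at h6
    exact absurd (csInf_le hbb (show t ∈ Bad from ⟨h0, a, b, c, h2, h3, h4, h5, h6⟩)) (not_le.2 h1)
  have huc : ∀ x, Continuous fun t => u t x := fun x => P.ucont.comp (Continuous.prodMk_left x)
  have hgτ : ∀ a b c, a ≤ c → c ≤ b → 0 < u τ a → 0 < u τ b → 0 < u τ c := by
    intro a b c h2 h3 h4 h5
    rcases hτ0.lt_or_eq with h | h
    · have e1 : ∀ᶠ t in 𝓝 τ, 0 < u t a := (huc a).continuousAt.eventually (lt_mem_nhds h4)
      have e2 : ∀ᶠ t in 𝓝 τ, 0 < u t b := (huc b).continuousAt.eventually (lt_mem_nhds h5)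
      obtain ⟨ε, hε, hball⟩ := Metric.eventually_nhds_iff.1 ((e1.and e2).and (lt_mem_nhds h))
      have hd : ∀ t, τ - ε / 2 ≤ t → t ≤ τ → (0 < u t a ∧ 0 < u t b) ∧ 0 < t := by
        intro t h6 h7
        apply hball
        rw [Real.dist_eq, abs_lt]
        constructor <;> linarith
      have hs := hd (τ - ε / 2) le_rfl (by linarith)
      refine P.lp X (s := τ - ε / 2) (T := τ) (a := a) (b := b) hs.2.le (fun t h6 h7 => (hd t h6 h7).1.1)
        (fun t h6 h7 => (hd t h6 h7).1.2) (fun x h8 h9 => ?_) τ c (by linarith) le_rfl h2 h3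
      exact hgood _ hs.2.le (by linarith) a b x h8 h9 hs.1.1 hs.1.2
    · rw [← h] at h5 ⊢
      exact P.u0 c (h3.trans_lt (P.lt_of_pos le_rfl h5))
  have hnear : ∀ σ > 0, ∃ t ∈ Bad, t < τ + σ := fun σ hσ => exists_lt_of_csInf_lt hne (by linarith)
  by_cases hem : ∃ m, 0 < u τ m
  · obtain ⟨m, hm⟩ := hem
    have e1 : ∀ᶠ t in 𝓝 τ, 0 < u t m := (huc m).continuousAt.eventually (lt_mem_nhds hm)
    obtain ⟨ε, hε, hball⟩ := Metric.eventually_nhds_iff.1 e1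
    have hmp : ∀ t, τ ≤ t → t ≤ τ + ε / 2 → 0 < u t m := by
      intro t h6 h7
      apply hball
      rw [Real.dist_eq, abs_lt]
      constructor <;> linarith
    set Ω : Set (ℝ × ℝ) := {q | (τ ≤ q.1 ∧ q.1 ≤ τ + ε / 2) ∧ ∃ c ∈ uIcc m q.2, u q.1 c ≤ 0} with hΩ
    have hcl : IsClosed Ω := by
      have h1 : IsClosed {q : (ℝ × ℝ) × unitInterval | u q.1.1 (m + (q.2 : ℝ) * (q.1.2 - m)) ≤ 0} := by
        refine isClosed_le ?_ continuous_const
        exact P.ucont.comp (g := fun q : ℝ × ℝ => u q.1 q.2)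
          (f := fun q : (ℝ × ℝ) × unitInterval => (q.1.1, m + (q.2 : ℝ) * (q.1.2 - m))) (by fun_prop)
      have h2 := (isClosedMap_fst_of_compactSpace _ h1)
      have h3 : IsClosed {q : ℝ × ℝ | τ ≤ q.1 ∧ q.1 ≤ τ + ε / 2} :=
        (isClosed_le continuous_const continuous_fst).inter (isClosed_le continuous_fst continuous_const)
      convert h3.inter h2 using 1
      ext ⟨t, x⟩
      simp only [hΩ, mem_ofPred_eq, mem_inter_iff, mem_image, Prod.exists, exists_and_right,
        exists_eq_right, ← segment_eq_uIcc, segment_eq_image', smul_eq_mul]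
      refine and_congr_right fun _ => ?_
      constructor
      · rintro ⟨c, ⟨θ, hθ, rfl⟩, hc⟩
        exact ⟨⟨θ, hθ⟩, hc⟩
      · rintro ⟨⟨θ, hθ⟩, hc⟩
        exact ⟨_, ⟨θ, hθ, rfl⟩, hc⟩
    have hsep : ∀ t x c, c ∈ uIcc m x → 0 < u t m → 0 < u t x → u t c ≤ 0 →
        ∀ s, 0 ≤ s → s ≤ t → (∀ r, s ≤ r → r ≤ t → 0 < u r m ∧ 0 < u r x) → ∃ c' ∈ uIcc m x, u s c' ≤ 0 := by
      intro t x c hc hm hx huc' s hs hst hr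
      by_contra hno
      push Not at hno
      rcases le_total m x with hmx | hmx
      · rw [uIcc_of_le hmx] at hc hno
        have := P.lp X hs (fun r h1 h2 => (hr r h1 h2).1) (fun r h1 h2 => (hr r h1 h2).2)
          (fun y h1 h2 => hno y ⟨h1, h2⟩) t c hst le_rfl hc.1 hc.2
        linarith
      · rw [uIcc_of_ge hmx] at hc hno
        have := P.lp X hs (fun r h1 h2 => (hr r h1 h2).2) (fun r h1 h2 => (hr r h1 h2).1)
          (fun y h1 h2 => hno y ⟨h1, h2⟩) t c hst le_rfl hc.1 hc.2
        linarith
    have key := maxPrinciple (d := d) (K := K) (T := τ + ε / 2) (B := R) X.hd.le Ω hcl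
      (fun q hq => ⟨hτ0.trans hq.1.1, hq.1.2⟩) u P.ucont.continuousOn
      (fun q hq => (P.up _ (hτ0.trans hq.1.1) _).trans (X.ple _ _)) ?_
    · obtain ⟨t, ⟨h0, a, b, c, h1, h2, h3, h4, h5⟩, h6⟩ := hnear (ε / 2) (by linarith)
      have hτt : τ ≤ t := csInf_le hbb ⟨h0, a, b, c, h1, h2, h3, h4, h5⟩
      rcases le_total c m with hcm | hcm
      · have := key t a ⟨⟨hτt, h6.le⟩, c, ?_, h5⟩
        · linarith
        · rw [uIcc_of_ge (h1.trans hcm)]; exact ⟨h1, hcm⟩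
      · have := key t b ⟨⟨hτt, h6.le⟩, c, ?_, h5⟩
        · linarith
        · rw [uIcc_of_le (hcm.trans h2)]; exact ⟨hcm, h2⟩
    · rintro t x ⟨⟨h1, h2⟩, c, hc, h5⟩ hw
      dsimp only at h1 h2 hc h5
      have hmt := hmp t h1 h2
      have hτt : τ < t := by
        rcases h1.lt_or_eq with h | h
        · exact h
        · exfalso
          rw [← h] at h5 hw
          rcases le_total m x with hmx | hmx
          · rw [uIcc_of_le hmx] at hc
            have := hgτ m x c hc.1 hc.2 hm hw
            linarith
          · rw [uIcc_of_ge hmx] at hc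
            have := hgτ x m c hc.1 hc.2 hw hm
            linarith
      have ht0 : 0 < t := lt_of_le_of_lt hτ0 hτt
      refine ⟨?_, ?_, ?_⟩
      · have hcx : c ≠ x := fun h => by rw [h] at h5; linarith
        have : ∀ᶠ y in 𝓝 x, c ∈ uIcc m y := by
          rcases le_total m x with hmx | hmx
          · rw [uIcc_of_le hmx] at hc
            filter_upwards [lt_mem_nhds (lt_of_le_of_ne hc.2 hcx)] with y hy
            rw [uIcc_of_le (hc.1.trans (le_of_lt hy))]
            exact ⟨hc.1, le_of_lt hy⟩
          · rw [uIcc_of_ge hmx] at hc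
            filter_upwards [gt_mem_nhds (lt_of_le_of_ne hc.1 hcx.symm)] with y hy
            rw [uIcc_of_ge ((le_of_lt hy).trans hc.2)]
            exact ⟨le_of_lt hy, hc.2⟩
        filter_upwards [this] with y hy
        exact ⟨⟨h1, h2⟩, c, hy, h5⟩
      · have e1 : ∀ᶠ s in 𝓝 t, 0 < u s x := (huc x).continuousAt.eventually (lt_mem_nhds hw)
        obtain ⟨δ, hδ, hb⟩ := Metric.eventually_nhds_iff.1 e1
        filter_upwards [self_mem_nhdsWithin, nhdsWithin_le_nhds (lt_mem_nhds hτt),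
          nhdsWithin_le_nhds (Metric.ball_mem_nhds t hδ)] with s hs1 hs2 hs3
        have hs1 : s ≤ t := hs1
        have hs2 : τ < s := hs2
        refine ⟨⟨hs2.le, hs1.trans h2⟩, ?_⟩
        refine hsep t x c hc hmt hw h5 s (hτ0.trans hs2.le) hs1 fun r hr1 hr2 =>
          ⟨hmp r (hs2.le.trans hr1) (hr2.trans h2), hb ?_⟩
        rw [Metric.mem_ball, Real.dist_eq, abs_lt] at hs3
        rw [Real.dist_eq, abs_lt]
        constructor <;> linarith
      · obtain ⟨uxx, hJ⟩ := P.jet ht0 (P.lt_of_pos ht0.le hw)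
        refine ⟨_, _, hJ, ?_⟩
        have hf := (abs_le.1 (X.fle (t := t) (x := x) hw.le
          ((P.up t ht0.le x).trans (X.ple t x)))).2
        linarith
  · push Not at hem
    obtain ⟨t, ⟨h0, a, b, c, h1, h2, h3, h4, h5⟩, h6⟩ := hnear 1 one_pos
    have hτt : τ ≤ t := csInf_le hbb ⟨h0, a, b, c, h1, h2, h3, h4, h5⟩
    have key := mp (d := d) (K := K) (s := τ) (T := t) (B := R) X.hd.le hτ0 univ isClosed_univ
      u P.ucont.continuousOn (fun t x _ h1 _ => (P.up _ (hτ0.trans h1) _).trans (X.ple _ _)) ?_ t a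
      (mem_univ _) hτt le_rfl
    · linarith
    · intro t x _ h1 _ hw
      have hτt : τ < t := by
        rcases h1.lt_or_eq with h | h
        · exact h
        · rw [← h] at hw
          have := hem x
          linarith
      have ht0 : 0 < t := lt_of_le_of_lt hτ0 hτt
      refine ⟨hτt, univ_mem, ?_⟩
      obtain ⟨uxx, hJ⟩ := P.jet ht0 (P.lt_of_pos ht0.le hw)
      refine ⟨_, _, hJ, ?_⟩
      have hf := (abs_le.1 (X.fle (t := t) (x := x) hw.le
        ((P.up t ht0.le x).trans (X.ple t x)))).2
      linarith

lemma Pre.unb (X : Ctx d ω L R K pm f p) (P : Pre d μ ω f p u h) {t : ℝ} (ht : 0 ≤ t) (x0 : ℝ) :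
    ∃ x < x0, 0 < u t x := by
  by_contra hcon
  push Not at hcon
  obtain ⟨N, hN⟩ := P.conv 0 (pm / 2) (by linarith [X.hpm])
  obtain ⟨n0, hn0⟩ := exists_nat_mul_ge X.hω t
  set n := max N n0
  have hn1 := hN n (le_max_left _ _)
  have hn2 := hn0 n (le_max_right _ _)
  have key : ∀ x, u (n * ω) x ≤ R * Real.exp ((-x0 - (K + d) * t) + (K + d) * (n * ω) + 1 * x) := by
    intro x
    have := mp (d := d) (K := K) (s := t) (T := n * ω) (B := R) X.hd.le ht univ isClosed_univ
      (fun t' x => u t' x - R * Real.exp ((-x0 - (K + d) * t) + (K + d) * t' + 1 * x))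
      (Continuous.continuousOn (by have := P.ucont; fun_prop)) ?_ ?_ (n * ω) x (mem_univ _) hn2 le_rfl
    · linarith
    · intro r x _ h1 _
      have := (P.up r (ht.trans h1) x).trans (X.ple _ _)
      have := X.hR
      have : 0 < R * Real.exp ((-x0 - (K + d) * t) + (K + d) * r + 1 * x) := by positivity
      linarith
    · intro r x _ h1 _ hw
      have hRR := X.hR
      have hEp : 0 < R * Real.exp ((-x0 - (K + d) * t) + (K + d) * r + 1 * x) := by positivity
      have hup : 0 < u r x := by linarith
      have hr : t < r := by
        rcases h1.lt_or_eq with h | h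
        · exact h
        · exfalso
          rw [← h] at hw hup
          rcases lt_or_ge x x0 with h3 | h3
          · linarith [hcon x h3]
          · have h4 := (P.up t ht x).trans (X.ple _ _)
            have h5 : 1 ≤ Real.exp ((-x0 - (K + d) * t) + (K + d) * t + 1 * x) := by
              apply Real.one_le_exp
              linarith
            nlinarith
      have hr0 := lt_of_le_of_lt ht hr
      refine ⟨hr, univ_mem, ?_⟩
      obtain ⟨uxx, hJ⟩ := P.jet hr0 (P.lt_of_pos hr0.le hup)
      refine ⟨_, _, hJ.sub ((Jet.exp _ _ _ r x).cmul R), ?_⟩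
      have hf := (abs_le.1 (X.fle (t := r) (x := x) hup.le
        ((P.up r hr0.le x).trans (X.ple r x)))).2
      nlinarith
  have hlim : Tendsto (fun x => R * Real.exp ((-x0 - (K + d) * t) + (K + d) * (n * ω) + 1 * x)) atBot (𝓝 (R * 0)) := by
    refine Tendsto.const_mul _ (Real.tendsto_exp_atBot.comp ?_)
    simp only [one_mul]
    exact tendsto_atBot_add_const_left _ _ tendsto_id
  rw [mul_zero] at hlim
  have hpm := X.hpm
  obtain ⟨x, hx1, hx2⟩ := ((hlim.eventually (gt_mem_nhds (show (0:ℝ) < pm / 2 by linarith))).and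
    (eventually_le_atBot 0)).exists
  have h1 := (abs_le.1 (hn1 x hx2)).1
  have h2 := key x
  have h3 := X.pge 0 x
  linarith

lemma Pre.down (X : Ctx d ω L R K pm f p) (P : Pre d μ ω f p u h) {t : ℝ} (ht : 0 ≤ t) {x b : ℝ}
    (hb : 0 < u t b) (hx : x ≤ b) : 0 < u t x := by
  obtain ⟨a, ha, hua⟩ := P.unb X ht x
  exact P.oc X t ht a b x ha.le hx hua hb

end

section

variable {d μ ω L R K pm : ℝ} {f : ℝ → ℝ → ℝ → ℝ} {p u : ℝ → ℝ → ℝ} {h : ℝ → ℝ}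

lemma slope_lower {g : ℝ → ℝ} {a b σ : ℝ} (hab : a < b) (hg : Continuous g)
    (hpos : ∀ x, a ≤ x → x < b → 0 < g x) (hb : g b = 0) (hσ : 0 < σ)
    (hd : HasDerivWithinAt g (-σ) (Iic b) b) :
    ∃ η > 0, ∀ x, a ≤ x → x ≤ b → η * (b - x) ≤ g x := by
  rw [hasDerivWithinAt_iff_tendsto_slope] at hd
  have h1 : ∀ᶠ x in 𝓝[Iic b \ {b}] b, slope g b x < -(σ / 2) :=
    hd.eventually (gt_mem_nhds (by linarith))
  rw [eventually_nhdsWithin_iff] at h1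
  obtain ⟨δ, hδ, hball⟩ := Metric.eventually_nhds_iff.1 h1
  have h2 : ∀ x, b - δ < x → x < b → σ / 2 * (b - x) ≤ g x := by
    intro x h3 h4
    have := hball (y := x) (by rw [Real.dist_eq, abs_lt]; constructor <;> linarith)
      ⟨h4.le, h4.ne⟩
    rw [slope_def_field, hb, sub_zero, div_lt_iff_of_neg (by linarith)] at this
    linarith
  set c := max a (b - δ / 2) with hc
  have hcb : c < b := max_lt hab (by linarith)
  obtain ⟨xm, hxm, hmin⟩ := (isCompact_Icc (a := a) (b := c)).exists_isMinOn
    ⟨a, le_rfl, le_max_left _ _⟩ hg.continuousOn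
  have hm := hpos xm hxm.1 (hxm.2.trans_lt hcb)
  have hba : 0 < b - a := by linarith
  refine ⟨min (σ / 2) (g xm / (b - a)), lt_min (by linarith) (by positivity), fun x h3 h4 => ?_⟩
  rcases h4.lt_or_eq with h5 | h5
  · rcases le_or_gt x c with h6 | h6
    · have h7 : g xm ≤ g x := hmin ⟨h3, h6⟩
      calc min (σ / 2) (g xm / (b - a)) * (b - x) ≤ g xm / (b - a) * (b - a) := by
            apply mul_le_mul (min_le_right _ _) (by linarith) (by linarith) (by positivity)
        _ = g xm := by field_simp
        _ ≤ g x := h7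
    · have h7 := h2 x (by have := le_max_right a (b - δ / 2); linarith) h5
      refine le_trans ?_ h7
      exact mul_le_mul_of_nonneg_right (min_le_left _ _) (by linarith)
  · rw [h5, hb, sub_self, mul_zero]

lemma slope_upper {g : ℝ → ℝ} {a b η D : ℝ} (hab : a < b)
    (hlow : ∀ x, a ≤ x → x ≤ b → η * (b - x) ≤ g x) (hb : g b = 0)
    (hd : HasDerivWithinAt g D (Iic b) b) : D ≤ -η := by
  rw [hasDerivWithinAt_iff_tendsto_slope] at hd
  have hset : Iic b \ {b} = Iio b := Iic_sdiff_right
  rw [hset] at hd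
  refine le_of_tendsto hd ?_
  filter_upwards [self_mem_nhdsWithin, nhdsWithin_le_nhds (lt_mem_nhds hab)] with x h1 h2
  have h1 : x < b := h1
  have h2 : a < x := h2
  rw [slope_def_field, hb, sub_zero, div_le_iff_of_neg (by linarith)]
  have := hlow x h2.le h1.le
  linarith

/-- Hopf type lower bound near a moving boundary -/
lemma hopf {d K s T C κ η0 x1 : ℝ} {W : ℝ → ℝ → ℝ} {h hd : ℝ → ℝ} (hd0 : 0 < d) (hK : 0 ≤ K)
    (hs : 0 ≤ s) (hsT : s ≤ T) (hc : Continuous h)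
    (hW : Continuous (fun q : ℝ × ℝ => W q.1 q.2))
    (hder : ∀ t, s < t → t ≤ T → HasDerivAt h (hd t) t) (hdC : ∀ t, s < t → t ≤ T → hd t ≤ C)
    (hpos : ∀ t x, s ≤ t → t ≤ T → x1 ≤ x → x ≤ h t → 0 ≤ W t x)
    (hκ : 0 < κ) (hside : ∀ t, s ≤ t → t ≤ T → κ ≤ W t x1)
    (hη : 0 < η0) (hbot : ∀ x, x1 ≤ x → x ≤ h s → η0 * (h s - x) ≤ W s x)
    (hsup : ∀ t x, s < t → t ≤ T → x1 < x → x < h t → ∃ Wt Wxx, Jet W t x Wt Wxx ∧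
      d * Wxx - K * W t x ≤ Wt) :
    ∃ η > 0, ∀ t x, s ≤ t → t ≤ T → x1 ≤ x → x ≤ h t → η * (h t - x) ≤ W t x := by
  obtain ⟨H, hH⟩ : ∃ H, ∀ t ∈ Icc s T, h t - x1 ≤ H := by
    obtain ⟨tm, htm, hmax⟩ := (isCompact_Icc (a := s) (b := T)).exists_isMaxOn ⟨s, le_rfl, hsT⟩
      hc.continuousOn
    exact ⟨h tm - x1, fun t ht => by have : h t ≤ h tm := hmax ht; linarith⟩
  set lam := (|C| + K) / d + 1 with hlam
  have hlam1 : 1 ≤ lam := by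
    have : 0 ≤ (|C| + K) / d := by positivity
    linarith
  have hlam0 : 0 < lam := by linarith
  have hdlam : |C| + K ≤ d * lam := by
    rw [hlam, mul_add, mul_div_cancel₀ _ hd0.ne']
    linarith
  have hdl2 : lam * C + K ≤ d * lam ^ 2 := by
    have h1 : lam * C ≤ lam * |C| := mul_le_mul_of_nonneg_left (le_abs_self _) hlam0.le
    nlinarith
  set H' := max H 0
  set η := min κ (η0 / lam) * Real.exp (-lam * H') with hηdef
  have hηp : 0 < η := by
    have : 0 < η0 / lam := by positivity
    have := lt_min hκ this
    positivity
  have hexp1 : ∀ z, Real.exp z - 1 ≤ z * Real.exp z := by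
    intro z
    have h1 := Real.add_one_le_exp (-z)
    have h2 : Real.exp (-z) * Real.exp z = 1 := by rw [← Real.exp_add]; simp
    nlinarith [Real.exp_pos z]
  have hηe : ∀ t x, s ≤ t → t ≤ T → x1 ≤ x → η * Real.exp (lam * (h t - x)) ≤ min κ (η0 / lam) := by
    intro t x h1 h2 h3
    rw [hηdef, mul_assoc, ← Real.exp_add]
    have h4 : Real.exp (-lam * H' + lam * (h t - x)) ≤ 1 := by
      rw [Real.exp_le_one_iff]
      have := hH t ⟨h1, h2⟩
      have : H ≤ H' := le_max_left _ _
      nlinarith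
    have : 0 < min κ (η0 / lam) := lt_min hκ (by positivity)
    nlinarith
  have hBeq : ∀ t x, η * (Real.exp (lam * h t) * Real.exp (-lam * x)) = η * Real.exp (lam * (h t - x)) := by
    intro t x
    rw [← Real.exp_add]
    ring_nf
  refine ⟨η * lam, by positivity, fun t x h1 h2 h3 h4 => ?_⟩
  have key := mp (d := d) (K := 0) (s := s) (T := T) (B := κ) hd0.le hs
    {q : ℝ × ℝ | x1 ≤ q.2 ∧ q.2 ≤ h q.1}
    ((isClosed_le continuous_const continuous_snd).inter
      (isClosed_le continuous_snd (hc.comp continuous_fst)))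
    (fun t x => η * (Real.exp (lam * h t) * Real.exp (-lam * x)) - η - W t x)
    (Continuous.continuousOn (by fun_prop)) ?_ ?_ t x ⟨h3, h4⟩ h1 h2
  · rw [hBeq] at key
    have := Real.add_one_le_exp (lam * (h t - x))
    nlinarith
  · rintro t x ⟨h3, h4⟩ h1 h2
    dsimp only at h3 h4
    rw [hBeq]
    have := (hηe t x h1 h2 h3).trans (min_le_left _ _)
    have := hpos t x h1 h2 h3 h4
    linarith
  · rintro t x ⟨h3, h4⟩ h1 h2 hw
    dsimp only at h3 h4
    rw [hBeq] at hw
    have hWx := hpos t x h1 h2 h3 h4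
    have hst : s < t := by
      rcases h1.lt_or_eq with hh | hh
      · exact hh
      · exfalso
        rw [← hh] at hw h4
        have e1 := hbot x h3 h4
        have e2 := hexp1 (lam * (h s - x))
        have e3 := (hηe s x le_rfl hsT h3).trans (min_le_right _ _)
        have e4 : 0 ≤ h s - x := by linarith
        have e5 : η * (Real.exp (lam * (h s - x)) - 1) ≤ η * (lam * (h s - x) * Real.exp (lam * (h s - x))) :=
          mul_le_mul_of_nonneg_left e2 hηp.le
        have e6 : (lam * (h s - x)) * (η * Real.exp (lam * (h s - x))) ≤ (lam * (h s - x)) * (η0 / lam) :=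
          mul_le_mul_of_nonneg_left e3 (by positivity)
        have e7 : (lam * (h s - x)) * (η0 / lam) = η0 * (h s - x) := by field_simp
        nlinarith
    have hx1 : x1 < x := by
      rcases h3.lt_or_eq with hh | hh
      · exact hh
      · exfalso
        rw [← hh] at hw
        have := hside t h1 h2
        have := (hηe t x1 h1 h2 le_rfl).trans (min_le_left _ _)
        linarith
    have hxh : x < h t := by
      rcases h4.lt_or_eq with hh | hh
      · exact hh
      · exfalso
        rw [← hh, sub_self, mul_zero, Real.exp_zero] at hw
        linarith
    refine ⟨hst, ?_, ?_⟩
    · refine IsOpen.mem_nhds ((isOpen_lt continuous_const continuous_snd).inter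
        (isOpen_lt continuous_snd (hc.comp continuous_fst))) ⟨hx1, hxh⟩ |> fun hh => mem_of_superset hh ?_
      rintro q ⟨hq1, hq2⟩
      exact ⟨le_of_lt hq1, le_of_lt hq2⟩
    · obtain ⟨Wt, Wxx, hJ, hJ2⟩ := hsup t x hst h2 hx1 hxh
      have hT : HasDerivAt (fun r => Real.exp (lam * h r)) (Real.exp (lam * h t) * (lam * hd t)) t :=
        ((hder t hst h2).const_mul lam).exp
      have hX : ∀ y, HasDerivAt (fun y => Real.exp (-lam * y)) (-lam * Real.exp (-lam * y)) y := by
        intro y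
        have := ((hasDerivAt_id y).const_mul (-lam)).exp
        simpa [mul_comm] using this
      have hX2 : HasDerivAt (fun y => -lam * Real.exp (-lam * y)) (-lam * (-lam * Real.exp (-lam * x))) x :=
        (hX x).const_mul _
      have hB := (((Jet.prod hT hX hX2).cmul η).sub (Jet.const η t x)).sub hJ
      refine ⟨_, _, hB, ?_⟩
      have e1 := hBeq t x
      set E := η * Real.exp (lam * (h t - x))
      have hE : 0 < E := by positivity
      have e2 : η * (Real.exp (lam * h t) * (lam * hd t) * Real.exp (-lam * x)) = lam * hd t * E := by
        rw [← e1]; ring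
      have e3 : η * (Real.exp (lam * h t) * (-lam * (-lam * Real.exp (-lam * x)))) = lam ^ 2 * E := by
        rw [← e1]; ring
      rw [e2, e3]
      have e4 : lam * hd t * E ≤ lam * C * E := by
        have := hdC t hst h2
        have : lam * hd t ≤ lam * C := mul_le_mul_of_nonneg_left this hlam0.le
        exact mul_le_mul_of_nonneg_right this hE.le
      have e5 : (lam * C + K) * E ≤ d * lam ^ 2 * E := mul_le_mul_of_nonneg_right hdl2 hE.le
      nlinarith

lemma Pre.deriv_eq (P : Pre d μ ω f p u h) {t : ℝ} (ht : 0 < t) :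
    deriv h t = -μ * derivWithin (u t) (Set.Iic (h t)) (h t) := (P.stefan t ht).deriv

lemma Pre.slope (hμ : 0 < μ) (P : Pre d μ ω f p u h) {t : ℝ} (ht : 0 < t) (hp : 0 < deriv h t) :
    HasDerivWithinAt (u t) (-(deriv h t / μ)) (Iic (h t)) (h t) := by
  have e := P.deriv_eq ht
  have h1 : derivWithin (u t) (Set.Iic (h t)) (h t) ≠ 0 := by
    intro h0
    rw [h0, mul_zero] at e
    exact hp.ne' e
  have h2 : DifferentiableWithinAt ℝ (u t) (Set.Iic (h t)) (h t) := by
    by_contra hno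
    exact h1 (derivWithin_zero_of_not_differentiableWithinAt hno)
  have h3 := h2.hasDerivWithinAt
  have h4 : derivWithin (u t) (Set.Iic (h t)) (h t) = -(deriv h t / μ) := by
    rw [e]; field_simp
  rwa [h4] at h3

lemma Pre.pos_of_deriv (hμ : 0 < μ) (X : Ctx d ω L R K pm f p) (P : Pre d μ ω f p u h) {t : ℝ}
    (ht : 0 < t) (hp : 0 < deriv h t) {x : ℝ} (hx : x < h t) : 0 < u t x := by
  have h1 := P.slope hμ ht hp
  rw [hasDerivWithinAt_iff_tendsto_slope, Iic_sdiff_right] at h1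
  have hq : 0 < deriv h t / μ := by positivity
  have h2 : ∀ᶠ y in 𝓝[<] (h t), _root_.slope (u t) (h t) y < 0 :=
    h1.eventually (gt_mem_nhds (by linarith))
  obtain ⟨y, ⟨hy1, hy2⟩, hy3⟩ := ((h2.and self_mem_nhdsWithin).and
    (nhdsWithin_le_nhds (lt_mem_nhds hx))).exists
  have hy2 : y < h t := hy2
  rw [slope_def_field, P.uz t ht.le _ le_rfl, sub_zero, div_neg_iff] at hy1
  refine P.down X ht.le (b := y) ?_ (le_of_lt hy3)
  rcases hy1 with h3 | h3
  · exact h3.1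
  · linarith [h3.2]

lemma Pre.tstar (X : Ctx d ω L R K pm f p) (P : Pre d μ ω f p u h) : ∃ t > 0, 0 < deriv h t := by
  have hpm := X.hpm
  obtain ⟨N, hN⟩ := P.conv (h 0 + 1) (pm / 2) (by linarith)
  set n := N + 1
  have h1 := (abs_le.1 (hN n (by omega) (h 0 + 1) le_rfl)).1
  have h2 := X.pge 0 (h 0 + 1)
  have hn : 0 < (n : ℝ) * ω := by
    have := X.hω
    have : (0:ℝ) < n := by exact_mod_cast Nat.succ_pos N
    positivity
  have h3 : h 0 + 1 < h (n * ω) := P.lt_of_pos hn.le (by linarith)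
  obtain ⟨t, ht, he⟩ := exists_deriv_eq_slope h hn P.hcont.continuousOn (fun t ht =>
    (P.stefan t ht.1).differentiableAt.differentiableWithinAt)
  refine ⟨t, ht.1, ?_⟩
  rw [he]
  apply div_pos <;> linarith

lemma Pre.hpos (hμ : 0 < μ) (X : Ctx d ω L R K pm f p) (P : Pre d μ ω f p u h) :
    ∃ ts > 0, ∀ t, ts ≤ t → 0 < deriv h t := by
  obtain ⟨ts, hts, hts2⟩ := P.tstar X
  refine ⟨ts, hts, ?_⟩
  by_contra hcon
  push Not at hcon
  obtain ⟨t1, ht1, ht1'⟩ := hcon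
  have hcd : ContinuousOn (deriv h) (Icc ts t1) := P.hdc.mono fun t ht => lt_of_lt_of_le hts ht.1
  have hcl : IsCompact (Icc ts t1 ∩ deriv h ⁻¹' Iic 0) :=
    isCompact_Icc.of_isClosed_subset (hcd.preimage_isClosed_of_isClosed isClosed_Icc isClosed_Iic)
      inter_subset_left
  obtain ⟨b, hb, hbmin⟩ := hcl.exists_isMinOn ⟨t1, ⟨ht1, le_rfl⟩, ht1'⟩ continuousOn_id
  have hb2 : deriv h b ≤ 0 := hb.2
  have hltb : ∀ t, ts ≤ t → t < b → 0 < deriv h t := by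
    intro t h1 h2
    by_contra h3
    push Not at h3
    have : b ≤ t := hbmin ⟨⟨h1, h2.le.trans hb.1.2⟩, h3⟩
    linarith
  have htsb : ts < b := by
    rcases hb.1.1.lt_or_eq with h1 | h1
    · exact h1
    · rw [← h1] at hb2; linarith
  have hb0 : 0 < b := hts.trans htsb
  obtain ⟨x1, hx1, hux1⟩ := P.unb X hb0.le (h b)
  have huc : ∀ x, Continuous fun t => u t x := fun x => P.ucont.comp (Continuous.prodMk_left x)
  obtain ⟨ε, hε, hball⟩ := Metric.eventually_nhds_iff.1
    (((huc x1).continuousAt.eventually (lt_mem_nhds hux1)).and (lt_mem_nhds htsb))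
  set s := b - ε / 2 with hs
  have hsb : s < b := by linarith
  have hev : ∀ t, s ≤ t → t ≤ b → 0 < u t x1 ∧ ts < t := by
    intro t h6 h7
    apply hball
    rw [Real.dist_eq, abs_lt]
    constructor <;> linarith
  have hs0 : 0 < s := hts.trans (hev s le_rfl hsb.le).2
  have hx1h : ∀ t, s ≤ t → t ≤ b → x1 < h t := fun t h1 h2 =>
    P.lt_of_pos (hs0.le.trans h1) (hev t h1 h2).1
  obtain ⟨tk, htk, hkmin⟩ := (isCompact_Icc (a := s) (b := b)).exists_isMinOn ⟨s, le_rfl, hsb.le⟩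
    (huc x1).continuousOn
  obtain ⟨tC, htC, hCmax⟩ := (isCompact_Icc (a := s) (b := b)).exists_isMaxOn ⟨s, le_rfl, hsb.le⟩
    (P.hdc.mono (fun t ht => lt_of_lt_of_le hs0 ht.1))
  have hposlt : ∀ t x, s ≤ t → t < b → x < h t → 0 < u t x := fun t x h1 h2 h3 =>
    P.pos_of_deriv hμ X (hs0.trans_le h1) (hltb t (hev t h1 h2.le).2.le h2) h3
  have hnn : ∀ t x, s ≤ t → t ≤ b → 0 ≤ u t x := by
    intro t x h1 h2
    have hlt : ∀ t, s ≤ t → t < b → 0 ≤ u t x := by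
      intro t h1 h2
      rcases lt_or_ge x (h t) with h3 | h3
      · exact (hposlt t x h1 h2 h3).le
      · exact (P.uz t (hs0.le.trans h1) x h3).ge
    rcases h2.lt_or_eq with h3 | h3
    · exact hlt t h1 h3
    · rw [h3]
      refine ge_of_tendsto ((huc x).continuousWithinAt (s := Iio b) (x := b)) ?_
      filter_upwards [self_mem_nhdsWithin, nhdsWithin_le_nhds (lt_mem_nhds hsb)] with r h6 h7
      exact hlt r (le_of_lt h7) h6
  have hds := hltb s (hev s le_rfl hsb.le).2.le hsb
  obtain ⟨η0, hη0, hsl⟩ := slope_lower (hx1h s le_rfl hsb.le)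
    (P.ucont.comp (Continuous.prodMk_right s)) (fun x _ h2 => hposlt s x le_rfl hsb h2)
    (P.uz s hs0.le _ le_rfl) (div_pos hds hμ) (P.slope hμ hs0 hds)
  obtain ⟨η, hη, hlow⟩ := hopf (d := d) (K := K) (s := s) (T := b) (x1 := x1) (W := u) (h := h)
    (hd := deriv h) X.hd X.hK.le hs0.le hsb.le P.hcont P.ucont
    (fun t h1 _ => (P.stefan t (hs0.trans h1)).differentiableAt.hasDerivAt)
    (fun t h1 h2 => hCmax ⟨h1.le, h2⟩) (fun t x h1 h2 _ _ => hnn t x h1 h2)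
    (hev tk htk.1 htk.2).1 (fun t h1 h2 => hkmin ⟨h1, h2⟩) hη0 hsl (by
      intro t x h1 h2 h3 h4
      obtain ⟨uxx, hJ⟩ := P.jet (hs0.trans h1) h4
      refine ⟨_, _, hJ, ?_⟩
      have hf := (abs_le.1 (X.fle (t := t) (x := x) (hnn t x h1.le h2)
        ((P.up t (hs0.trans h1).le x).trans (X.ple t x)))).1
      linarith)
  have hge : ∀ t, s ≤ t → t < b → μ * η ≤ deriv h t := by
    intro t h1 h2
    have hsl := P.slope hμ (hs0.trans_le h1) (hltb t (hev t h1 h2.le).2.le h2)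
    have := slope_upper (hx1h t h1 h2.le) (fun x h3 h4 => hlow t x h1 h2.le h3 h4)
      (P.uz t (hs0.le.trans h1) _ le_rfl) hsl
    have h5 : η ≤ deriv h t / μ := by linarith
    rw [le_div_iff₀ hμ] at h5
    linarith
  have hcb : ContinuousWithinAt (deriv h) (Iio b) b :=
    (P.hdc.continuousAt (Ioi_mem_nhds hb0)).continuousWithinAt
  have : μ * η ≤ deriv h b := by
    refine ge_of_tendsto hcb ?_
    filter_upwards [self_mem_nhdsWithin, nhdsWithin_le_nhds (lt_mem_nhds hsb)] with r h6 h7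
    exact hge r (le_of_lt h7) h6
  have : 0 < μ * η := by positivity
  linarith

end

section

variable {d μ ω L R K pm : ℝ} {f : ℝ → ℝ → ℝ → ℝ} {p u : ℝ → ℝ → ℝ} {h : ℝ → ℝ}

lemma Pre.gap_mp (X : Ctx d ω L R K pm f p) (P : Pre d μ ω f p u h) {T : ℝ} (G : Set (ℝ × ℝ))
    (hG : IsClosed G) (b : ℝ → ℝ → ℝ) (hb : Continuous (fun q : ℝ × ℝ => b q.1 q.2))
    (hbpm : ∀ t x, (t, x) ∈ G → 0 ≤ t → t ≤ T → b t x ≤ pm)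
    (hbd : ∀ t x, (t, x) ∈ G → 0 ≤ t → t ≤ T → p t x - u t x < b t x → 0 < t ∧ G ∈ 𝓝 (t, x))
    (hJ : ∀ t x, ∃ bt bxx, Jet b t x bt bxx ∧ bt ≤ d * bxx - K * b t x) :
    ∀ t x, (t, x) ∈ G → 0 ≤ t → t ≤ T → b t x ≤ p t x - u t x := by
  intro t x h1 h2 h3
  have key := mp (d := d) (K := 0) (s := 0) (T := T) (B := pm) X.hd.le le_rfl G hG
    (fun t x => b t x - (p t x - u t x))
    (Continuous.continuousOn (by have := P.ucont; have := X.pc; fun_prop)) ?_ ?_ t x h1 h2 h3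
  · linarith
  · intro t x h1 h2 h3
    have := hbpm t x h1 h2 h3
    have := P.up t h2 x
    linarith
  · intro t x h1 h2 h3 hw
    obtain ⟨ht, hn⟩ := hbd t x h1 h2 h3 (by linarith)
    refine ⟨ht, hn, ?_⟩
    have e1 := hbpm t x h1 h2 h3
    have e2 := X.pge t x
    have hu : 0 < u t x := by linarith
    obtain ⟨uxx, hJu⟩ := P.jet ht (P.lt_of_pos h2 hu)
    obtain ⟨pxx, hJp⟩ := jet_of_solves X.psol (t := t) (x := x) (by simp)
    obtain ⟨bt, bxx, hJb, hle⟩ := hJ t x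
    refine ⟨_, _, hJb.sub (hJp.sub hJu), ?_⟩
    have hf := (abs_le.1 (X.flip (t := t) (x := x) hu.le (P.up t h2 x) (X.ple t x))).1
    nlinarith [X.hK]

lemma Pre.gapT (X : Ctx d ω L R K pm f p) (P : Pre d μ ω f p u h) {T : ℝ} (hT : 0 < T) :
    ∃ θ > 0, ∀ x, θ ≤ p T x - u T x := by
  obtain ⟨ε, hε, x0, hgap⟩ := P.gap
  have hd := X.hd
  have hK := X.hK
  have hpm := X.hpm
  set ε1 := min ε pm with hε1
  have hε1p : 0 < ε1 := lt_min hε hpm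
  have hJ1 : ∀ t x, ∃ bt bxx, Jet (fun t x => ε1 * Real.exp (0 + (-K) * t + 0 * x) -
      ε1 * Real.exp (-x0 + (d - K) * t + 1 * x)) t x bt bxx ∧ bt ≤ d * bxx - K *
      (ε1 * Real.exp (0 + (-K) * t + 0 * x) - ε1 * Real.exp (-x0 + (d - K) * t + 1 * x)) := by
    intro t x
    refine ⟨_, _, ((Jet.exp _ _ _ t x).cmul ε1).sub ((Jet.exp _ _ _ t x).cmul ε1), ?_⟩
    apply le_of_eq
    ring
  have hle1 : ∀ t x : ℝ, 0 ≤ t → ε1 * Real.exp (0 + (-K) * t + 0 * x) ≤ ε1 := by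
    intro t x ht
    have : Real.exp (0 + (-K) * t + 0 * x) ≤ 1 := by
      rw [Real.exp_le_one_iff]
      nlinarith
    nlinarith
  have hepos : ∀ z, 0 < ε1 * Real.exp z := fun z => by positivity
  have g1 := P.gap_mp X (T := T) univ isClosed_univ _ (by fun_prop) (by
      intro t x _ h1 h2
      have := hle1 t x h1
      have := hepos (-x0 + (d - K) * t + 1 * x)
      have : ε1 ≤ pm := min_le_right _ _
      linarith) (by
      intro t x _ h1 h2 h3
      refine ⟨?_, univ_mem⟩
      rcases h1.lt_or_eq with h4 | h4
      · exact h4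
      · exfalso
        rw [← h4] at h3
        rcases le_or_gt x x0 with h5 | h5
        · have := hgap x h5
          have := hle1 0 x le_rfl
          have := hepos (-x0 + (d - K) * 0 + 1 * x)
          have : ε1 ≤ ε := min_le_left _ _
          linarith
        · have := P.up 0 le_rfl x
          have := hle1 0 x le_rfl
          have : 1 ≤ Real.exp (-x0 + (d - K) * 0 + 1 * x) := Real.one_le_exp (by linarith)
          nlinarith) hJ1
  set x1 := x0 - d * T - 1 with hx1
  set ε2 := ε1 * Real.exp (-K * T) * (1 - Real.exp (-1)) with hε2
  have he1 : Real.exp (-1) < 1 := by rw [Real.exp_lt_one_iff]; norm_num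
  have hε2p : 0 < ε2 := by
    have : 0 < 1 - Real.exp (-1) := by linarith
    positivity
  have hgx1 : ∀ t x, 0 ≤ t → t ≤ T → x ≤ x1 → ε2 ≤ p t x - u t x := by
    intro t x h1 h2 h3
    refine le_trans ?_ (g1 t x (mem_univ _) h1 h2)
    have e1 : Real.exp (-x0 + (d - K) * t + 1 * x) = Real.exp (-K * t) * Real.exp (-x0 + d * t + x) := by
      rw [← Real.exp_add]; ring_nf
    have e2 : Real.exp (0 + (-K) * t + 0 * x) = Real.exp (-K * t) := by ring_nf
    rw [e1, e2]
    have e3 : Real.exp (-x0 + d * t + x) ≤ Real.exp (-1) := by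
      apply Real.exp_le_exp.2
      nlinarith
    have e4 : Real.exp (-K * T) ≤ Real.exp (-K * t) := by
      apply Real.exp_le_exp.2
      nlinarith
    have e5 : Real.exp (-K * T) * (1 - Real.exp (-1)) ≤ Real.exp (-K * t) * (1 - Real.exp (-x0 + d * t + x)) := by
      apply mul_le_mul e4 (by linarith) (by linarith) (Real.exp_pos _).le
    nlinarith
  have hε2pm : ε2 ≤ pm := by
    have e1 : Real.exp (-K * T) ≤ 1 := by rw [Real.exp_le_one_iff]; nlinarith
    have e2 : 1 - Real.exp (-1) ≤ 1 := by linarith [Real.exp_pos (-1)]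
    have e3 : Real.exp (-K * T) * (1 - Real.exp (-1)) ≤ 1 :=
      mul_le_one₀ e1 (by linarith) e2
    have e4 : ε1 ≤ pm := min_le_right _ _
    have e5 : ε2 = ε1 * (Real.exp (-K * T) * (1 - Real.exp (-1))) := by rw [hε2]; ring
    nlinarith
  -- second barrier
  set H := max (h T - x1) 0 with hH
  set lam := (H + 1) / (d * T) with hlam
  have hdT : 0 < d * T := by positivity
  have hlamp : 0 < lam := by
    have : 0 ≤ H := le_max_right _ _
    positivity
  have hlamT : lam * (d * T) = H + 1 := by rw [hlam]; field_simp
  set ε3 := ε2 * Real.exp (-(d * lam ^ 2 * T)) with hε3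
  have hε3p : 0 < ε3 := by positivity
  have hJ2 : ∀ t x, ∃ bt bxx, Jet (fun t x => ε3 * Real.exp (lam * x1 + (d * lam ^ 2 - K) * t + (-lam) * x) -
      ε3 * Real.exp (0 + (-K) * t + 0 * x)) t x bt bxx ∧ bt ≤ d * bxx - K *
      (ε3 * Real.exp (lam * x1 + (d * lam ^ 2 - K) * t + (-lam) * x) - ε3 * Real.exp (0 + (-K) * t + 0 * x)) := by
    intro t x
    refine ⟨_, _, ((Jet.exp _ _ _ t x).cmul ε3).sub ((Jet.exp _ _ _ t x).cmul ε3), ?_⟩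
    apply le_of_eq
    ring
  have hle2 : ∀ t x : ℝ, 0 ≤ t → t ≤ T → x1 ≤ x →
      ε3 * Real.exp (lam * x1 + (d * lam ^ 2 - K) * t + (-lam) * x) ≤ ε2 := by
    intro t x h1 h2 h3
    rw [hε3, mul_assoc, ← Real.exp_add]
    have : Real.exp (-(d * lam ^ 2 * T) + (lam * x1 + (d * lam ^ 2 - K) * t + (-lam) * x)) ≤ 1 := by
      rw [Real.exp_le_one_iff]
      have : d * lam ^ 2 * t ≤ d * lam ^ 2 * T := mul_le_mul_of_nonneg_left h2 (by positivity)
      nlinarith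
    nlinarith
  have hepos3 : ∀ z, 0 < ε3 * Real.exp z := fun z => by positivity
  have g2 := P.gap_mp X (T := T) {q : ℝ × ℝ | x1 ≤ q.2}
    (isClosed_le continuous_const continuous_snd) _ (by fun_prop) (by
      intro t x hx h1 h2
      have := hle2 t x h1 h2 hx
      have := hepos3 (0 + (-K) * t + 0 * x)
      linarith) (by
      intro t x hx h1 h2 h3
      have hx : x1 ≤ x := hx
      have hb := hepos3 (0 + (-K) * t + 0 * x)
      have hb2 := hle2 t x h1 h2 hx
      constructor
      · rcases h1.lt_or_eq with h4 | h4
        · exact h4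
        · exfalso
          rw [← h4] at h3
          have := P.up 0 le_rfl x
          have : Real.exp (lam * x1 + (d * lam ^ 2 - K) * 0 + (-lam) * x) ≤ Real.exp (0 + (-K) * 0 + 0 * x) := by
            apply Real.exp_le_exp.2
            nlinarith
          nlinarith
      · have hx' : x1 < x := by
          rcases hx.lt_or_eq with h4 | h4
          · exact h4
          · exfalso
            have := hgx1 t x h1 h2 h4.ge
            linarith
        refine mem_of_superset ((isOpen_lt continuous_const continuous_snd).mem_nhds hx') ?_
        intro q hq
        have hq : x1 < q.2 := hq
        exact hq.le) hJ2
  set θ2 := ε3 * Real.exp (lam * x1 + (d * lam ^ 2 - K) * T + (-lam) * (x1 + H)) -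
    ε3 * Real.exp (0 + (-K) * T + 0 * (x1 + H)) with hθ2
  have hθ2p : 0 < θ2 := by
    have : Real.exp (0 + (-K) * T + 0 * (x1 + H)) < Real.exp (lam * x1 + (d * lam ^ 2 - K) * T + (-lam) * (x1 + H)) := by
      apply Real.exp_lt_exp.2
      have : d * lam ^ 2 * T = lam * (H + 1) := by rw [← hlamT]; ring
      nlinarith
    rw [hθ2]
    have := mul_lt_mul_of_pos_left this hε3p
    linarith
  refine ⟨min ε2 (min θ2 pm), lt_min hε2p (lt_min hθ2p hpm), fun x => ?_⟩
  rcases le_or_gt x x1 with h1 | h1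
  · exact (min_le_left _ _).trans (hgx1 T x hT.le le_rfl h1)
  · rcases le_or_gt x (x1 + H) with h2 | h2
    · refine (min_le_right _ _).trans ((min_le_left _ _).trans ?_)
      refine le_trans ?_ (g2 T x h1.le hT.le le_rfl)
      have : Real.exp (lam * x1 + (d * lam ^ 2 - K) * T + (-lam) * (x1 + H)) ≤
          Real.exp (lam * x1 + (d * lam ^ 2 - K) * T + (-lam) * x) := by
        apply Real.exp_le_exp.2
        nlinarith
      have e : Real.exp (0 + (-K) * T + 0 * (x1 + H)) = Real.exp (0 + (-K) * T + 0 * x) := by ring_nf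
      rw [hθ2, e]
      nlinarith
    · refine (min_le_right _ _).trans ((min_le_right _ _).trans ?_)
      have : h T - x1 ≤ H := le_max_left _ _
      rw [P.uz T hT.le x (by linarith), sub_zero]
      exact X.pge T x

/-- a genuine positive solution of the free boundary problem on `t ≥ 0` -/
structure Core (d μ : ℝ) (f : ℝ → ℝ → ℝ → ℝ) (p u : ℝ → ℝ → ℝ) (h : ℝ → ℝ) : Prop where
  hcont : Continuous h
  ucont : Continuous (fun q : ℝ × ℝ => u q.1 q.2)
  uz : ∀ t, 0 ≤ t → ∀ x, h t ≤ x → u t x = 0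
  pos : ∀ t, 0 ≤ t → ∀ x, x < h t → 0 < u t x
  pde : SolvesPDE d f u {q : ℝ × ℝ | 0 < q.1 ∧ q.2 < h q.1}
  up : ∀ t, 0 ≤ t → ∀ x, u t x ≤ p t x
  stefan : ∃ hd : ℝ → ℝ, (∀ T, ∃ C, ∀ t, 0 ≤ t → t ≤ T → hd t ≤ C) ∧
    ∀ t, 0 ≤ t → HasDerivAt h (hd t) t ∧ 0 < hd t ∧
      HasDerivWithinAt (u t) (-(hd t / μ)) (Iic (h t)) (h t)

structure Full (d μ ω : ℝ) (f : ℝ → ℝ → ℝ → ℝ) (p u : ℝ → ℝ → ℝ) (h : ℝ → ℝ) : Prop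
    extends Core d μ f p u h where
  gap : ∃ θ > 0, ∀ x, θ ≤ p 0 x - u 0 x
  conv : ∀ C : ℝ, ∀ ε > 0, ∃ N : ℕ, ∀ n : ℕ, N ≤ n → ∀ x ≤ C, |u ((n : ℝ) * ω) x - p 0 x| ≤ ε

lemma Ctx.fn (X : Ctx d ω L R K pm f p) (n : ℕ) {t x a : ℝ} (ha : 0 ≤ a) :
    f (t + n * ω) x a = f t x a :=
  per_nat (g := fun t => f t x a) (fun t => X.fper_t t x a ha) n t

lemma Ctx.pn (X : Ctx d ω L R K pm f p) (n : ℕ) (t x : ℝ) : p (t + n * ω) x = p t x :=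
  per_nat (g := fun t => p t x) (fun t => X.pper_t t x) n t

lemma solves_shift (X : Ctx d ω L R K pm f p) (n : ℕ) {S S' : Set (ℝ × ℝ)}
    (hS : ∀ q ∈ S', (q.1 + n * ω, q.2) ∈ S) (hpos : ∀ q ∈ S', 0 ≤ u (q.1 + n * ω) q.2)
    (hu : SolvesPDE d f u S) : SolvesPDE d f (fun t x => u (t + n * ω) x) S' := by
  rintro ⟨t, x⟩ hq
  obtain ⟨a, b, c⟩ := hu _ (hS _ hq)
  dsimp only at a b c ⊢
  refine ⟨a, b, ?_⟩
  have h0 := hpos _ hq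
  dsimp only at h0
  rw [X.fn n h0] at c
  have := HasDerivAt.comp_add_const t (n * ω) c
  exact this

lemma Pre.full (hμ : 0 < μ) (X : Ctx d ω L R K pm f p) (P : Pre d μ ω f p u h) :
    ∃ n : ℕ, Full d μ ω f p (fun t x => u (t + n * ω) x) (fun t => h (t + n * ω)) := by
  obtain ⟨ts, hts, hpos⟩ := P.hpos hμ X
  obtain ⟨n, hn⟩ := exists_nat_mul_ge X.hω ts
  have hn := hn n le_rfl
  have hn0 : 0 < n * ω := by linarith
  have hup : ∀ t, 0 ≤ t → ∀ x, x < h (t + n * ω) → 0 < u (t + n * ω) x := fun t ht x hx =>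
    P.pos_of_deriv hμ X (by linarith) (hpos _ (by linarith)) hx
  refine ⟨n, ⟨?_, ?_, ?_, hup, ?_, ?_, ?_⟩, ?_, ?_⟩
  · exact P.hcont.comp (by fun_prop)
  · exact P.ucont.comp (g := fun q : ℝ × ℝ => u q.1 q.2) (f := fun q : ℝ × ℝ => (q.1 + n * ω, q.2))
      (by fun_prop)
  · intro t ht x hx
    exact P.uz _ (by linarith) x hx
  · refine solves_shift X n ?_ ?_ P.pde
    · rintro q ⟨h1, h2⟩
      exact ⟨by dsimp only; linarith, h2⟩
    · rintro q ⟨h1, h2⟩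
      exact (hup _ (le_of_lt h1) _ h2).le
  · intro t ht x
    rw [← X.pn n t x]
    exact P.up _ (by linarith) x
  · refine ⟨fun t => deriv h (t + n * ω), ?_, ?_⟩
    · intro T
      obtain ⟨tC, htC, hCmax⟩ := (isCompact_Icc (a := n * ω) (b := max T 0 + n * ω)).exists_isMaxOn
        ⟨n * ω, le_rfl, by have := le_max_right T 0; linarith⟩
        (P.hdc.mono (fun t ht => lt_of_lt_of_le hn0 ht.1))
      refine ⟨deriv h tC, fun t h1 h2 => hCmax ⟨by linarith, ?_⟩⟩
      have := le_max_left T 0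
      linarith
    · intro t ht
      have ht0 : 0 < t + n * ω := by linarith
      refine ⟨?_, hpos _ (by linarith), P.slope hμ ht0 (hpos _ (by linarith))⟩
      exact HasDerivAt.comp_add_const t (n * ω) (P.stefan _ ht0).differentiableAt.hasDerivAt
  · obtain ⟨θ, hθ, hg⟩ := P.gapT X hn0
    refine ⟨θ, hθ, fun x => ?_⟩
    have := X.pn n 0 x
    rw [zero_add] at this
    rw [← this, zero_add]
    exact hg x
  · intro C ε hε
    obtain ⟨N, hN⟩ := P.conv C ε hε
    refine ⟨N, fun m hm x hx => ?_⟩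
    have := hN (m + n) (by omega) x hx
    push_cast at this
    rwa [add_mul] at this

end

section

variable {d μ ω L R K pm : ℝ} {f : ℝ → ℝ → ℝ → ℝ} {p u v : ℝ → ℝ → ℝ} {h g : ℝ → ℝ}

lemma Core.jet (P : Core d μ f p u h) {t x : ℝ} (ht : 0 < t) (hx : x < h t) :
    ∃ uxx, Jet u t x (d * uxx + f t x (u t x)) uxx :=
  jet_of_solves P.pde (by filter_upwards [gt_mem_nhds hx] with y hy using ⟨ht, hy⟩)

lemma Core.nonneg (P : Core d μ f p u h) {t : ℝ} (ht : 0 ≤ t) (x : ℝ) : 0 ≤ u t x := by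
  rcases lt_or_ge x (h t) with h1 | h1
  · exact (P.pos t ht x h1).le
  · exact (P.uz t ht x h1).ge

lemma Core.leR (X : Ctx d ω L R K pm f p) (P : Core d μ f p u h) {t : ℝ} (ht : 0 ≤ t) (x : ℝ) :
    u t x ≤ R := (P.up t ht x).trans (X.ple t x)

lemma Core.lt_of_pos (P : Core d μ f p u h) {t x : ℝ} (ht : 0 ≤ t) (hu : 0 < u t x) : x < h t := by
  by_contra hx
  push Not at hx
  rw [P.uz t ht x hx] at hu
  exact lt_irrefl _ hu

lemma Core.mono (P : Core d μ f p u h) {s t : ℝ} (hs : 0 ≤ s) (hst : s ≤ t) : h s ≤ h t := by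
  obtain ⟨hd, -, H⟩ := P.stefan
  have : MonotoneOn h (Ici 0) := by
    apply monotoneOn_of_deriv_nonneg (convex_Ici 0) P.hcont.continuousOn
    · rw [interior_Ici]
      intro t ht
      exact (H t (le_of_lt ht)).1.differentiableAt.differentiableWithinAt
    · rw [interior_Ici]
      intro t ht
      rw [(H t (le_of_lt ht)).1.deriv]
      exact (H t (le_of_lt ht)).2.1.le
  exact this hs (hs.trans hst) hst

lemma Core.shift (X : Ctx d ω L R K pm f p) (P : Core d μ f p u h) (n : ℕ) :
    Core d μ f p (fun t x => u (t + n * ω) x) (fun t => h (t + n * ω)) := by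
  have hω := X.hω
  have hn0 : 0 ≤ n * ω := by positivity
  have hup : ∀ t, 0 ≤ t → ∀ x, x < h (t + n * ω) → 0 < u (t + n * ω) x := fun t ht x hx =>
    P.pos _ (by linarith) x hx
  refine ⟨?_, ?_, ?_, hup, ?_, ?_, ?_⟩
  · exact P.hcont.comp (by fun_prop)
  · exact P.ucont.comp (g := fun q : ℝ × ℝ => u q.1 q.2) (f := fun q : ℝ × ℝ => (q.1 + n * ω, q.2))
      (by fun_prop)
  · intro t ht x hx
    exact P.uz _ (by linarith) x hx
  · refine solves_shift X n ?_ ?_ P.pde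
    · rintro q ⟨h1, h2⟩
      exact ⟨by dsimp only; linarith, h2⟩
    · rintro q ⟨h1, h2⟩
      exact (hup _ (le_of_lt h1) _ h2).le
  · intro t ht x
    rw [← X.pn n t x]
    exact P.up _ (by linarith) x
  · obtain ⟨hd, hb, H⟩ := P.stefan
    refine ⟨fun t => hd (t + n * ω), ?_, ?_⟩
    · intro T
      obtain ⟨C, hC⟩ := hb (T + n * ω)
      exact ⟨C, fun t h1 h2 => hC _ (by linarith) (by linarith)⟩
    · intro t ht
      obtain ⟨a, b, c⟩ := H (t + n * ω) (by linarith)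
      exact ⟨HasDerivAt.comp_add_const t (n * ω) a, b, c⟩

lemma Ctx.fx (X : Ctx d ω L R K pm f p) (j : ℤ) {t x a : ℝ} (ha : 0 ≤ a) :
    f t (x - j * L) a = f t x a := by
  have : Function.Periodic (fun x => f t x a) L := fun x => X.fper_x t x a ha
  have := this.sub_zsmul_eq j (x := x)
  simpa using this

lemma Ctx.px (X : Ctx d ω L R K pm f p) (j : ℤ) (t x : ℝ) : p t (x - j * L) = p t x := by
  have : Function.Periodic (fun x => p t x) L := fun x => X.pper_x t x
  have := this.sub_zsmul_eq j (x := x)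
  simpa using this

lemma Core.xshift (X : Ctx d ω L R K pm f p) (P : Core d μ f p u h) (j : ℤ) :
    Core d μ f p (fun t x => u t (x - j * L)) (fun t => h t + j * L) := by
  have hup : ∀ t, 0 ≤ t → ∀ x, x < h t + j * L → 0 < u t (x - j * L) := fun t ht x hx =>
    P.pos _ ht _ (by linarith)
  refine ⟨?_, ?_, ?_, hup, ?_, ?_, ?_⟩
  · exact P.hcont.add continuous_const
  · exact P.ucont.comp (g := fun q : ℝ × ℝ => u q.1 q.2) (f := fun q : ℝ × ℝ => (q.1, q.2 - j * L))
      (by fun_prop)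
  · intro t ht x hx
    exact P.uz _ ht _ (by linarith)
  · rintro ⟨t, x⟩ ⟨h1, h2⟩
    dsimp only at h1 h2
    obtain ⟨a, b, c⟩ := P.pde (t, x - j * L) ⟨h1, by dsimp only; linarith⟩
    dsimp only at a b c ⊢
    rw [X.fx j (hup t h1.le x h2).le] at c
    have e1 : deriv (fun y => u t (y - j * L)) = fun y => deriv (u t) (y - j * L) := by
      funext y
      exact deriv_comp_sub_const (f := u t) (j * L) y
    have e2 : deriv (fun y => deriv (u t) (y - j * L)) x = deriv (deriv (u t)) (x - j * L) :=
      deriv_comp_sub_const (f := deriv (u t)) (j * L) x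
    refine ⟨?_, ?_, ?_⟩
    · exact a.comp x (by fun_prop)
    · rw [e1]
      exact DifferentiableAt.comp (g := deriv (u t)) (f := fun y => y - j * L) x b (by fun_prop)
    · rw [e1, e2]
      exact c
  · intro t ht x
    rw [← X.px j t x]
    exact P.up _ ht _
  · obtain ⟨hd, hb, H⟩ := P.stefan
    refine ⟨hd, hb, ?_⟩
    intro t ht
    obtain ⟨a, b, c⟩ := H t ht
    refine ⟨a.add_const _, b, ?_⟩
    have hid : HasDerivWithinAt (fun x : ℝ => x - j * L) 1 (Iic (h t + j * L)) (h t + j * L) :=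
      ((hasDerivAt_id _).sub_const _).hasDerivWithinAt
    have c' : HasDerivWithinAt (u t) (-(hd t / μ)) (Iic (h t)) (h t + j * L - j * L) := by
      rwa [add_sub_cancel_right]
    have := HasDerivWithinAt.comp (h t + j * L) c' hid (fun x hx => by
      have : x ≤ h t + j * L := hx
      show x - j * L ≤ h t
      linarith)
    rw [mul_one] at this
    exact this

/-- upper barriers -/
lemma Core.upper (X : Ctx d ω L R K pm f p) (P : Core d μ f p u h) {T : ℝ} (Q : ℝ → ℝ → ℝ)
    (hQ : Continuous (fun q : ℝ × ℝ => Q q.1 q.2)) (hQ0 : ∀ t x, 0 ≤ t → 0 ≤ Q t x)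
    (hJ : ∀ t x, 0 < t → t ≤ T → ∃ Qt Qxx, Jet Q t x Qt Qxx ∧ d * Qxx + K * Q t x ≤ Qt)
    (h0 : ∀ x, u 0 x ≤ Q 0 x) : ∀ t x, 0 ≤ t → t ≤ T → u t x ≤ Q t x := by
  intro t x h1 h2
  have key := mp (d := d) (K := K) (s := 0) (T := T) (B := R) X.hd.le le_rfl univ isClosed_univ
    (fun t x => u t x - Q t x) (Continuous.continuousOn (by have := P.ucont; fun_prop)) ?_ ?_ t x
    (mem_univ _) h1 h2
  · linarith
  · intro t x _ h1 _
    have := P.leR X h1 x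
    have := hQ0 t x h1
    linarith
  · intro t x _ h1 h2 hw
    have hq := hQ0 t x h1
    have ht : 0 < t := by
      rcases h1.lt_or_eq with h3 | h3
      · exact h3
      · rw [← h3] at hw
        linarith [h0 x]
    refine ⟨ht, univ_mem, ?_⟩
    have hu : 0 < u t x := by linarith
    obtain ⟨uxx, hJu⟩ := P.jet ht (P.lt_of_pos h1 hu)
    obtain ⟨Qt, Qxx, hJQ, hle⟩ := hJ t x ht h2
    refine ⟨_, _, hJu.sub hJQ, ?_⟩
    have hf := (abs_le.1 (X.fle (t := t) (x := x) hu.le (P.leR X h1 x))).2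
    linarith

/-- lower barriers -/
lemma Core.lower (X : Ctx d ω L R K pm f p) (P : Core d μ f p u h) {T y ε : ℝ} (q : ℝ → ℝ → ℝ)
    (hq : Continuous (fun z : ℝ × ℝ => q z.1 z.2)) (hqR : ∀ t x, 0 ≤ t → q t x ≤ R)
    (hJ : ∀ t x, 0 < t → t ≤ T → ∃ qt qxx, Jet q t x qt qxx ∧
      ∀ r, 0 ≤ r → r ≤ q t x → qt ≤ d * qxx + f t x r + K * (q t x - r))
    (hy : y ≤ h 0) (hε : 0 ≤ ε)
    (h0 : ∀ x ≤ y, q 0 x - ε ≤ u 0 x) : ∀ t x, 0 ≤ t → t ≤ T →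
      q t x - (ε + R * Real.exp (x - y + d * t)) * Real.exp (K * t) ≤ u t x := by
  intro t x h1 h2
  have hR := X.hR
  have hK := X.hK
  have hd := X.hd
  have hE1 : ∀ t, 0 ≤ t → 1 ≤ Real.exp (K * t) := fun t ht => Real.one_le_exp (by positivity)
  have hbig : ∀ t x, 0 ≤ t → y ≤ x → q t x - (ε + R * Real.exp (x - y + d * t)) * Real.exp (K * t) ≤ u t x := by
    intro t x h1 h2
    have e1 := hqR t x h1
    have e2 := P.nonneg h1 x
    have e3 : 1 ≤ Real.exp (x - y + d * t) := Real.one_le_exp (by nlinarith)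
    have e4 := hE1 t h1
    have e5 : R ≤ ε + R * Real.exp (x - y + d * t) := by nlinarith
    nlinarith
  rcases le_or_gt y x with hyx | hyx
  · exact hbig t x h1 hyx
  have eB : ∀ t x, (ε + R * Real.exp (x - y + d * t)) * Real.exp (K * t) =
      ε * Real.exp (0 + K * t + 0 * x) + R * Real.exp (-y + (d + K) * t + 1 * x) := by
    intro t x
    rw [add_mul, mul_assoc R, ← Real.exp_add]
    ring_nf
  have key := mp (d := d) (K := K) (s := 0) (T := T) (B := R) X.hd.le le_rfl {z : ℝ × ℝ | z.2 ≤ y}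
    (isClosed_le continuous_snd continuous_const)
    (fun t x => q t x - u t x - (ε * Real.exp (0 + K * t + 0 * x) + R * Real.exp (-y + (d + K) * t + 1 * x)))
    (Continuous.continuousOn (by have := P.ucont; fun_prop)) ?_ ?_ t x hyx.le h1 h2
  · rw [eB]
    linarith
  · intro t x _ h1 _
    have := P.nonneg h1 x
    have := hqR t x h1
    have : 0 ≤ ε * Real.exp (0 + K * t + 0 * x) + R * Real.exp (-y + (d + K) * t + 1 * x) := by positivity
    linarith
  · intro t x hx h1 h2 hw
    have hx : x ≤ y := hx
    have hEp : 0 ≤ ε * Real.exp (0 + K * t + 0 * x) + R * Real.exp (-y + (d + K) * t + 1 * x) := by positivity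
    have hxy : x < y := by
      rcases hx.lt_or_eq with h3 | h3
      · exact h3
      · have := hbig t x h1 h3.ge
        rw [eB] at this
        linarith
    have ht : 0 < t := by
      rcases h1.lt_or_eq with h3 | h3
      · exact h3
      · exfalso
        rw [← h3] at hw
        have e1 := h0 x hx
        have e2 : Real.exp (0 + K * 0 + 0 * x) = 1 := by simp
        have e3 : 0 < R * Real.exp (-y + (d + K) * 0 + 1 * x) := by positivity
        rw [e2] at hw
        linarith
    refine ⟨ht, ?_, ?_⟩
    · refine mem_of_superset ((isOpen_lt continuous_snd continuous_const).mem_nhds hxy) ?_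
      intro q hq
      have hq : q.2 < y := hq
      exact hq.le
    · have hxh : x < h t := hxy.trans_le (hy.trans (P.mono le_rfl h1))
      obtain ⟨uxx, hJu⟩ := P.jet ht hxh
      obtain ⟨qt, qxx, hJq, hle⟩ := hJ t x ht h2
      refine ⟨_, _, (hJq.sub hJu).sub (((Jet.exp _ _ _ t x).cmul ε).add ((Jet.exp _ _ _ t x).cmul R)), ?_⟩
      have := hle (u t x) (P.nonneg h1 x) (by linarith)
      nlinarith

lemma first_touch {F : ℝ → ℝ} (hF : Continuous F) (h0 : F 0 < 0) {t1 : ℝ} (ht1 : 0 ≤ t1)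
    (h1 : 0 ≤ F t1) : ∃ t0, 0 < t0 ∧ t0 ≤ t1 ∧ F t0 = 0 ∧ ∀ t, 0 ≤ t → t < t0 → F t < 0 := by
  have hcl : IsCompact (Icc 0 t1 ∩ F ⁻¹' Ici 0) :=
    isCompact_Icc.inter_right (isClosed_Ici.preimage hF)
  obtain ⟨b, hb, hbmin⟩ := hcl.exists_isMinOn ⟨t1, ⟨ht1, le_rfl⟩, h1⟩ continuousOn_id
  have hb2 : 0 ≤ F b := hb.2
  have hlt : ∀ t, 0 ≤ t → t < b → F t < 0 := by
    intro t h2 h3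
    by_contra h4
    push Not at h4
    have : b ≤ t := hbmin ⟨⟨h2, h3.le.trans hb.1.2⟩, h4⟩
    linarith
  have hb0 : 0 < b := by
    rcases hb.1.1.lt_or_eq with h | h
    · exact h
    · rw [← h] at hb2; linarith
  refine ⟨b, hb0, hb.1.2, le_antisymm ?_ hb2, hlt⟩
  refine le_of_tendsto (hF.continuousWithinAt (s := Iio b) (x := b)) ?_
  filter_upwards [self_mem_nhdsWithin, nhdsWithin_le_nhds (lt_mem_nhds hb0)] with r h6 h7
  exact (hlt r (le_of_lt h7) h6).le

lemma touch_deriv {F : ℝ → ℝ} {t0 D : ℝ} (h0 : 0 < t0) (hz : F t0 = 0)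
    (hlt : ∀ t, 0 ≤ t → t < t0 → F t < 0) (hD : HasDerivAt F D t0) : 0 ≤ D := by
  have h1 := hD.hasDerivWithinAt (s := Iio t0)
  rw [hasDerivWithinAt_iff_tendsto_slope] at h1
  have e : Iio t0 \ {t0} = Iio t0 := by
    ext x; simp only [Set.mem_sdiff, mem_Iio, mem_singleton_iff, and_iff_left_iff_imp]; exact fun h => h.ne
  rw [e] at h1
  refine ge_of_tendsto h1 ?_
  filter_upwards [self_mem_nhdsWithin, nhdsWithin_le_nhds (lt_mem_nhds h0)] with r h6 h7
  have h6 : r < t0 := h6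
  rw [slope_def_field, hz, sub_zero]
  exact div_nonneg_of_nonpos (hlt r (le_of_lt h7) h6).le (by linarith)

end

section

variable {d μ ω L R K pm : ℝ} {f : ℝ → ℝ → ℝ → ℝ} {p u v : ℝ → ℝ → ℝ} {h g : ℝ → ℝ}

/-- comparison as long as the fronts are ordered -/
lemma comp_le (X : Ctx d ω L R K pm f p) (V : Core d μ f p v g) (U : Core d μ f p u h) {T : ℝ}
    (hgh : ∀ t, 0 ≤ t → t ≤ T → g t ≤ h t) (h0 : ∀ x ≤ g 0, v 0 x ≤ u 0 x) :
    ∀ t x, 0 ≤ t → t ≤ T → v t x ≤ u t x := by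
  intro t x h1 h2
  rcases le_or_gt (g t) x with hx | hx
  · rw [V.uz t h1 x hx]
    exact U.nonneg h1 x
  have key := mp (d := d) (K := K) (s := 0) (T := T) (B := R) X.hd.le le_rfl
    {q : ℝ × ℝ | q.2 ≤ g q.1} (isClosed_le continuous_snd (V.hcont.comp continuous_fst))
    (fun t x => v t x - u t x)
    (Continuous.continuousOn (by have := V.ucont; have := U.ucont; fun_prop)) ?_ ?_ t x hx.le h1 h2
  · linarith
  · intro t x _ h1 _
    have := V.leR X h1 x
    have := U.nonneg h1 x
    linarith
  · intro t x hx h1 h2 hw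
    have hx : x ≤ g t := hx
    have hu := U.nonneg h1 x
    have hv : 0 < v t x := by linarith
    have hxg := V.lt_of_pos h1 hv
    have ht : 0 < t := by
      rcases h1.lt_or_eq with h3 | h3
      · exact h3
      · rw [← h3] at hw hx
        linarith [h0 x hx]
    refine ⟨ht, ?_, ?_⟩
    · refine mem_of_superset ((isOpen_lt continuous_snd (V.hcont.comp continuous_fst)).mem_nhds hxg) ?_
      intro q hq
      have hq : q.2 < g q.1 := hq
      exact hq.le
    · obtain ⟨vxx, hJv⟩ := V.jet ht hxg
      obtain ⟨uxx, hJu⟩ := U.jet ht (hxg.trans_le (hgh t h1 h2))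
      refine ⟨_, _, hJv.sub hJu, ?_⟩
      have hf := (abs_le.1 (X.flip (t := t) (x := x) hu (by linarith) (V.leR X h1 x))).2
      linarith

lemma comp (hμ : 0 < μ) (X : Ctx d ω L R K pm f p) (V : Core d μ f p v g) (U : Core d μ f p u h)
    (h0 : ∀ x ≤ g 0, v 0 x < u 0 x) : ∀ t, 0 ≤ t → g t ≤ h t ∧ ∀ x, v t x ≤ u t x := by
  have hd := X.hd
  have hK := X.hK
  have hgh : ∀ t, 0 ≤ t → g t < h t := by
    by_contra hcon
    push Not at hcon
    obtain ⟨t1, ht1, hge⟩ := hcon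
    have hg0 : g 0 < h 0 := by
      apply U.lt_of_pos le_rfl
      have := h0 (g 0) le_rfl
      rwa [V.uz 0 le_rfl _ le_rfl] at this
    obtain ⟨t0, ht0, -, hz, hlt⟩ := first_touch (F := fun t => g t - h t) (V.hcont.sub U.hcont)
      (by linarith) ht1 (by linarith)
    have hle0 : ∀ t, 0 ≤ t → t ≤ t0 → g t ≤ h t := by
      intro t h1 h2
      rcases h2.lt_or_eq with h3 | h3
      · have := hlt t h1 h3
        linarith
      · rw [h3]
        linarith
    have hvu := comp_le X V U hle0 (fun x hx => (h0 x hx).le)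
    set W : ℝ → ℝ → ℝ := fun t x => u t x - v t x with hW
    have hWc : Continuous (fun q : ℝ × ℝ => W q.1 q.2) := U.ucont.sub V.ucont
    have hWnn : ∀ t x, 0 ≤ t → t ≤ t0 → 0 ≤ W t x := fun t x h1 h2 => by
      have := hvu t x h1 h2
      simp only [hW]
      linarith
    have hWJ : ∀ t x, 0 < t → t ≤ t0 → x < g t → ∃ Wt Wxx, Jet W t x Wt Wxx ∧
        d * Wxx - K * W t x ≤ Wt := by
      intro t x h1 h2 h3
      obtain ⟨vxx, hJv⟩ := V.jet h1 h3
      obtain ⟨uxx, hJu⟩ := U.jet h1 (h3.trans_le (hle0 t h1.le h2))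
      refine ⟨_, _, hJu.sub hJv, ?_⟩
      have hf := (abs_le.1 (X.flip (t := t) (x := x) (V.nonneg h1.le x) (hvu t x h1.le h2) (U.leR X h1.le x))).1
      simp only [hW]
      linarith
    set x1 := g 0 - 2 with hx1
    have hπ := Real.pi_le_four
    have hπ0 := Real.pi_pos
    obtain ⟨xm, hxm, hmin⟩ := (isCompact_Icc (a := x1 - 2) (b := g 0)).exists_isMinOn
      ⟨g 0, by linarith, le_rfl⟩ (hWc.comp (Continuous.prodMk_right (0:ℝ))).continuousOn
    set κ := W 0 xm with hκdef
    have hκ : 0 < κ := by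
      have := h0 xm hxm.2
      simp only [hκdef, hW]
      linarith
    have hκle : ∀ x, x1 - 2 ≤ x → x ≤ g 0 → κ ≤ W 0 x := fun x h1 h2 => hmin ⟨h1, h2⟩
    have hexp : ∀ t : ℝ, 0 ≤ t → Real.exp (-(K + d) * t) ≤ 1 := fun t ht => by
      rw [Real.exp_le_one_iff]
      nlinarith
    have hgm : ∀ t, 0 ≤ t → g 0 ≤ g t := fun t ht => V.mono le_rfl ht
    have bump : ∀ t x, (t, x) ∈ {q : ℝ × ℝ | x1 - Real.pi / 2 ≤ q.2 ∧ q.2 ≤ x1 + Real.pi / 2} → 0 ≤ t → t ≤ t0 →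
        (κ * Real.exp (-(K + d) * t)) * Real.cos (x - x1) - W t x ≤ 0 := by
      refine mp (d := d) (K := 0) (s := 0) (T := t0) (B := κ) hd.le le_rfl _
        ((isClosed_le continuous_const continuous_snd).inter (isClosed_le continuous_snd continuous_const))
        (fun t x => (κ * Real.exp (-(K + d) * t)) * Real.cos (x - x1) - W t x)
        (Continuous.continuousOn (by fun_prop)) ?_ ?_
      · intro t x _ h1 h2
        have := hWnn t x h1 h2
        have e1 := hexp t h1
        have e2 := Real.cos_le_one (x - x1)
        have e3 := Real.exp_pos (-(K + d) * t)
        have e4 : (κ * Real.exp (-(K + d) * t)) * Real.cos (x - x1) ≤ (κ * 1) * 1 := by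
          apply mul_le_mul _ e2 _ (by positivity)
          · exact mul_le_mul_of_nonneg_left e1 hκ.le
          · apply Real.cos_nonneg_of_mem_Icc
            rename_i hx
            obtain ⟨hx1, hx2⟩ := hx
            have hx1 : x1 - Real.pi / 2 ≤ x := hx1
            have hx2 : x ≤ x1 + Real.pi / 2 := hx2
            constructor <;> linarith
        linarith
      · rintro t x ⟨ha, hb⟩ h1 h2 hw
        have ha : x1 - Real.pi / 2 ≤ x := ha
        have hb : x ≤ x1 + Real.pi / 2 := hb
        have hWn := hWnn t x h1 h2
        have e1 := hexp t h1
        have e2 := Real.cos_le_one (x - x1)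
        have ht : 0 < t := by
          rcases h1.lt_or_eq with h3 | h3
          · exact h3
          · exfalso
            rw [← h3] at hw
            have := hκle x (by linarith) (by linarith)
            simp only [mul_zero, Real.exp_zero, mul_one] at hw
            nlinarith
        have ha' : x1 - Real.pi / 2 < x := by
          rcases ha.lt_or_eq with h3 | h3
          · exact h3
          · exfalso
            have : x - x1 = -(Real.pi / 2) := by linarith
            rw [this, Real.cos_neg, Real.cos_pi_div_two] at hw
            linarith
        have hb' : x < x1 + Real.pi / 2 := by
          rcases hb.lt_or_eq with h3 | h3
          · exact h3
          · exfalso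
            have : x - x1 = Real.pi / 2 := by linarith
            rw [this, Real.cos_pi_div_two] at hw
            linarith
        refine ⟨ht, ?_, ?_⟩
        · refine mem_of_superset (((isOpen_lt continuous_const continuous_snd).inter
            (isOpen_lt continuous_snd continuous_const)).mem_nhds ⟨ha', hb'⟩) ?_
          rintro q ⟨hq1, hq2⟩
          have hq1 : x1 - Real.pi / 2 < q.2 := hq1
          have hq2 : q.2 < x1 + Real.pi / 2 := hq2
          exact ⟨hq1.le, hq2.le⟩
        · obtain ⟨Wt, Wxx, hJ, hle⟩ := hWJ t x ht h2 (by have := hgm t h1; linarith)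
          have hT : HasDerivAt (fun r => κ * Real.exp (-(K + d) * r))
              (κ * (Real.exp (-(K + d) * t) * (-(K + d) * 1))) t :=
            (((hasDerivAt_id t).const_mul (-(K + d))).exp).const_mul κ
          have hX : ∀ y, HasDerivAt (fun y => Real.cos (y - x1)) (-Real.sin (y - x1)) y := by
            intro y
            have := ((hasDerivAt_id y).sub_const x1).cos
            simpa using this
          have hX2 : HasDerivAt (fun y => -Real.sin (y - x1)) (-Real.cos (x - x1)) x := by
            have := ((((hasDerivAt_id x).sub_const x1).sin).neg)
            rw [mul_one] at this
            exact this
          refine ⟨_, _, (Jet.prod hT hX hX2).sub hJ, ?_⟩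
          nlinarith
    obtain ⟨gd, hgb, hg⟩ := V.stefan
    obtain ⟨hdd, -, hh⟩ := U.stefan
    obtain ⟨C, hC⟩ := hgb t0
    set κ' := κ * Real.exp (-(K + d) * t0) with hκ'
    obtain ⟨η, hη, hlow⟩ := hopf (d := d) (K := K) (s := 0) (T := t0) (x1 := x1) (W := W) (h := g)
      (hd := gd) (C := C) (κ := κ') (η0 := κ / 2) hd hK.le le_rfl ht0.le V.hcont hWc
      (fun t h1 _ => (hg t h1.le).1) (fun t h1 h2 => hC t h1.le h2)
      (fun t x h1 h2 _ _ => hWnn t x h1 h2) (by positivity)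
      (by
        intro t h1 h2
        have := bump t x1 ⟨by dsimp only; linarith, by dsimp only; linarith⟩ h1 h2
        rw [sub_self, Real.cos_zero, mul_one] at this
        have e : Real.exp (-(K + d) * t0) ≤ Real.exp (-(K + d) * t) := by
          apply Real.exp_le_exp.2
          nlinarith
        have := mul_le_mul_of_nonneg_left e hκ.le
        rw [hκ']
        linarith) (by positivity)
      (by
        intro x h1 h2
        have := hκle x (by linarith) h2
        nlinarith)
      (fun t x h1 h2 _ h4 => hWJ t x h1 h2 h4)
    have hz' : g t0 = h t0 := by linarith
    obtain ⟨g1, -, g3⟩ := hg t0 ht0.le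
    obtain ⟨k1, -, k3⟩ := hh t0 ht0.le
    rw [← hz'] at k3
    have hsl := slope_upper (g := W t0) (a := x1) (by have := hgm t0 ht0.le; linarith)
      (fun x h1 h2 => hlow t0 x ht0.le le_rfl h1 h2)
      (by simp only [hW]; rw [V.uz t0 ht0.le _ le_rfl, U.uz t0 ht0.le _ hz'.ge, sub_zero]) (k3.sub g3)
    have hdv := touch_deriv ht0 hz hlt (g1.sub k1)
    have : hdd t0 / μ ≤ gd t0 / μ := by
      apply div_le_div_of_nonneg_right _ hμ.le
      linarith
    linarith
  intro t ht
  exact ⟨(hgh t ht).le, fun x => comp_le X V U (T := t) (fun s h1 _ => (hgh s h1).le)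
    (fun x hx => (h0 x hx).le) t x ht le_rfl⟩

lemma front (hμ : 0 < μ) (X : Ctx d ω L R K pm f p) (U : Core d μ f p u h) {T E l x0 : ℝ} (hE : 0 < E)
    (hl : 0 < l) (hKl : K * l ^ 2 ≤ 2 * d) (hu : ∀ t x, 0 ≤ t → t ≤ T → x0 ≤ x → u t x ≤ E) :
    ∀ t, 0 ≤ t → t ≤ T → h t ≤ max (h 0) x0 + l + 3 * μ * E / l * t := by
  have hd := X.hd
  have hK := X.hK
  set A := max (h 0) x0 with hA
  have hA1 : h 0 ≤ A := le_max_left _ _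
  have hA2 : x0 ≤ A := le_max_right _ _
  set γ := 3 * μ * E / l with hγ
  have hγ0 : 0 < γ := by positivity
  by_contra hcon
  push Not at hcon
  obtain ⟨t1, ht1, ht1T, hgt⟩ := hcon
  obtain ⟨t0, ht0, ht01, hz, hlt⟩ := first_touch (F := fun t => h t - (A + l + γ * t))
    (U.hcont.sub (by fun_prop)) (by simp only [mul_zero]; linarith) ht1 (by linarith)
  have hle : ∀ t, 0 ≤ t → t ≤ t0 → h t ≤ A + l + γ * t := by
    intro t h1 h2
    rcases h2.lt_or_eq with h3 | h3
    · have := hlt t h1 h3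
      linarith
    · rw [h3]
      linarith
  have key : ∀ t x, (t, x) ∈ {q : ℝ × ℝ | A + γ * q.1 ≤ q.2 ∧ q.2 ≤ A + l + γ * q.1} → 0 ≤ t → t ≤ t0 →
      u t x - E * (1 - ((x - A - γ * t) / l) ^ 2) ≤ 0 := by
    refine mp (d := d) (K := K) (s := 0) (T := t0) (B := E) hd.le le_rfl _
      ((isClosed_le (by fun_prop) continuous_snd).inter (isClosed_le continuous_snd (by fun_prop)))
      (fun t x => u t x - E * (1 - ((x - A - γ * t) / l) ^ 2))
      (Continuous.continuousOn (by have := U.ucont; fun_prop)) ?_ ?_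
    · rintro t x ⟨ha, hb⟩ h1 h2
      have ha : A + γ * t ≤ x := ha
      have hb : x ≤ A + l + γ * t := hb
      have e1 := hu t x h1 (h2.trans (ht01.trans ht1T)) (by nlinarith)
      have e2 : ((x - A - γ * t) / l) ^ 2 ≤ 1 := by
        apply pow_le_one₀
        · apply div_nonneg <;> linarith
        · rw [div_le_one hl]; linarith
      nlinarith
    · rintro t x ⟨ha, hb⟩ h1 h2 hw
      have ha : A + γ * t ≤ x := ha
      have hb : x ≤ A + l + γ * t := hb
      have e1 := hu t x h1 (h2.trans (ht01.trans ht1T)) (by nlinarith)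
      set s := (x - A - γ * t) / l with hs
      have e2 : 0 ≤ s := by apply div_nonneg <;> linarith
      have e3 : s ≤ 1 := by rw [hs, div_le_one hl]; linarith
      have hpos : 0 < u t x := by
        have : s ^ 2 ≤ 1 := pow_le_one₀ e2 e3
        have : 0 ≤ E * (1 - s ^ 2) := mul_nonneg hE.le (by linarith)
        linarith
      have hxh := U.lt_of_pos h1 hpos
      have ht : 0 < t := by
        rcases h1.lt_or_eq with h3 | h3
        · exact h3
        · exfalso
          rw [← h3] at hxh ha
          linarith
      have hs0 : 0 < s := by
        rcases e2.lt_or_eq with h3 | h3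
        · exact h3
        · exfalso
          rw [← h3] at hw
          nlinarith
      have ha' : A + γ * t < x := by
        rw [hs, lt_div_iff₀ hl] at hs0
        linarith
      have hb' : x < A + l + γ * t := hxh.trans_le (hle t h1 h2)
      refine ⟨ht, ?_, ?_⟩
      · refine mem_of_superset (((isOpen_lt (by fun_prop) continuous_snd).inter
          (isOpen_lt continuous_snd (by fun_prop))).mem_nhds
          (show (t, x) ∈ {q : ℝ × ℝ | A + γ * q.1 < q.2} ∩ {q : ℝ × ℝ | q.2 < A + l + γ * q.1} from ⟨ha', hb'⟩)) ?_
        rintro q ⟨hq1, hq2⟩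
        have hq1 : A + γ * q.1 < q.2 := hq1
        have hq2 : q.2 < A + l + γ * q.1 := hq2
        exact ⟨hq1.le, hq2.le⟩
      · obtain ⟨uxx, hJu⟩ := U.jet ht hxh
        have hJW : Jet (fun t x => E * (1 - ((x - A - γ * t) / l) ^ 2)) t x
            (E * (2 * s * (γ / l))) (E * (-(2 / l ^ 2))) := by
          have h1 : HasDerivAt (fun r => (x - A - γ * r) / l) (-γ / l) t := by
            have := (((hasDerivAt_id t).const_mul γ).const_sub (x - A)).div_const l
            simpa using this
          have h2 : ∀ y, HasDerivAt (fun y => (y - A - γ * t) / l) (1 / l) y := by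
            intro y
            have := (((hasDerivAt_id y).sub_const A).sub_const (γ * t)).div_const l
            simpa using this
          refine ⟨HasDerivAt.hasDerivWithinAt ?_, fun y => E * (-(2 * ((y - A - γ * t) / l) * (1 / l))), ?_, ?_⟩
          · have := ((h1.pow 2).const_sub 1).const_mul E
            refine this.congr_deriv ?_
            rw [hs]; push_cast; ring
          · refine Eventually.of_forall fun y => ?_
            have := (((h2 y).pow 2).const_sub 1).const_mul E
            refine this.congr_deriv ?_
            push_cast; ring
          · have := ((((h2 x).const_mul 2).mul_const (1 / l)).neg).const_mul E
            refine this.congr_deriv ?_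
            field_simp
        refine ⟨_, _, hJu.sub hJW, ?_⟩
        have hf := (abs_le.1 (X.fle (t := t) (x := x) hpos.le (U.leR X h1 x))).2
        have e4 : 0 ≤ E * (2 * s * (γ / l)) := by positivity
        have e5 : K * E ≤ d * (E * (2 / l ^ 2)) := by
          have : K ≤ d * (2 / l ^ 2) := by
            rw [mul_div_assoc', le_div_iff₀ (by positivity)]
            linarith
          nlinarith
        have e6 : K * (E * (1 - s ^ 2)) ≤ K * E := by
          apply mul_le_mul_of_nonneg_left _ hK.le
          nlinarith
        nlinarith
  obtain ⟨hdd, -, hh⟩ := U.stefan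
  obtain ⟨k1, -, k3⟩ := hh t0 ht0.le
  have hz' : h t0 = A + l + γ * t0 := by linarith
  have hsl := slope_upper (g := fun x => -u t0 x) (a := h t0 - l) (b := h t0) (η := -(2 * E / l)) (by linarith)
    (by
      intro x h1 h2
      have := key t0 x ⟨by dsimp only; linarith, by dsimp only; linarith⟩ ht0.le le_rfl
      have e : (x - A - γ * t0) / l = 1 - (h t0 - x) / l := by
        rw [hz']; field_simp; ring
      rw [e] at this
      have e2 : 0 ≤ (h t0 - x) / l := by apply div_nonneg <;> linarith
      have e3 : -(2 * E / l) * (h t0 - x) = -(2 * E * ((h t0 - x) / l)) := by ring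
      have e4 : E * (1 - (1 - (h t0 - x) / l) ^ 2) = 2 * E * ((h t0 - x) / l) - E * ((h t0 - x) / l) ^ 2 := by
        ring
      have e5 : 0 ≤ E * ((h t0 - x) / l) ^ 2 := by positivity
      show -(2 * E / l) * (h t0 - x) ≤ -u t0 x
      linarith) (by rw [U.uz t0 ht0.le _ le_rfl, neg_zero]) k3.neg
  have hdv := touch_deriv ht0 hz hlt (k1.sub (((hasDerivAt_id t0).const_mul γ).const_add (A + l)))
  have h5 : hdd t0 / μ ≤ 2 * E / l := by linarith
  rw [div_le_iff₀ hμ] at h5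
  have h6 : γ = 2 * E / l * μ + E / l * μ := by rw [hγ]; ring
  have h7 : 0 < E / l * μ := by positivity
  linarith

end

section

variable {d μ ω L R K pm : ℝ} {f : ℝ → ℝ → ℝ → ℝ} {p u v : ℝ → ℝ → ℝ} {h g : ℝ → ℝ}

lemma exists_div {a t : ℝ} (ha : 0 < a) (ht : 0 ≤ t) :
    ∃ n : ℕ, ∃ r : ℝ, 0 ≤ r ∧ r < a ∧ t = r + n * a := by
  refine ⟨⌊t / a⌋₊, t - ⌊t / a⌋₊ * a, ?_, ?_, by ring⟩
  · have := Nat.floor_le (a := t / a) (by positivity)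
    rw [le_div_iff₀ ha] at this
    linarith
  · have := Nat.lt_floor_add_one (t / a)
    rw [div_lt_iff₀ ha] at this
    linarith

lemma exp_small {A ε : ℝ} (hA : 0 < A) (hε : 0 < ε) : ∃ b > 0, A * Real.exp (-b) ≤ ε := by
  have hm : A / ε ≤ Real.exp (max 1 (A / ε)) := by
    have := Real.add_one_le_exp (max 1 (A / ε))
    have := le_max_right 1 (A / ε)
    linarith
  refine ⟨max 1 (A / ε), lt_of_lt_of_le one_pos (le_max_left _ _), ?_⟩
  rw [Real.exp_neg, ← div_eq_mul_inv, div_le_iff₀ (Real.exp_pos _)]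
  rw [div_le_iff₀ hε] at hm
  linarith

lemma lowerU (X : Ctx d ω L R K pm f p) (T : ℝ) {δ : ℝ} (hT : 0 ≤ T) (hδ : 0 < δ) :
    ∃ b > 0, ∃ η > 0, ∀ (u : ℝ → ℝ → ℝ) (h : ℝ → ℝ) (y : ℝ) (q : ℝ → ℝ → ℝ), Core d μ f p u h →
    Continuous (fun z : ℝ × ℝ => q z.1 z.2) → (∀ t x, 0 ≤ t → q t x ≤ R) →
    (∀ t x, 0 < t → t ≤ T → ∃ qt qxx, Jet q t x qt qxx ∧
      ∀ r, 0 ≤ r → r ≤ q t x → qt ≤ d * qxx + f t x r + K * (q t x - r)) →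
    y ≤ h 0 → (∀ x ≤ y, q 0 x - η ≤ u 0 x) → ∀ t x, 0 ≤ t → t ≤ T → x ≤ y - b → q t x - δ ≤ u t x := by
  have hR := X.hR
  have hK := X.hK
  have hd := X.hd
  obtain ⟨b, hb, hbe⟩ := exp_small (A := R * Real.exp (d * T) * Real.exp (K * T)) (ε := δ / 2)
    (by positivity) (by positivity)
  refine ⟨b, hb, δ / 2 * Real.exp (-(K * T)), by positivity, ?_⟩
  intro u h y q P hq hqR hJ hy h0 t x h1 h2 h3
  have key := P.lower X q hq hqR hJ hy (ε := δ / 2 * Real.exp (-(K * T))) (by positivity) h0 t x h1 h2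
  have e1 : Real.exp (K * t) ≤ Real.exp (K * T) := Real.exp_le_exp.2 (by nlinarith)
  have e2 : Real.exp (x - y + d * t) ≤ Real.exp (-b + d * T) := Real.exp_le_exp.2 (by nlinarith)
  have e3 : (δ / 2 * Real.exp (-(K * T)) + R * Real.exp (x - y + d * t)) * Real.exp (K * t) ≤
      (δ / 2 * Real.exp (-(K * T)) + R * Real.exp (-b + d * T)) * Real.exp (K * T) := by
    gcongr
  have e4 : (δ / 2 * Real.exp (-(K * T)) + R * Real.exp (-b + d * T)) * Real.exp (K * T) =
      δ / 2 + R * Real.exp (d * T) * Real.exp (K * T) * Real.exp (-b) := by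
    rw [Real.exp_add, add_mul, mul_assoc, ← Real.exp_add]
    simp only [neg_add_cancel, Real.exp_zero]
    ring
  linarith

lemma p_sub (X : Ctx d ω L R K pm f p) (t x : ℝ) : ∃ qt qxx, Jet p t x qt qxx ∧
    ∀ r, 0 ≤ r → r ≤ p t x → qt ≤ d * qxx + f t x r + K * (p t x - r) := by
  obtain ⟨pxx, hJ⟩ := jet_of_solves X.psol (t := t) (x := x) (by simp)
  refine ⟨_, _, hJ, fun r h1 h2 => ?_⟩
  have := (abs_le.1 (X.flip (t := t) (x := x) h1 h2 (X.ple t x))).2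
  linarith

lemma Full.close (X : Ctx d ω L R K pm f p) (U : Full d μ ω f p u h) (C : ℝ) {ε : ℝ} (hε : 0 < ε) :
    ∃ S, 0 ≤ S ∧ ∀ t, S ≤ t → ∀ x ≤ C, p t x - ε ≤ u t x := by
  have hω := X.hω
  have hpm := X.hpm
  obtain ⟨b, hb, η, hη, H⟩ := lowerU (μ := μ) X ω hω.le hε
  obtain ⟨N, hN⟩ := U.conv (C + b) (min η (pm / 2)) (lt_min hη (by linarith))
  refine ⟨N * ω, by positivity, fun t ht x hx => ?_⟩
  obtain ⟨n, r, hr0, hr, rfl⟩ := exists_div hω (t := t) (le_trans (by positivity) ht)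
  have hn : N ≤ n := by
    by_contra hlt
    push Not at hlt
    have : (n : ℝ) + 1 ≤ N := by exact_mod_cast hlt
    nlinarith
  have hc := hN n hn
  have h1 := H _ _ (C + b) p (U.toCore.shift X n) X.pc (fun t x _ => X.ple t x)
    (fun t x _ _ => p_sub X t x) ?_ ?_ r x hr0 hr.le (by linarith)
  · rw [X.pn]
    exact h1
  · rw [zero_add]
    apply le_of_lt
    apply U.lt_of_pos (by positivity)
    have := (abs_le.1 (hc (C + b) le_rfl)).1
    have := min_le_right η (pm / 2)
    have := X.pge 0 (C + b)
    linarith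
  · intro x hx
    rw [zero_add]
    have := (abs_le.1 (hc x hx)).1
    have := min_le_left η (pm / 2)
    linarith

def DD (ω L : ℝ) (u : ℝ → ℝ → ℝ) (h : ℝ → ℝ) (n : ℕ) (j : ℤ) : Prop :=
  ∀ x ≤ h 0 + j * L, u 0 (x - j * L) < u (n * ω) x

lemma DD.comp {n : ℕ} {j : ℤ} (D : DD ω L u h n j) (hμ : 0 < μ) (X : Ctx d ω L R K pm f p)
    (U : Core d μ f p u h) : ∀ t, 0 ≤ t → h t + j * L ≤ h (t + n * ω) ∧
      ∀ x, u t (x - j * L) ≤ u (t + n * ω) x :=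
  _root_.comp hμ X (U.xshift X j) (U.shift X n) (by
    intro x hx
    rw [zero_add]
    exact D x hx)

lemma DD.add {n m : ℕ} {j i : ℤ} (D : DD ω L u h n j) (D' : DD ω L u h m i) (hμ : 0 < μ)
    (X : Ctx d ω L R K pm f p) (U : Core d μ f p u h) : DD ω L u h (n + m) (j + i) := by
  intro x hx
  have hω := X.hω
  push_cast at hx ⊢
  have h1 := D (x - i * L) (by linarith)
  have h2 := (D'.comp hμ X U (n * ω) (by positivity)).2 x
  have e1 : x - i * L - j * L = x - (j + i) * L := by ring
  have e2 : n * ω + m * ω = (n + m) * ω := by ring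
  rw [e1] at h1
  rw [e2] at h2
  linarith

lemma DD.mul {n : ℕ} {j : ℤ} (D : DD ω L u h n j) (hμ : 0 < μ)
    (X : Ctx d ω L R K pm f p) (U : Core d μ f p u h) (k : ℕ) :
    DD ω L u h ((k + 1) * n) ((k + 1 : ℕ) * j) := by
  induction k with
  | zero => simpa using D
  | succ k ih =>
    have := ih.add D hμ X U
    convert this using 1
    · ring
    · push_cast; ring

lemma Full.dd_of (X : Ctx d ω L R K pm f p) {θ : ℝ} (hθ : ∀ x, θ ≤ p 0 x - u 0 x)
    {n : ℕ} {j : ℤ} (H : ∀ x ≤ h 0 + j * L, p 0 x - θ < u (n * ω) x) : DD ω L u h n j := by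
  intro x hx
  have h1 := hθ (x - j * L)
  rw [X.px] at h1
  have := H x hx
  linarith

lemma Full.dd_large (X : Ctx d ω L R K pm f p) (U : Full d μ ω f p u h) (J : ℤ) :
    ∃ N : ℕ, ∀ n, N ≤ n → ∀ j ≤ J, DD ω L u h n j := by
  obtain ⟨θ, hθ, hg⟩ := U.gap
  obtain ⟨N, hN⟩ := U.conv (h 0 + J * L) (θ / 2) (by linarith)
  refine ⟨N, fun n hn j hj => Full.dd_of X hg fun x hx => ?_⟩
  have hL := X.hL
  have : (j : ℝ) ≤ J := by exact_mod_cast hj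
  have := (abs_le.1 (hN n hn x (by nlinarith))).1
  linarith

lemma exists_l (X : Ctx d ω L R K pm f p) {b : ℝ} (hb : 0 < b) : ∃ l > 0, l ≤ b ∧ K * l ^ 2 ≤ 2 * d := by
  have hd := X.hd
  have hK := X.hK
  refine ⟨min b (√(2 * d / K)), lt_min hb (Real.sqrt_pos.2 (by positivity)), min_le_left _ _, ?_⟩
  have h1 : min b (√(2 * d / K)) ^ 2 ≤ √(2 * d / K) ^ 2 :=
    pow_le_pow_left₀ (le_min hb.le (Real.sqrt_nonneg _)) (min_le_right _ _) 2
  rw [Real.sq_sqrt (by positivity)] at h1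
  have := mul_le_mul_of_nonneg_left h1 hK.le
  rwa [mul_div_cancel₀ _ hK.ne'] at this

/-- a linear upper bound for the front -/
lemma Core.lin (hμ : 0 < μ) (X : Ctx d ω L R K pm f p) (U : Core d μ f p u h) :
    ∃ l > 0, ∃ γ > 0, ∀ t, 0 ≤ t → h t ≤ h 0 + l + γ * t := by
  have hR := X.hR
  obtain ⟨l, hl, -, hKl⟩ := exists_l X one_pos
  refine ⟨l, hl, 3 * μ * R / l, by positivity, fun t ht => ?_⟩
  have := front hμ X U (T := t) hR hl hKl (x0 := h 0) (fun t x h1 _ _ => U.leR X h1 x) t ht le_rfl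
  rwa [max_self] at this

lemma Full.speed (hμ : 0 < μ) (X : Ctx d ω L R K pm f p) (U : Full d μ ω f p u h) :
    ∃ σ : ℝ, 0 < σ ∧ (∀ n : ℕ, 1 ≤ n → ∀ j : ℤ, DD ω L u h n j → (j : ℝ) ≤ σ * n) ∧
      ∀ s < σ, ∃ n : ℕ, 1 ≤ n ∧ ∃ j : ℤ, DD ω L u h n j ∧ s * n < j := by
  have hL := X.hL
  have hω := X.hω
  obtain ⟨l, hl, γ, hγ, hlin⟩ := Core.lin hμ X U.toCore
  set A : Set ℝ := {r | ∃ n : ℕ, 1 ≤ n ∧ ∃ j : ℤ, DD ω L u h n j ∧ r = j / n} with hA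
  have hbdd : BddAbove A := by
    refine ⟨(l + γ * ω) / L, ?_⟩
    rintro r ⟨n, hn, j, D, rfl⟩
    have hn' : (1 : ℝ) ≤ n := by exact_mod_cast hn
    have h1 := (D.comp hμ X U.toCore 0 le_rfl).1
    rw [zero_add] at h1
    have h2 := hlin (n * ω) (by positivity)
    rw [div_le_div_iff₀ (by linarith) hL]
    nlinarith
  obtain ⟨N, hN⟩ := U.dd_large X 1
  have hmem : (1 : ℝ) / (N + 1 : ℕ) ∈ A := ⟨N + 1, by omega, 1, hN _ (by omega) 1 le_rfl, by push_cast; rfl⟩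
  refine ⟨sSup A, lt_of_lt_of_le (by positivity) (le_csSup hbdd hmem), ?_, ?_⟩
  · intro n hn j D
    have hn' : (0 : ℝ) < n := by exact_mod_cast hn
    rw [← div_le_iff₀ hn']
    exact le_csSup hbdd ⟨n, hn, j, D, rfl⟩
  · intro s hs
    obtain ⟨r, ⟨n, hn, j, D, rfl⟩, hr⟩ := exists_lt_of_lt_csSup ⟨_, hmem⟩ hs
    have hn' : (0 : ℝ) < n := by exact_mod_cast hn
    exact ⟨n, hn, j, D, by rwa [lt_div_iff₀ hn'] at hr⟩

lemma Full.inner (hμ : 0 < μ) (X : Ctx d ω L R K pm f p) (U : Full d μ ω f p u h) {c : ℝ}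
    {n : ℕ} (hn : 1 ≤ n) {j : ℤ} (D : DD ω L u h n j) (hc : c * (n * ω) < j * L) {ε : ℝ} (hε : 0 < ε) :
    ∃ T, 0 ≤ T ∧ ∀ t, T ≤ t → ∀ x ≤ c * t, p t x - ε ≤ u t x := by
  have hL := X.hL
  have hω := X.hω
  have hn' : (1 : ℝ) ≤ n := by exact_mod_cast hn
  have hnω : 0 < n * ω := by positivity
  obtain ⟨S, hS, hcl⟩ := U.close X 0 hε
  obtain ⟨k0, hk0⟩ := exists_nat_gt (|c| * (S + n * ω) / (j * L - c * (n * ω)))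
  rw [div_lt_iff₀ (by linarith)] at hk0
  refine ⟨S + (k0 + 1) * (n * ω), by positivity, fun t ht x hx => ?_⟩
  have hk0n : (0 : ℝ) ≤ k0 := Nat.cast_nonneg _
  obtain ⟨k, r, hr0, hr, e⟩ := exists_div hnω (t := t - S) (by nlinarith)
  have hk : k0 + 1 ≤ k := by
    by_contra hlt
    push Not at hlt
    have : (k : ℝ) ≤ k0 := by exact_mod_cast (by omega : k ≤ k0)
    nlinarith
  have hk' : (k0 : ℝ) ≤ k := by exact_mod_cast (by omega : k0 ≤ k)
  obtain ⟨k', rfl⟩ : ∃ k', k = k' + 1 := ⟨k - 1, by omega⟩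
  have h1 := ((D.mul hμ X U.toCore k').comp hμ X U.toCore (S + r) (by linarith)).2 x
  have e1 : S + r + ((k' + 1) * n : ℕ) * ω = t := by push_cast at e ⊢; linarith
  have hy : x - (((k' + 1 : ℕ) * j : ℤ) : ℝ) * L ≤ 0 := by
    have e2 : (((k' + 1 : ℕ) * j : ℤ) : ℝ) = ((k' + 1 : ℕ) : ℝ) * j := by push_cast; ring
    rw [e2]
    have h3 : c * (S + r) ≤ |c| * (S + n * ω) := by
      calc c * (S + r) ≤ |c| * (S + r) := mul_le_mul_of_nonneg_right (le_abs_self c) (by linarith)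
        _ ≤ _ := mul_le_mul_of_nonneg_left (by linarith) (abs_nonneg c)
    have h4 : c * t = c * (S + r) + ((k' + 1 : ℕ) : ℝ) * (c * (n * ω)) := by
      have : t = S + r + ((k' + 1 : ℕ) : ℝ) * (n * ω) := by linarith
      rw [this]; ring
    nlinarith
  have h2 := hcl (S + r) (by linarith) _ hy
  rw [X.px] at h2
  rw [e1] at h1
  have h5 : p t x = p (S + r) x := by
    rw [← e1, X.pn]
  rw [h5]
  linarith

end

section

variable {d μ ω L R K pm : ℝ} {f : ℝ → ℝ → ℝ → ℝ} {p u v : ℝ → ℝ → ℝ} {h : ℝ → ℝ}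

lemma Ps_mono {d τ B B' : ℝ} {a b : ℝ → ℝ} (ha : Continuous a) (hB : ∀ y, |a y| ≤ B)
    (hb : Continuous b) (hB' : ∀ y, |b y| ≤ B') {x x' c : ℝ} (hx : x' = x - c)
    (hab : ∀ y, a y ≤ b (y - c)) : Ps d τ a x ≤ Ps d τ b x' := by
  unfold Ps GA
  refine MeasureTheory.integral_mono (ker_ga.integrable_mul ha hB _ _)
    (ker_ga.integrable_mul hb hB' _ _) fun z => ?_
  dsimp only
  apply mul_le_mul_of_nonneg_left _ (ga_pos z).le
  have := hab (x + √(2 * d * τ) * z)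
  have e : x - c + √(2 * d * τ) * z = x + √(2 * d * τ) * z - c := by ring
  rw [hx, e]
  exact this

lemma Ps_barrier {d R H : ℝ} {a : ℝ → ℝ} (hd : 0 < d) (ha : Continuous a) (h0 : ∀ y, 0 ≤ a y) (hR : 0 < R)
    (haR : ∀ y, a y ≤ R) (haz : ∀ y, H ≤ y → a y = 0) {τ : ℝ} (hτ : 0 ≤ τ) (x : ℝ) :
    Ps d τ a x ≤ R * Real.exp (H + d * τ + (-1) * x) := by
  have hB : ∀ y, |a y| ≤ R := fun y => by rw [abs_of_nonneg (h0 y)]; exact haR y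
  have key := mp (d := d) (K := 0) (s := 0) (T := τ) (B := R) hd.le le_rfl univ isClosed_univ
    (fun t x => Ps d t a x - R * Real.exp (H + d * t + (-1) * x))
    (Continuous.continuousOn (by have := Ps_cont (d := d) ha hB; fun_prop)) ?_ ?_ τ x
    (mem_univ _) hτ le_rfl
  · linarith
  · intro t x _ _ _
    have := ga_le ha hB haR (√(2 * d * t)) x
    have : Ps d t a x ≤ R := this
    have : 0 ≤ R * Real.exp (H + d * t + (-1) * x) := by positivity
    linarith
  · intro t x _ h1 _ hw
    have ht : 0 < t := by
      rcases h1.lt_or_eq with h3 | h3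
      · exact h3
      · exfalso
        rw [← h3, Ps_zero, mul_zero, add_zero] at hw
        rcases le_or_gt H x with hx | hx
        · rw [haz x hx] at hw
          have : 0 ≤ R * Real.exp (H + (-1) * x) := by positivity
          linarith
        · have : 1 ≤ Real.exp (H + (-1) * x) := Real.one_le_exp (by linarith)
          have := haR x
          nlinarith
    refine ⟨ht, univ_mem, ?_⟩
    obtain ⟨vxx, hJ⟩ := Ps_jet ha hB hd ht x
    refine ⟨_, _, hJ.sub ((Jet.exp H d (-1) t x).cmul R), ?_⟩
    apply le_of_eq
    ring

lemma hasDerivAt_expc (c t : ℝ) : HasDerivAt (fun s => Real.exp (c * s)) (c * Real.exp (c * t)) t := by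
  have := ((hasDerivAt_id t).const_mul c).exp
  refine this.congr_deriv ?_
  simp only [id]
  ring

lemma Core.c0 (U : Core d μ f p u h) (t : ℝ) : Continuous (u t) :=
  U.ucont.comp (Continuous.prodMk_right t)

lemma Core.absR (X : Ctx d ω L R K pm f p) (U : Core d μ f p u h) {t : ℝ} (ht : 0 ≤ t) (y : ℝ) :
    |u t y| ≤ R := by rw [abs_of_nonneg (U.nonneg ht y)]; exact U.leR X ht y

lemma Core.upperPs (X : Ctx d ω L R K pm f p) (U : Core d μ f p u h) {t : ℝ} (ht : 0 ≤ t) (x : ℝ) :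
    u t x ≤ Real.exp (K * t) * Ps d t (u 0) x := by
  have hc := U.c0 0
  have hB := U.absR X le_rfl
  refine U.upper X (T := t) (fun t x => Real.exp (K * t) * Ps d t (u 0) x) ?_ ?_ ?_ ?_ t x ht le_rfl
  · have := Ps_cont (d := d) hc hB
    fun_prop
  · intro t x _
    exact mul_nonneg (Real.exp_pos _).le (ga_nonneg (U.nonneg le_rfl) _ _)
  · intro t x h1 _
    obtain ⟨vxx, hJ⟩ := Ps_jet hc hB X.hd h1 x
    refine ⟨_, _, Jet.tmul (hasDerivAt_expc K t) hJ, ?_⟩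
    apply le_of_eq
    ring
  · intro x
    rw [Ps_zero, mul_zero, Real.exp_zero, one_mul]

lemma upperU (X : Ctx d ω L R K pm f p) {T ε : ℝ} (hε : 0 < ε) :
    ∃ b > 0, ∀ (u : ℝ → ℝ → ℝ) (h : ℝ → ℝ) (y : ℝ), Core d μ f p u h →
      (∀ x, y ≤ x → u 0 x ≤ ε) → ∀ t x, 0 ≤ t → t ≤ T → y + b ≤ x → u t x ≤ 2 * ε * Real.exp (K * T) := by
  have hR := X.hR
  have hd := X.hd
  have hK := X.hK
  obtain ⟨b, hb, hbe⟩ := exp_small (A := R * Real.exp (d * T)) (by positivity) hε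
  refine ⟨b, hb, fun u h y U h0 t x h1 h2 h3 => ?_⟩
  have key := U.upper X (T := T) (fun t x => ε * Real.exp (K * t) + R * Real.exp (y + (d + K) * t + (-1) * x))
    (by fun_prop) (fun t x _ => by positivity) ?_ ?_ t x h1 h2
  · have e1 : R * Real.exp (y + (d + K) * t + (-1) * x) ≤ R * Real.exp (d * T) * Real.exp (-b) * Real.exp (K * T) := by
      rw [mul_assoc, mul_assoc, ← Real.exp_add, ← Real.exp_add]
      apply mul_le_mul_of_nonneg_left _ hR.le
      apply Real.exp_le_exp.2
      nlinarith
    have e2 : ε * Real.exp (K * t) ≤ ε * Real.exp (K * T) := by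
      apply mul_le_mul_of_nonneg_left _ hε.le
      apply Real.exp_le_exp.2
      nlinarith
    have e3 := mul_le_mul_of_nonneg_right hbe (Real.exp_pos (K * T)).le
    linarith
  · intro t x h1 _
    have j1 := Jet.tmul (hasDerivAt_expc K t) (Jet.const ε t x)
    have j2 := j1.add ((Jet.exp y (d + K) (-1) t x).cmul R)
    have e : (fun s y_1 => Real.exp (K * s) * ε + R * Real.exp (y + (d + K) * s + -1 * y_1)) =
      (fun t x => ε * Real.exp (K * t) + R * Real.exp (y + (d + K) * t + (-1) * x)) := by
      ext s z; ring
    rw [e] at j2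
    refine ⟨_, _, j2, ?_⟩
    apply le_of_eq
    ring
  · intro x
    rw [mul_zero, mul_zero, Real.exp_zero, add_zero, mul_one]
    rcases le_or_gt y x with hx | hx
    · have := h0 x hx
      have : 0 ≤ R * Real.exp (y + (-1) * x) := by positivity
      linarith
    · have : 1 ≤ Real.exp (y + (-1) * x) := Real.one_le_exp (by linarith)
      have := U.leR X le_rfl x
      nlinarith

lemma sol_sub (X : Ctx d ω L R K pm f p) {v : ℝ → ℝ → ℝ} (hv : SolvesPDE d f v {q : ℝ × ℝ | 0 < q.1})
    {t x : ℝ} (ht : 0 < t) (hR : v t x ≤ R) : ∃ qt qxx, Jet v t x qt qxx ∧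
    ∀ r, 0 ≤ r → r ≤ v t x → qt ≤ d * qxx + f t x r + K * (v t x - r) := by
  obtain ⟨pxx, hJ⟩ := jet_of_solves hv (t := t) (x := x) (Eventually.of_forall fun y => ht)
  refine ⟨_, _, hJ, fun r h1 h2 => ?_⟩
  have := (abs_le.1 (X.flip (t := t) (x := x) h1 h2 hR)).2
  linarith

lemma Ps_sub (X : Ctx d ω L R K pm f p) (U : Core d μ f p u h) {t x : ℝ} (ht : 0 < t) :
    ∃ qt qxx, Jet (fun t x => Real.exp (-K * t) * Ps d t (u 0) x) t x qt qxx ∧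
    ∀ r, 0 ≤ r → r ≤ Real.exp (-K * t) * Ps d t (u 0) x →
      qt ≤ d * qxx + f t x r + K * (Real.exp (-K * t) * Ps d t (u 0) x - r) := by
  have hK := X.hK
  obtain ⟨vxx, hJ⟩ := Ps_jet (U.c0 0) (U.absR X le_rfl) X.hd ht x
  refine ⟨_, _, Jet.tmul (hasDerivAt_expc (-K) t) hJ, fun r h1 h2 => ?_⟩
  have hle : Ps d t (u 0) x ≤ R := ga_le (U.c0 0) (U.absR X le_rfl) (U.leR X le_rfl) _ _
  have hnn : 0 ≤ Ps d t (u 0) x := ga_nonneg (U.nonneg le_rfl) _ _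
  have he : Real.exp (-K * t) ≤ 1 := by rw [Real.exp_le_one_iff]; nlinarith
  have hr : r ≤ R := by nlinarith
  have := (abs_le.1 (X.fle (t := t) (x := x) h1 hr)).1
  set Z := Real.exp (-K * t) * Ps d t (u 0) x with hZ
  have : -K * Real.exp (-K * t) * Ps d t (u 0) x = -K * Z := by rw [hZ]; ring
  nlinarith

end

section

variable {d μ ω L R K pm : ℝ} {f : ℝ → ℝ → ℝ → ℝ} {p u v : ℝ → ℝ → ℝ} {h : ℝ → ℝ}

/-- once the averaged density at `x` is not small, the population spreads up to `x` -/
lemma Full.seed (hμ : 0 < μ) (X : Ctx d ω L R K pm f p) (U : Full d μ ω f p u h) {ε : ℝ} (hε : 0 < ε) :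
    ∃ B : ℝ, ∃ N2 : ℕ, ∀ s0 : ℕ, ∀ x, ε < Ps d ω (u (s0 * ω)) x → ∀ j : ℤ, h 0 + j * L ≤ x - B →
      DD ω L u h (s0 + N2) j := by
  have hd := X.hd
  have hK := X.hK
  have hω := X.hω
  have hL := X.hL
  have hR := X.hR
  obtain ⟨θ, hθ, hgap⟩ := U.gap
  obtain ⟨N1, hN1⟩ := U.dd_large X 0
  obtain ⟨b, hb, hbe⟩ := exp_small (A := R * Real.exp (d * ω)) (by positivity) hε
  set c0 := (√2)⁻¹ * Real.exp (-(L ^ 2 / (2 * d * ω))) with hc0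
  have hc0p : 0 < c0 := by positivity
  set δ := Real.exp (-K * (2 * ω)) * (c0 * ε) / 2 with hδ
  have hδp : 0 < δ := by positivity
  obtain ⟨b1, hb1, η1, hη1, H1⟩ := lowerU (μ := μ) X (2 * ω) (by positivity) hδp
  obtain ⟨v, hvc, hv0, hvs, hvb, hvS⟩ := X.cau (min δ 1) (lt_min hδp one_pos) (min_le_right _ _)
  obtain ⟨S, hS⟩ := hvS (θ / 4) (by positivity)
  obtain ⟨N3, hN3⟩ := exists_nat_mul_ge hω S
  have hN3 := hN3 N3 le_rfl
  obtain ⟨b2, hb2, η2, hη2, H2⟩ := lowerU (μ := μ) X (N3 * ω) (by positivity) (δ := θ / 4) (by positivity)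
  refine ⟨b + b1 + b2, N1 + 2 + N3, fun s0 x hx j hj => ?_⟩
  set s := s0 + N1 with hs
  have W := U.toCore.shift X s
  -- the averaged density is large on a half line
  have hP : ∀ i : ℕ, ε < Ps d ω (fun y => u (0 + s * ω) y) (x - i * L) := by
    intro i
    refine lt_of_lt_of_le hx ?_
    have D := hN1 N1 le_rfl (-(i : ℤ)) (by omega)
    have hs0 : (0 : ℝ) ≤ s0 * ω := by positivity
    refine Ps_mono (U.c0 _) (U.absR X hs0) (W.c0 0) (W.absR X le_rfl) (c := i * L) rfl ?_
    intro y
    have := (D.comp hμ X U.toCore (s0 * ω) hs0).2 (y - i * L)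
    have e1 : y - i * L - ((-(i : ℤ) : ℤ) : ℝ) * L = y := by push_cast; ring
    have e2 : s0 * ω + N1 * ω = 0 + s * ω := by rw [hs]; push_cast; ring
    rw [e1, e2] at this
    exact this
  have hxH : x < h (0 + s * ω) + b := by
    by_contra hcon
    push Not at hcon
    have h1 := Ps_barrier hd (W.c0 0) (W.nonneg le_rfl) hR (W.leR X le_rfl) (W.uz 0 le_rfl) hω.le x
    have h2 := hP 0
    rw [Nat.cast_zero, zero_mul, sub_zero] at h2
    have h3 : R * Real.exp (h (0 + s * ω) + d * ω + (-1) * x) ≤ R * Real.exp (d * ω) * Real.exp (-b) := by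
      rw [mul_assoc, ← Real.exp_add]
      apply mul_le_mul_of_nonneg_left _ hR.le
      apply Real.exp_le_exp.2
      linarith
    linarith
  have hH : ∀ y ≤ x, c0 * ε ≤ Ps d (2 * ω) (fun y => u (0 + s * ω) y) y := by
    intro y hy
    obtain ⟨i, r, hr0, hr, e⟩ := exists_div hL (t := x - y) (by linarith)
    have h1 := Ps_harnack (W.c0 0) (W.absR X le_rfl) (W.nonneg le_rfl) hd hω (D := L)
      (x := x - i * L) (y := y) (by rw [abs_le]; constructor <;> linarith)
    have h2 := mul_le_mul_of_nonneg_left (hP i).le hc0p.le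
    exact h2.trans h1
  have hle2 : ∀ t y, 0 ≤ t → Real.exp (-K * t) * Ps d t (fun y => u (0 + s * ω) y) y ≤ R := by
    intro t y ht
    have hle : Ps d t (fun y => u (0 + s * ω) y) y ≤ R :=
      ga_le (W.c0 0) (W.absR X le_rfl) (W.leR X le_rfl) _ _
    have hnn : 0 ≤ Ps d t (fun y => u (0 + s * ω) y) y := ga_nonneg (W.nonneg le_rfl) _ _
    have he : Real.exp (-K * t) ≤ 1 := by rw [Real.exp_le_one_iff]; nlinarith
    nlinarith
  have hpos : ∀ y ≤ x - b - b1, δ ≤ u (2 * ω + s * ω) y := by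
    intro y hy
    have h1 := H1 _ _ (h (0 + s * ω)) (fun t y => Real.exp (-K * t) * Ps d t (fun y => u (0 + s * ω) y) y) W
      (by have := Ps_cont (d := d) (W.c0 0) (W.absR X le_rfl); fun_prop) hle2
      (fun t x h1 _ => Ps_sub X W h1) le_rfl
      (fun y _ => by
        rw [Ps_zero, mul_zero, Real.exp_zero, one_mul]
        linarith) (2 * ω) y (by positivity) le_rfl (by linarith)
    have h2 := mul_le_mul_of_nonneg_left (hH y (by linarith)) (Real.exp_pos (-K * (2 * ω))).le
    linarith
  -- spreading
  have e2 : 2 * ω + s * ω = 0 + (s + 2 : ℕ) * ω := by push_cast; ring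
  rw [e2] at hpos
  have hspread : ∀ y ≤ x - b - b1 - b2, v (N3 * ω) y - θ / 4 ≤ u (N3 * ω + (s + 2 : ℕ) * ω) y := by
    intro y hy
    refine H2 _ _ (x - b - b1) v (U.toCore.shift X (s + 2)) hvc (fun t x ht => (hvb t ht x).2)
      (fun t x h1 _ => sol_sub X hvs h1 (hvb t h1.le x).2) ?_ ?_ (N3 * ω) y (by positivity) le_rfl hy
    · apply le_of_lt
      apply U.lt_of_pos (by positivity)
      exact lt_of_lt_of_le hδp (hpos _ le_rfl)
    · intro y hy
      have h1 := hpos y hy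
      have h2 := min_le_left δ 1
      rw [hv0]
      linarith
  refine Full.dd_of X hgap fun y hy => ?_
  have h1 := hspread y (by linarith)
  have h2 := (abs_le.1 (hS (N3 * ω) hN3 y)).1
  have h3 : p (N3 * ω) y = p 0 y := by
    have := X.pn N3 0 y
    rwa [zero_add] at this
  have e3 : N3 * ω + (s + 2 : ℕ) * ω = ((s0 + (N1 + 2 + N3) : ℕ) : ℝ) * ω := by
    rw [hs]; push_cast; ring
  rw [e3] at h1
  linarith

lemma Full.outer (hμ : 0 < μ) (X : Ctx d ω L R K pm f p) (U : Full d μ ω f p u h) {σ : ℝ} (hσ0 : 0 < σ)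
    (hσ : ∀ n : ℕ, 1 ≤ n → ∀ j : ℤ, DD ω L u h n j → (j : ℝ) ≤ σ * n) {m k : ℕ} (hk : 1 ≤ k)
    (hmk : σ * k < m) : ∃ A : ℝ, ∀ t, 0 ≤ t → h t ≤ A + m * L / (k * ω) * t := by
  have hd := X.hd
  have hK := X.hK
  have hω := X.hω
  have hL := X.hL
  have hk' : (1 : ℝ) ≤ k := by exact_mod_cast hk
  have hm : 1 ≤ m := by
    by_contra hlt
    have : m = 0 := by omega
    rw [this, Nat.cast_zero] at hmk
    nlinarith
  have hm' : (1 : ℝ) ≤ m := by exact_mod_cast hm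
  have hkω : 0 < k * ω := by positivity
  obtain ⟨l, hl, hlL, hKl⟩ := exists_l X (b := L / 2) (by positivity)
  set M := 3 * μ * (2 * Real.exp (K * ω) * Real.exp (K * (k * ω))) / l * (k * ω) with hM
  have hMp : 0 < M := by positivity
  set ε := L / 2 / M with hε
  have hεp : 0 < ε := by positivity
  -- claim A
  have claim : ∃ S : ℝ, ∀ n : ℕ, ∀ x, S + n * (m * L) ≤ x → Ps d ω (u ((n * k : ℕ) * ω)) x ≤ ε := by
    obtain ⟨B, N2, HB⟩ := U.seed hμ X hεp
    by_contra hcon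
    push Not at hcon
    obtain ⟨n, x, hx, hgt⟩ := hcon (B + h 0 + L * (2 + σ * (N2 + 1)))
    have D := HB (n * k) x hgt ⌊(x - B - h 0) / L⌋ (by
      have := Int.floor_le ((x - B - h 0) / L)
      rw [le_div_iff₀ hL] at this
      linarith)
    have hnn : 1 ≤ n * k + (N2 + 1) := by omega
    have Dg := hσ (n * k + N2)
    have hfl := Int.lt_floor_add_one ((x - B - h 0) / L)
    rw [div_lt_iff₀ hL] at hfl
    have hjle : ((⌊(x - B - h 0) / L⌋ : ℤ) : ℝ) ≤ σ * (n * k + N2 + 1) := by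
      by_cases h0 : 1 ≤ n * k + N2
      · have := Dg h0 _ D
        push_cast at this
        nlinarith
      · -- degenerate case: use one more period
        have e0 : n * k + N2 = 0 := by omega
        rw [e0] at D
        exfalso
        have hD := (D.comp hμ X U.toCore 0 le_rfl).1
        simp only [Nat.cast_zero, zero_mul, add_zero] at hD
        have hj : 0 < ((⌊(x - B - h 0) / L⌋ : ℤ) : ℝ) := by
          have : 0 ≤ (n : ℝ) * (m * L) := by positivity
          have : 0 ≤ L * (σ * (N2 + 1)) := by positivity
          nlinarith
        nlinarith
    have h3 : (n : ℝ) * (σ * k) ≤ n * m := mul_le_mul_of_nonneg_left hmk.le (Nat.cast_nonneg n)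
    have h4 : x - B - h 0 < (n * m + σ * (N2 + 1) + 1) * L := by
      refine hfl.trans_le (mul_le_mul_of_nonneg_right ?_ hL.le)
      linarith
    linarith
  obtain ⟨S, hS⟩ := claim
  set E := 2 * (Real.exp (K * ω) * ε) * Real.exp (K * (k * ω)) with hE
  have hEp : 0 < E := by positivity
  obtain ⟨b, hb, Hb⟩ := upperU (μ := μ) X (T := k * ω) (ε := Real.exp (K * ω) * ε) (by positivity)
  have hEl : 3 * μ * E / l * (k * ω) = L / 2 := by
    have : 3 * μ * E / l * (k * ω) = M * ε := by rw [hE, hM]; ring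
    rw [this, hε]
    field_simp
  have step : ∀ n : ℕ, h (((n + 1) * k + 1 : ℕ) * ω) ≤
      max (h ((n * k + 1 : ℕ) * ω)) (S + n * (m * L) + b) + L := by
    intro n
    have W := U.toCore.shift X (n * k)
    have W1 := U.toCore.shift X (n * k + 1)
    have h0 : ∀ x, S + n * (m * L) ≤ x → u (0 + (n * k + 1 : ℕ) * ω) x ≤ Real.exp (K * ω) * ε := by
      intro x hx
      have h1 := W.upperPs X hω.le x
      have h2 := mul_le_mul_of_nonneg_left (hS n x hx) (Real.exp_pos (K * ω)).le
      have e1 : ω + (n * k : ℕ) * ω = 0 + (n * k + 1 : ℕ) * ω := by push_cast; ring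
      rw [e1, zero_add ((n * k : ℕ) * ω)] at h1
      exact h1.trans h2
    have h1 := Hb _ _ (S + n * (m * L)) W1 h0
    have h2 := front hμ X W1 hEp hl hKl (x0 := S + n * (m * L) + b) h1 (k * ω) hkω.le le_rfl
    have e1 : k * ω + (n * k + 1 : ℕ) * ω = ((n + 1) * k + 1 : ℕ) * ω := by push_cast; ring
    rw [e1, zero_add] at h2
    linarith
  set A := max (h ((0 * k + 1 : ℕ) * ω)) (S + b) with hA
  have ind : ∀ n : ℕ, h ((n * k + 1 : ℕ) * ω) ≤ A + n * (m * L) := by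
    intro n
    induction n with
    | zero =>
      rw [Nat.cast_zero (R := ℝ), zero_mul (m * L), add_zero]
      exact le_max_left _ _
    | succ n ih =>
      have h1 := step n
      have h2 : max (h ((n * k + 1 : ℕ) * ω)) (S + n * (m * L) + b) ≤ A + n * (m * L) := by
        apply max_le ih
        have : S + b ≤ A := le_max_right _ _
        linarith
      push_cast at h1 h2 ⊢
      nlinarith
  refine ⟨A + m * L, fun t ht => ?_⟩
  obtain ⟨n, r, hr0, hr, rfl⟩ := exists_div hkω ht
  have h1 := ind (n + 1)
  have h2 : h (r + n * (k * ω)) ≤ h (((n + 1) * k + 1 : ℕ) * ω) := by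
    apply U.mono ht
    push_cast
    nlinarith
  have h3 : m * L / (k * ω) * (r + n * (k * ω)) = m * L / (k * ω) * r + n * (m * L) := by
    field_simp
  have h4 : 0 ≤ m * L / (k * ω) * r := by positivity
  rw [h3]
  push_cast at h1 h2
  linarith

end

section

variable {d μ ω L R K pm : ℝ} {f : ℝ → ℝ → ℝ → ℝ} {p u v : ℝ → ℝ → ℝ} {h g : ℝ → ℝ}

def Inn (p : ℝ → ℝ → ℝ) (c0 : ℝ) (u : ℝ → ℝ → ℝ) : Prop :=
  ∀ c < c0, ∀ ε > 0, ∃ T, ∀ t ≥ T, ∀ x ≤ c * t, p t x - ε ≤ u t x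

def Out (c0 : ℝ) (h : ℝ → ℝ) : Prop := ∀ c > c0, ∃ A T : ℝ, ∀ t ≥ T, h t ≤ A + c * t

lemma Inn.shift (X : Ctx d ω L R K pm f p) {c0 : ℝ} (H : Inn p c0 u) (n : ℕ)
    (hle : ∀ t, 0 ≤ t → ∀ x, u t x ≤ v (t + n * ω) x) : Inn p c0 v := by
  intro c hc ε hε
  obtain ⟨c', hc1, hc2⟩ := exists_between hc
  obtain ⟨T, hT⟩ := H c' hc2 ε hε
  have hcc : 0 < c' - c := by linarith
  refine ⟨max (n * ω + max 0 T) (c' * (n * ω) / (c' - c)), fun t ht x hx => ?_⟩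
  have h1 := (le_max_left _ _).trans ht
  have h2 := (le_max_right _ _).trans ht
  rw [div_le_iff₀ hcc] at h2
  have h3 := le_max_left 0 T
  have h4 := le_max_right 0 T
  have h5 := hT (t - n * ω) (by linarith) x (by nlinarith)
  have h6 := hle (t - n * ω) (by linarith) x
  rw [sub_add_cancel] at h6
  have h7 := X.pn n (t - n * ω) x
  rw [sub_add_cancel] at h7
  linarith

lemma Out.shift {c0 : ℝ} (H : Out c0 h) (a T0 : ℝ) (hle : ∀ t, T0 ≤ t → g t ≤ h (t + a)) : Out c0 g := by
  intro c hc
  obtain ⟨A, T, hA⟩ := H c hc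
  refine ⟨A + c * a, max T0 (T - a), fun t ht => ?_⟩
  have h1 := (le_max_left _ _).trans ht
  have h2 := (le_max_right _ _).trans ht
  have h3 := hle t h1
  have h4 := hA (t + a) (by linarith)
  linarith

lemma Full.ref (hμ : 0 < μ) (X : Ctx d ω L R K pm f p) (U : Full d μ ω f p u h) :
    ∃ c0 > 0, Inn p c0 u ∧ Out c0 h := by
  have hL := X.hL
  have hω := X.hω
  obtain ⟨σ, hσ0, hσ1, hσ2⟩ := U.speed hμ X
  refine ⟨σ * L / ω, by positivity, ?_, ?_⟩
  · intro c hc ε hε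
    rw [lt_div_iff₀ hω] at hc
    obtain ⟨n, hn, j, D, hj⟩ := hσ2 (c * ω / L) (by rwa [div_lt_iff₀ hL])
    have hj' : c * (n * ω) < j * L := by
      have := mul_lt_mul_of_pos_right hj hL
      have e : c * ω / L * n * L = c * (n * ω) := by field_simp
      linarith
    obtain ⟨T, -, hT⟩ := U.inner hμ X hn D hj' hε
    exact ⟨T, hT⟩
  · intro c hc
    have hc : σ * L / ω < c := hc
    have hc' : σ < c * ω / L := by
      rw [div_lt_iff₀ hω] at hc
      rwa [lt_div_iff₀ hL]
    obtain ⟨q, hq1, hq2⟩ := exists_rat_btwn hc'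
    have hq0 : 0 < q := by
      have : (0 : ℝ) < q := hσ0.trans hq1
      exact_mod_cast this
    have hden : (0 : ℝ) < q.den := by exact_mod_cast q.den_pos
    have hqe : (q : ℝ) = (q.num.toNat : ℝ) / q.den := by
      have h1 : ((q.num.toNat : ℤ)) = q.num := Int.toNat_of_nonneg (Rat.num_nonneg.2 hq0.le)
      have h2 : ((q.num.toNat : ℕ) : ℝ) = ((q.num : ℤ) : ℝ) := by exact_mod_cast congrArg (Int.cast (R := ℝ)) h1
      rw [h2]
      exact Rat.cast_def q
    rw [hqe] at hq1 hq2
    obtain ⟨A, hA⟩ := U.outer hμ X hσ0 hσ1 (m := q.num.toNat) (k := q.den) q.den_pos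
      (by rwa [lt_div_iff₀ hden] at hq1)
    refine ⟨A, 0, fun t ht => (hA t ht).trans ?_⟩
    have : (q.num.toNat : ℝ) * L / (q.den * ω) ≤ c := by
      rw [div_lt_div_iff₀ hden hL] at hq2
      rw [div_le_iff₀ (by positivity)]
      nlinarith
    have := mul_le_mul_of_nonneg_right this ht
    linarith

lemma Full.dom (hμ : 0 < μ) (X : Ctx d ω L R K pm f p) (V : Full d μ ω f p v g) (U : Full d μ ω f p u h) :
    ∃ N : ℕ, ∀ t, 0 ≤ t → g t ≤ h (t + N * ω) ∧ ∀ x, v t x ≤ u (t + N * ω) x := by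
  obtain ⟨θ, hθ, hg⟩ := V.gap
  obtain ⟨N, hN⟩ := U.conv (g 0) (θ / 2) (by positivity)
  refine ⟨N, comp hμ X V.toCore (U.toCore.shift X N) fun x hx => ?_⟩
  have h1 := (abs_le.1 (hN N le_rfl x hx)).1
  have h2 := hg x
  rw [zero_add]
  linarith

lemma conclude (X : Ctx d ω L R K pm f p) {c0 : ℝ} (hI : Inn p c0 u) (hO : Out c0 h)
    {T0 : ℝ} (hup : ∀ t, T0 ≤ t → ∀ x, u t x ≤ p t x) (hz : ∀ t, T0 ≤ t → ∀ x, h t < x → u t x = 0) :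
    (∀ c < c0, ∀ ε > 0, ∃ T, ∀ t ≥ T, ∀ x ≤ c * t, |u t x - p t x| ≤ ε) ∧
      Tendsto (fun t => h t / t) atTop (𝓝 c0) := by
  have hpm := X.hpm
  constructor
  · intro c hc ε hε
    obtain ⟨T, hT⟩ := hI c hc ε hε
    refine ⟨max T T0, fun t ht x hx => ?_⟩
    have h1 := hT t ((le_max_left _ _).trans ht) x hx
    have h2 := hup t ((le_max_right _ _).trans ht) x
    rw [abs_le]
    constructor <;> linarith
  · rw [tendsto_order]
    constructor
    · intro a ha
      obtain ⟨c, hc1, hc2⟩ := exists_between ha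
      obtain ⟨T, hT⟩ := hI c hc2 (pm / 2) (by positivity)
      filter_upwards [eventually_ge_atTop T, eventually_ge_atTop T0, eventually_gt_atTop 0] with t h1 h2 h3
      rw [lt_div_iff₀ h3]
      have h4 := hT t h1 (c * t) le_rfl
      have h5 := X.pge t (c * t)
      have h6 : c * t ≤ h t := by
        by_contra hlt
        push Not at hlt
        rw [hz t h2 _ hlt] at h4
        linarith
      nlinarith
    · intro a ha
      obtain ⟨c, hc1, hc2⟩ := exists_between ha
      obtain ⟨A, T, hT⟩ := hO c hc1
      have hac : 0 < a - c := by linarith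
      filter_upwards [eventually_ge_atTop T, eventually_gt_atTop (A / (a - c)), eventually_gt_atTop 0] with t h1 h2 h3
      rw [div_lt_iff₀ h3]
      rw [div_lt_iff₀ hac] at h2
      have := hT t h1
      linarith

end

/-- Theorem 3.11: existence of the rightward spreading speed `c₊*` for the half-line
free boundary problem (1.10). -/
theorem half_line_rightward_spreading_speed
    (d μ ω L : ℝ) (hd : 0 < d) (hμ : 0 < μ) (hω : 0 < ω) (hL : 0 < L)
    (f : ℝ → ℝ → ℝ → ℝ) (hf : BasicAssumptions ω L f)
    (p : ℝ → ℝ → ℝ) (hp : HypH d ω L f p) :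
    ∃ cstar > (0:ℝ),
      ∀ (h₀ : ℝ) (u₀ : ℝ → ℝ), memHplus h₀ u₀ →
      (∀ x ≤ h₀, u₀ x ≤ p 0 x) →
      (∃ ε > (0:ℝ), ∃ X : ℝ, ∀ x ≤ X, ε ≤ p 0 x - u₀ x) →
      ∀ (u : ℝ → ℝ → ℝ) (h : ℝ → ℝ), IsHalfFBPSolution d μ f h₀ u₀ u h →
      (∀ C : ℝ, ∀ ε > 0, ∃ N : ℕ, ∀ n : ℕ, N ≤ n → ∀ x ≤ C,
        |u ((n : ℝ) * ω) x - p 0 x| ≤ ε) →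
      (∀ c < cstar, ∀ ε > 0, ∃ T, ∀ t ≥ T, ∀ x ≤ c * t, |u t x - p t x| ≤ ε) ∧
      Tendsto (fun t => h t / t) atTop (𝓝 cstar) := by

  obtain ⟨R, K, pm, X⟩ := ctx_exists hd hω hL hf hp
  have key : ∀ (h₀ : ℝ) (u₀ : ℝ → ℝ), memHplus h₀ u₀ →
      (∀ x ≤ h₀, u₀ x ≤ p 0 x) →
      (∃ ε > (0:ℝ), ∃ X : ℝ, ∀ x ≤ X, ε ≤ p 0 x - u₀ x) →
      ∀ (u : ℝ → ℝ → ℝ) (h : ℝ → ℝ), IsHalfFBPSolution d μ f h₀ u₀ u h →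
      (∀ C : ℝ, ∀ ε > 0, ∃ N : ℕ, ∀ n : ℕ, N ≤ n → ∀ x ≤ C,
        |u ((n : ℝ) * ω) x - p 0 x| ≤ ε) →
      ∃ (v : ℝ → ℝ → ℝ) (g : ℝ → ℝ) (n : ℕ), Full d μ ω f p v g ∧
        (∀ t, 0 ≤ t → g t = h (t + n * ω)) ∧ ∀ t, 0 ≤ t → ∀ x, v t x = u (t + n * ω) x := by
    intro h₀ u₀ hu₀ hle hgap u h hu hconv
    obtain ⟨n, F⟩ := (pre_of_sol hf X hu₀ hle hgap hu hconv).full hμ X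
    refine ⟨_, _, n, F, ?_, ?_⟩
    · intro t ht
      have : 0 ≤ t + n * ω := by positivity
      simp only [max_eq_left this]
    · intro t ht x
      have : 0 ≤ t + n * ω := by positivity
      simp only [max_eq_left this]
  by_cases hex : ∃ (u : ℝ → ℝ → ℝ) (h : ℝ → ℝ), Full d μ ω f p u h
  · obtain ⟨ur, hr, U⟩ := hex
    obtain ⟨c0, hc0, hI, hO⟩ := U.ref hμ X
    refine ⟨c0, hc0, ?_⟩
    intro h₀ u₀ hu₀ hle hgap u h hu hconv
    obtain ⟨v, g, n, V, hg, hv⟩ := key h₀ u₀ hu₀ hle hgap u h hu hconv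
    obtain ⟨N, hN⟩ := Full.dom hμ X V U
    obtain ⟨N', hN'⟩ := Full.dom hμ X U V
    have hnω : 0 ≤ n * ω := by positivity
    have hOg : Out c0 g := hO.shift (N * ω) 0 (fun t ht => (hN t ht).1)
    have hIv : Inn p c0 v := hI.shift X N' (fun t ht => (hN' t ht).2)
    have hOh : Out c0 h := hOg.shift (-(n * ω)) (n * ω) (fun t ht => by
      rw [hg _ (by linarith), neg_add_cancel_right])
    have hIu : Inn p c0 u := hIv.shift X n (fun t ht x => (hv t ht x).le)
    refine conclude X hIu hOh (T0 := n * ω) ?_ ?_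
    · intro t ht x
      have h1 := V.up (t - n * ω) (by linarith) x
      rw [hv _ (by linarith), sub_add_cancel] at h1
      have h2 := X.pn n (t - n * ω) x
      rw [sub_add_cancel] at h2
      linarith
    · intro t ht x hx
      exact hu.ext t (hnω.trans ht) x hx
  · refine ⟨1, one_pos, ?_⟩
    intro h₀ u₀ hu₀ hle hgap u h hu hconv
    obtain ⟨v, g, n, V, -, -⟩ := key h₀ u₀ hu₀ hle hgap u h hu hconv
    exact absurd ⟨v, g, V⟩ hex
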